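/- For every real η > 0 there exists a natural number n₀ such that the following holds: if H is a 3-uniform hypergraph on n ≥ n₀ vertices whose minimum vertex degree satisfies δ(H) ≥ (5/9 + η)·(n choose 2), then H contains a tight cycle of length at least (1 − η)·n. -/

import Mathlib

namespace TightCycle
open Finset
open scoped Classical

section Inseparable
variable {V : Type}

/-- The total weight `g` puts on `S × T`. -/
noncomputable def weight (g : V → V → ℝ) (S T : Finset V) : ℝ := ∑ x ∈ S, ∑ y ∈ T, g x y

lemma weight_comm {g : V → V → ℝ} (hs : ∀ x y, g x y = g y x) (S T : Finset V) :
    weight g S T = weight g T S := by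
  unfold weight
  rw [Finset.sum_comm]
  simp_rw [hs]

lemma weight_nonneg {g : V → V → ℝ} (h0 : ∀ x y, 0 ≤ g x y) (S T : Finset V) :
    0 ≤ weight g S T :=
  sum_nonneg fun _ _ => sum_nonneg fun _ _ => h0 _ _

lemma weight_le {g : V → V → ℝ} (h1 : ∀ x y, g x y ≤ 1) (S T : Finset V) :
    weight g S T ≤ #S * #T := by
  unfold weight
  calc _ ≤ ∑ x ∈ S, ∑ y ∈ T, (1 : ℝ) := sum_le_sum fun _ _ => sum_le_sum fun _ _ => h1 _ _
    _ = _ := by simp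

lemma weight_mono {g : V → V → ℝ} (h0 : ∀ x y, 0 ≤ g x y) {S S' T T' : Finset V} (h : S ⊆ S')
    (h' : T ⊆ T') : weight g S T ≤ weight g S' T' := by
  unfold weight
  calc _ ≤ ∑ x ∈ S, ∑ y ∈ T', g x y :=
        sum_le_sum fun _ _ => sum_le_sum_of_subset_of_nonneg h' fun _ _ _ => h0 _ _
    _ ≤ _ := sum_le_sum_of_subset_of_nonneg h fun _ _ _ => sum_nonneg fun _ _ => h0 _ _

lemma weight_union_left {g : V → V → ℝ} {S S' : Finset V} (h : Disjoint S S') (T : Finset V) :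
    weight g (S ∪ S') T = weight g S T + weight g S' T := by
  unfold weight
  rw [sum_union h]

lemma weight_union_right {g : V → V → ℝ} (S : Finset V) {T T' : Finset V} (h : Disjoint T T') :
    weight g S (T ∪ T') = weight g S T + weight g S T' := by
  unfold weight
  rw [← sum_add_distrib]
  exact sum_congr rfl fun _ _ => sum_union h

lemma weight_union_left_le {g : V → V → ℝ} (h0 : ∀ x y, 0 ≤ g x y) (S S' T : Finset V) :
    weight g (S ∪ S') T ≤ weight g S T + weight g S' T := by
  rw [← union_sdiff_self_eq_union, weight_union_left disjoint_sdiff]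
  have := weight_mono h0 (sdiff_subset (s := S') (t := S)) (subset_refl T)
  linarith

lemma weight_union_right_le {g : V → V → ℝ} (h0 : ∀ x y, 0 ≤ g x y) (S T T' : Finset V) :
    weight g S (T ∪ T') ≤ weight g S T + weight g S T' := by
  rw [← union_sdiff_self_eq_union, weight_union_right _ disjoint_sdiff]
  have := weight_mono h0 (subset_refl S) (sdiff_subset (s := T') (t := T))
  linarith

/-- A graph of density above `5/9` has an inseparable induced subgraph on more than two thirds
of the vertices that keeps almost all edges it possibly could. -/
lemma exists_inseparable [Fintype V] {g : V → V → ℝ} (hs : ∀ x y, g x y = g y x) (h0 : ∀ x y, 0 ≤ g x y)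
    (h1 : ∀ x y, g x y ≤ 1) {α μ : ℝ} (hμ : 0 < μ) (hμα : μ ≤ α / 4)
    (hn : 0 < Fintype.card V)
    (he : (5 / 9 + α) * (Fintype.card V : ℝ) ^ 2 ≤ weight g univ univ) :
    ∃ X : Finset V, 2 * (Fintype.card V : ℝ) < 3 * #X ∧
      (5 / 9 + α / 2) * (Fintype.card V : ℝ) ^ 2 - (Fintype.card V - #X : ℝ) ^ 2 ≤ weight g X X ∧
      ∀ A ⊆ X, μ * #A * #(X \ A) ≤ weight g A (X \ A) := by
  set n : ℝ := (Fintype.card V : ℝ) with hndef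
  have hnpos : 0 < n := by simpa [hndef] using (Nat.cast_pos (α := ℝ)).2 hn
  let Q : Finset V → Prop := fun X => n < 3 * #X ∧
    (5 / 9 + α) * n ^ 2 - (n - #X) ^ 2 - 2 * μ * (n - #X) * n ≤ weight g X X
  have hQV : Q univ := by
    refine ⟨?_, ?_⟩
    · rw [card_univ, ← hndef]; linarith
    · rw [card_univ, ← hndef]; simpa using he
  have hcard : ∀ X : Finset V, (#X : ℝ) ≤ n := fun X => by
    rw [hndef]; exact_mod_cast card_le_univ X
  have hbig : ∀ X, Q X → 2 * n < 3 * #X := by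
    rintro X ⟨hX1, hX2⟩
    have h3 := weight_le h1 X X
    have h4 := hcard X
    by_contra hcon
    push Not at hcon
    have h5 : (3 * (#X : ℝ) - n) * (3 * #X - 2 * n) ≤ 0 :=
      mul_nonpos_of_nonneg_of_nonpos (by linarith) (by linarith)
    have h6 : 0 ≤ (α - 4 * μ) * n ^ 2 := mul_nonneg (by linarith) (by positivity)
    have h7 : 0 < μ * n ^ 2 := by positivity
    have h8 : μ * (n - #X) * n ≤ μ * n ^ 2 := by
      have : 0 ≤ μ * #X * n := by positivity
      nlinarith
    nlinarith
  obtain ⟨X, hXmem, hXmin⟩ := exists_min_image (univ.filter Q) (fun X => #X)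
    ⟨univ, by simpa using hQV⟩
  have hQX : Q X := by simpa using hXmem
  have hmin : ∀ Y, Q Y → #X ≤ #Y := fun Y hY => hXmin Y (by simpa using hY)
  have hXb := hbig X hQX
  refine ⟨X, hXb, ?_, ?_⟩
  · have h2 := hQX.2
    have h4 := hcard X
    have : 2 * μ * (n - #X) * n ≤ α / 2 * n ^ 2 := by
      have h5 : μ * ((n - #X) * n) ≤ α / 4 * (n * n) :=
        mul_le_mul hμα (mul_le_mul_of_nonneg_right (by linarith [(#X).cast_nonneg (α := ℝ)])
          hnpos.le) (mul_nonneg (by linarith) hnpos.le) (by linarith)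
      nlinarith
    linarith
  have key : ∀ A ⊆ X, (#(X \ A) : ℝ) ≤ #A → μ * #A * #(X \ A) ≤ weight g A (X \ A) := by
    intro A hA hle
    by_contra hcon
    push Not at hcon
    have hB : 0 < #(X \ A) := by
      rcases Nat.eq_zero_or_pos (#(X \ A)) with h | h
      · rw [h] at hcon
        have := weight_nonneg h0 A (X \ A)
        simp at hcon; linarith
      · exact h
    have hsum : (#X : ℝ) = #A + #(X \ A) := by
      have := card_sdiff_add_card_eq_card hA
      rw [← this]; push_cast; ring
    have hlt : #A < #X := by
      have := card_sdiff_add_card_eq_card hA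
      omega
    have hwX : weight g X X = weight g A A + 2 * weight g A (X \ A) +
        weight g (X \ A) (X \ A) := by
      conv_lhs => rw [← union_sdiff_of_subset hA]
      rw [weight_union_left disjoint_sdiff, weight_union_right _ disjoint_sdiff,
        weight_union_right _ disjoint_sdiff, weight_comm hs (X \ A) A]
      ring
    have hwB := weight_le h1 (X \ A) (X \ A)
    have hBpos : (0 : ℝ) < #(X \ A) := by exact_mod_cast hB
    have hxn := hcard X
    have han := hcard A
    have hQA : Q A := by
      refine ⟨by linarith, ?_⟩
      have h2 := hQX.2
      set a : ℝ := (#A : ℝ)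
      set b : ℝ := (#(X \ A) : ℝ)
      rw [hsum] at h2 hxn
      have e1 : 0 ≤ (n - (a + b)) * b := mul_nonneg (by linarith) hBpos.le
      have e2 : 0 ≤ μ * b * (n - a) := by
        apply mul_nonneg (by positivity); linarith
      nlinarith
    exact absurd (hmin A hQA) (by omega)
  intro A hA
  rcases le_total (#(X \ A) : ℝ) (#A) with h | h
  · exact key A hA h
  · have h2 := key (X \ A) sdiff_subset (by rwa [Finset.sdiff_sdiff_eq_self hA])
    rw [Finset.sdiff_sdiff_eq_self hA] at h2
    rw [weight_comm hs]
    linarith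

end Inseparable

section Expansion
variable {V : Type}

lemma weight_singleton (g : V → V → ℝ) (v : V) (T : Finset V) :
    weight g {v} T = ∑ y ∈ T, g v y := by
  simp [weight]

set_option maxHeartbeats 1000000 in
/-- Two interleaved monotone sequences of subsets of an inseparable, far from bipartite vertex
set that absorb all vertices with many neighbours in them exhaust the vertex set. -/
lemma expansion_exhausts [Fintype V] {g : V → V → ℝ} (hs : ∀ x y, g x y = g y x)
    (h0 : ∀ x y, 0 ≤ g x y) (h1 : ∀ x y, g x y ≤ 1) {μ θ : ℝ} (hμ : 0 < μ) (hμ1 : μ ≤ 1)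
    (hθ : θ = μ ^ 2 / 4000) {X : Finset V} (hX : 2 * (Fintype.card V : ℝ) < 3 * #X)
    (hlow : 5 / 9 * (Fintype.card V : ℝ) ^ 2 - (Fintype.card V - #X : ℝ) ^ 2 ≤ weight g X X)
    (hins : ∀ A ⊆ X, μ * #A * #(X \ A) ≤ weight g A (X \ A))
    (hdeg : ∀ v ∈ X, μ / 2 * Fintype.card V ≤ ∑ y ∈ X, g v y)
    {A B : ℕ → Finset V} (hA : ∀ i, A i ⊆ X) (hB : ∀ i, B i ⊆ X)
    (hAm : ∀ i, A i ⊆ A (i + 1))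
    (hAB : ∀ i, ∀ v ∈ X, θ * Fintype.card V ≤ ∑ y ∈ A i, g v y → v ∈ B i)
    (hBA : ∀ i, ∀ v ∈ X, θ * Fintype.card V ≤ ∑ y ∈ B i, g v y → v ∈ A (i + 1))
    (hA0 : μ / 2 * Fintype.card V ≤ #(A 0)) {I : ℕ} (hI : 1 < I * θ) :
    A I = X := by
  set n : ℝ := (Fintype.card V : ℝ) with hndef
  have hcard : ∀ Y : Finset V, (#Y : ℝ) ≤ n := fun Y => by
    rw [hndef]; exact_mod_cast card_le_univ Y
  have hxn := hcard X
  have hn : 0 < n := by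
    by_contra h
    have : (0 : ℝ) ≤ #X := by positivity
    linarith
  have hθpos : 0 < θ := by rw [hθ]; positivity
  have hmono : Monotone A := monotone_nat_of_le_succ hAm
  obtain ⟨i, hiI, hi⟩ : ∃ i < I, (#(A (i + 1)) : ℝ) - #(A i) < θ * n := by
    by_contra! hcon
    have : ∀ i ≤ I, i * (θ * n) ≤ (#(A i) : ℝ) := by
      intro i
      induction i with
      | zero => intro _; simp
      | succ k ih =>
        intro hk
        have := ih (by omega)
        have := hcon k (by omega)
        push_cast
        linarith
    have h2 := this I le_rfl
    have h3 := hcard (A I)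
    nlinarith
  have hAB' : weight g (A i) (X \ B i) ≤ θ * n ^ 2 := by
    rw [weight_comm hs]
    unfold weight
    calc _ ≤ ∑ v ∈ X \ B i, θ * n := by
          refine sum_le_sum fun v hv => ?_
          rw [mem_sdiff] at hv
          by_contra! h
          exact hv.2 (hAB i v hv.1 h.le)
      _ ≤ θ * n ^ 2 := by
          rw [sum_const, nsmul_eq_mul]
          have := hcard (X \ B i)
          nlinarith [mul_le_mul_of_nonneg_right this (by positivity : 0 ≤ θ * n)]
  have hBA' : weight g (B i) (X \ A i) ≤ 2 * θ * n ^ 2 := by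
    have hsplit : X \ A i ⊆ (A (i + 1) \ A i) ∪ (X \ A (i + 1)) := by
      intro v hv
      rw [mem_sdiff] at hv
      by_cases h : v ∈ A (i + 1)
      · exact mem_union_left _ (mem_sdiff.2 ⟨h, hv.2⟩)
      · exact mem_union_right _ (mem_sdiff.2 ⟨hv.1, h⟩)
    have hw1 : weight g (B i) (A (i + 1) \ A i) ≤ θ * n ^ 2 := by
      have h2 := weight_le h1 (B i) (A (i + 1) \ A i)
      have h3 : (#(A (i + 1) \ A i) : ℝ) ≤ θ * n := by
        rw [cast_card_sdiff (hAm i)]; exact hi.le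
      have h4 := mul_le_mul (hcard (B i)) h3 (by positivity) hn.le
      nlinarith
    have hw2 : weight g (B i) (X \ A (i + 1)) ≤ θ * n ^ 2 := by
      rw [weight_comm hs]
      unfold weight
      calc _ ≤ ∑ v ∈ X \ A (i + 1), θ * n := by
            refine sum_le_sum fun v hv => ?_
            rw [mem_sdiff] at hv
            by_contra! h
            exact hv.2 (hBA i v hv.1 h.le)
        _ ≤ θ * n ^ 2 := by
            rw [sum_const, nsmul_eq_mul]
            have := hcard (X \ A (i + 1))
            nlinarith [mul_le_mul_of_nonneg_right this (by positivity : 0 ≤ θ * n)]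
    have h5 := weight_mono h0 (subset_refl (B i)) hsplit
    have h6 := weight_union_right_le h0 (B i) (A (i + 1) \ A i) (X \ A (i + 1))
    linarith
  set P := A i ∩ B i with hP
  set Z := X \ (A i ∪ B i) with hZ
  have hPX : P ⊆ X := inter_subset_left.trans (hA i)
  have hZX : Z ⊆ X := sdiff_subset
  have hPw : μ * #P * #(X \ P) ≤ 3 * θ * n ^ 2 := by
    have h2 := hins P hPX
    have h3 : X \ P ⊆ (X \ A i) ∪ (X \ B i) := by
      intro v hv
      simp only [hP, mem_sdiff, mem_inter, mem_union] at hv ⊢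
      tauto
    have h4 := weight_mono h0 (subset_refl P) h3
    have h5 := weight_union_right_le h0 P (X \ A i) (X \ B i)
    have h6 := weight_mono h0 (inter_subset_right : P ⊆ B i) (subset_refl (X \ A i))
    have h7 := weight_mono h0 (inter_subset_left : P ⊆ A i) (subset_refl (X \ B i))
    linarith
  have hZw : μ * #Z * #(X \ Z) ≤ 3 * θ * n ^ 2 := by
    have h2 := hins Z hZX
    have h3 : X \ Z = A i ∪ B i := by
      rw [hZ, Finset.sdiff_sdiff_eq_self (union_subset (hA i) (hB i))]
    rw [h3] at h2 ⊢
    have h5 := weight_union_right_le h0 Z (A i) (B i)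
    have h6 : Z ⊆ X \ B i := sdiff_subset_sdiff (subset_refl _) subset_union_right
    have h7 : Z ⊆ X \ A i := sdiff_subset_sdiff (subset_refl _) subset_union_left
    have h8 := weight_mono h0 h6 (subset_refl (A i))
    have h9 := weight_mono h0 h7 (subset_refl (B i))
    rw [weight_comm hs (X \ B i)] at h8
    rw [weight_comm hs (X \ A i)] at h9
    linarith
  have hZsmall : (#Z : ℝ) ≤ 6 * θ / μ ^ 2 * n := by
    have h2 : μ / 2 * n ≤ #(X \ Z) := by
      refine hA0.trans ?_
      have : A 0 ⊆ X \ Z := by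
        rw [hZ, Finset.sdiff_sdiff_eq_self (union_subset (hA i) (hB i))]
        exact (hmono (Nat.zero_le i)).trans subset_union_left
      exact_mod_cast card_le_card this
    have h3 : μ * #Z * (μ / 2 * n) ≤ 3 * θ * n ^ 2 :=
      (mul_le_mul_of_nonneg_left h2 (by positivity)).trans hZw
    have h4 : (#Z : ℝ) * μ ^ 2 ≤ 6 * θ * n := by
      by_contra! h
      nlinarith
    rw [div_mul_eq_mul_div, le_div_iff₀ (by positivity)]
    exact h4
  have hZs : (#Z : ℝ) ≤ 6 / 4000 * n := by
    convert hZsmall using 2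
    rw [hθ]; field_simp
  have hsumP : (#X : ℝ) = #P + #(X \ P) := by
    rw [cast_card_sdiff hPX]; ring
  have hPlarge : (#(X \ P) : ℝ) ≤ 9 * θ / μ * n := by
    by_contra! hcon
    have hPsmall : (#P : ℝ) ≤ 9 * θ / μ * n := by
      by_contra! hcon2
      have hd : 0 < 9 * θ / μ * n := by positivity
      have key : ∀ p q : ℝ, n / 3 ≤ p → 9 * θ / μ * n < q → 0 ≤ p → 3 * θ * n ^ 2 < μ * p * q := by
        intro p q hp hq hp0
        have : μ * (n / 3) * (9 * θ / μ * n) = 3 * θ * n ^ 2 := by field_simp; norm_num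
        rw [← this]
        have h2 : μ * (n / 3) ≤ μ * p := by gcongr
        have h3 : 0 < μ * (n / 3) := by positivity
        nlinarith
      rcases le_total (#P : ℝ) (#(X \ P)) with h | h
      · have := key (#(X \ P)) (#P) (by linarith) hcon2 (by positivity)
        nlinarith
      · have := key (#P) (#(X \ P)) (by linarith) hcon (by positivity)
        nlinarith
    have hPs : (#P : ℝ) ≤ 9 / 4000 * n := by
      refine hPsmall.trans ?_
      have : 9 * θ / μ = 9 / 4000 * μ := by rw [hθ]; field_simp
      rw [this]; nlinarith
    set Q := A i \ B i with hQ
    set R := B i \ A i with hR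
    have hcov : X ⊆ (P ∪ Z) ∪ (Q ∪ R) := by
      intro v hv
      simp only [hP, hZ, hQ, hR, mem_union, mem_inter, mem_sdiff]
      tauto
    have hQR : Disjoint Q R := by
      rw [disjoint_left]
      intro v hv hv'
      rw [hQ, mem_sdiff] at hv
      rw [hR, mem_sdiff] at hv'
      exact hv.2 hv'.1
    have hQX : Q ⊆ X \ B i := sdiff_subset_sdiff (hA i) (subset_refl _)
    have hRX : R ⊆ X \ A i := sdiff_subset_sdiff (hB i) (subset_refl _)
    have hQRX : Q ∪ R ⊆ X := union_subset (hQX.trans sdiff_subset) (hRX.trans sdiff_subset)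
    have hcQR : (#Q : ℝ) + #R ≤ #X := by
      have := card_le_card hQRX
      rw [card_union_of_disjoint hQR] at this
      exact_mod_cast this
    have hqq := weight_mono h0 (sdiff_subset : Q ⊆ A i) hQX
    have hrr := weight_mono h0 (sdiff_subset : R ⊆ B i) hRX
    have hqr := weight_le h1 Q R
    have hww : weight g (Q ∪ R) (Q ∪ R) ≤ 3 * θ * n ^ 2 + (#X : ℝ) ^ 2 / 2 := by
      rw [weight_union_left hQR, weight_union_right _ hQR, weight_union_right _ hQR,
        weight_comm hs R Q]
      nlinarith [sq_nonneg ((#Q : ℝ) - #R), (#Q).cast_nonneg (α := ℝ), (#R).cast_nonneg (α := ℝ)]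
    have hPZ : (#(P ∪ Z) : ℝ) ≤ 15 / 4000 * n := by
      have : (#(P ∪ Z) : ℝ) ≤ #P + #Z := by exact_mod_cast card_union_le P Z
      linarith
    have hXX : weight g X X ≤ 30 / 4000 * n ^ 2 + (3 * θ * n ^ 2 + (#X : ℝ) ^ 2 / 2) := by
      have e1 := weight_mono h0 (subset_refl X) hcov
      have e2 := weight_union_right_le h0 X (P ∪ Z) (Q ∪ R)
      have e3 := weight_mono h0 hcov (subset_refl (Q ∪ R))
      have e4 := weight_union_left_le h0 (P ∪ Z) (Q ∪ R) (Q ∪ R)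
      have e5 := weight_le h1 X (P ∪ Z)
      have e6 := weight_le h1 (P ∪ Z) (Q ∪ R)
      have e7 := mul_le_mul hxn hPZ (by positivity) hn.le
      have e8 := mul_le_mul hPZ (hcard (Q ∪ R)) (by positivity) (by positivity)
      nlinarith
    have hθs : θ ≤ 1 / 4000 := by rw [hθ]; nlinarith
    have hθn : θ * n ^ 2 ≤ 1 / 4000 * n ^ 2 := by gcongr
    have : (3 * (#X : ℝ) - 2 * n) * (n - #X) ≥ 0 := mul_nonneg (by linarith) (by linarith)
    nlinarith
  have hfin : A (i + 1) = X := by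
    refine subset_antisymm (hA _) fun v hv => hBA i v hv ?_
    have hPB : ∑ y ∈ P, g v y ≤ ∑ y ∈ B i, g v y :=
      sum_le_sum_of_subset_of_nonneg inter_subset_right fun _ _ _ => h0 _ _
    have hsp : ∑ y ∈ X, g v y = ∑ y ∈ X \ P, g v y + ∑ y ∈ P, g v y :=
      (sum_sdiff hPX).symm
    have hle : ∑ y ∈ X \ P, g v y ≤ #(X \ P) := by
      calc _ ≤ ∑ y ∈ X \ P, (1 : ℝ) := sum_le_sum fun _ _ => h1 _ _
        _ = _ := by simp
    have hd := hdeg v hv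
    have h9 : 9 * θ / μ = 9 / 4000 * μ := by rw [hθ]; field_simp
    rw [h9] at hPlarge
    have h10 : θ * n ≤ μ / 4000 * n := by
      rw [hθ]; gcongr; nlinarith
    nlinarith
  refine subset_antisymm (hA I) ?_
  rw [← hfin]
  exact hmono hiI

end Expansion

section Walks
variable {V : Type}

/-- `Walk G v l a`: the vertices `v`, `l`, `a` in this order form a walk in `G`. -/
def Walk (G : V → V → Prop) : V → List V → V → Prop
  | v, [], a => G v a
  | v, z :: l, a => G v z ∧ Walk G z l a

/-- Normalised adjacency operator. -/
noncomputable def avg [Fintype V] (g : V → V → ℝ) : Module.End ℝ (V → ℝ) where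
  toFun f v := (∑ z, g v z * f z) / Fintype.card V
  map_add' f f' := by
    ext v
    simp only [Pi.add_apply, mul_add, sum_add_distrib, add_div]
  map_smul' c f := by
    ext v
    simp only [Pi.smul_apply, smul_eq_mul, RingHom.id_apply, mul_div_assoc', mul_sum]
    congr 1
    exact sum_congr rfl fun _ _ => by ring

lemma avg_apply [Fintype V] (g : V → V → ℝ) (f : V → ℝ) (v : V) :
    avg g f v = (∑ z, g v z * f z) / Fintype.card V := rfl

lemma avg_nonneg [Fintype V] {g : V → V → ℝ} (h0 : ∀ x y, 0 ≤ g x y) {f : V → ℝ}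
    (hf : ∀ v, 0 ≤ f v) (v : V) : 0 ≤ avg g f v :=
  div_nonneg (sum_nonneg fun _ _ => mul_nonneg (h0 _ _) (hf _)) (by positivity)

lemma avg_ge [Fintype V] {g : V → V → ℝ} (h0 : ∀ x y, 0 ≤ g x y) {f : V → ℝ}
    (hf : ∀ v, 0 ≤ f v) {S : Finset V} {c θ : ℝ} (hc : 0 ≤ c) (hS : ∀ z ∈ S, c ≤ f z) {v : V}
    (hV : 0 < Fintype.card V) (hv : θ * Fintype.card V ≤ ∑ y ∈ S, g v y) : θ * c ≤ avg g f v := by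
  rw [avg_apply, le_div_iff₀ (by exact_mod_cast hV)]
  calc θ * c * Fintype.card V = θ * Fintype.card V * c := by ring
    _ ≤ (∑ y ∈ S, g v y) * c := mul_le_mul_of_nonneg_right hv hc
    _ = ∑ y ∈ S, g v y * c := by rw [sum_mul]
    _ ≤ ∑ y ∈ S, g v y * f y := sum_le_sum fun y hy =>
        mul_le_mul_of_nonneg_left (hS y hy) (h0 _ _)
    _ ≤ ∑ y, g v y * f y := sum_le_sum_of_subset_of_nonneg (subset_univ _) fun _ _ _ =>
        mul_nonneg (h0 _ _) (hf _)

lemma avg_pow_nonneg [Fintype V] {g : V → V → ℝ} (h0 : ∀ x y, 0 ≤ g x y) {f : V → ℝ}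
    (hf : ∀ v, 0 ≤ f v) (j : ℕ) (v : V) : 0 ≤ ((avg g) ^ j) f v := by
  induction j generalizing v with
  | zero => simpa using hf v
  | succ k ih =>
    rw [pow_succ', Module.End.mul_apply]
    exact avg_nonneg h0 ih v

lemma sum_fin_cons [Fintype V] {j : ℕ} (F : (Fin (j + 1) → V) → ℝ) :
    ∑ p, F p = ∑ z, ∑ p : Fin j → V, F (Fin.cons z p) := by
  rw [← Fintype.sum_prod_type']
  exact (Fintype.sum_equiv (Fin.consEquiv fun _ => V) _ _ fun _ => rfl).symm

lemma card_walk [Fintype V] (G : V → V → Prop) (hV : 0 < Fintype.card V) (a : V) (j : ℕ) (v : V) :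
    (#{p : Fin j → V | Walk G v (List.ofFn p) a} : ℝ) = (Fintype.card V : ℝ) ^ j *
      ((avg fun x y => if G x y then 1 else 0) ^ j) (fun z => if G z a then 1 else 0) v := by
  induction j generalizing v with
  | zero =>
    simp only [Walk, pow_zero, one_mul, List.ofFn_zero, Module.End.one_apply]
    split_ifs with h <;> simp [h]
  | succ k ih =>
    have hV' : (Fintype.card V : ℝ) ≠ 0 := by exact_mod_cast hV.ne'
    rw [pow_succ' (avg _), Module.End.mul_apply, avg_apply, card_filter]
    push_cast
    rw [sum_fin_cons]
    simp only [List.ofFn_cons, Walk]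
    rw [pow_succ, mul_assoc, mul_div_cancel₀ _ hV', mul_sum]
    refine sum_congr rfl fun z _ => ?_
    by_cases h : G v z
    · simp only [h, true_and, if_true, one_mul]
      rw [← ih z, card_filter]
      push_cast; rfl
    · simp [h]

/-- In a graph of density above `5/9` there is a vertex set `X` on more than two thirds of the
vertices inducing almost all edges it could, such that any two vertices of `X` are joined by a
positive proportion of all possible walks with some bounded even number of inner vertices. -/
lemma exists_robust_set {α : ℝ} (hα : 0 < α) : ∃ (I : ℕ) (c : ℝ), 0 < c ∧
    ∀ (V : Type) [Fintype V] (G : V → V → Prop), (∀ x y, G x y → G y x) → 6 ≤ Fintype.card V →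
      (5 / 9 + α) * (Fintype.card V : ℝ) ^ 2 ≤
        weight (fun x y => if G x y then 1 else 0) univ univ →
      ∃ X : Finset V, 2 * (Fintype.card V : ℝ) < 3 * #X ∧
        (5 / 9 + α / 2) * (Fintype.card V : ℝ) ^ 2 - (Fintype.card V - #X : ℝ) ^ 2 ≤
          weight (fun x y => if G x y then 1 else 0) X X ∧
        ∀ v ∈ X, ∀ a ∈ X, ∃ j ≤ I, c * (Fintype.card V : ℝ) ^ (2 * j) ≤
          #{p : Fin (2 * j) → V | Walk G v (List.ofFn p) a} := by
  set μ : ℝ := min (α / 4) 1 with hμdef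
  have hμ : 0 < μ := lt_min (by linarith) one_pos
  set θ : ℝ := μ ^ 2 / 4000 with hθdef
  have hθ : 0 < θ := by positivity
  obtain ⟨I, hI⟩ := exists_nat_gt (1 / θ)
  have hI' : 1 < I * θ := by rwa [div_lt_iff₀ hθ] at hI
  refine ⟨I, θ ^ (2 * I) / (I + 1), by positivity, ?_⟩
  intro V _ G hG hn he
  have hV : 0 < Fintype.card V := by omega
  set g : V → V → ℝ := fun x y => if G x y then 1 else 0 with hg
  have hs : ∀ x y, g x y = g y x := fun x y => by
    have : G x y ↔ G y x := ⟨hG x y, hG y x⟩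
    simp [hg, this]
  have h0 : ∀ x y, 0 ≤ g x y := fun x y => by simp only [hg]; split_ifs <;> norm_num
  have h1 : ∀ x y, g x y ≤ 1 := fun x y => by simp only [hg]; split_ifs <;> norm_num
  obtain ⟨X, hX, hlow, hins⟩ := exists_inseparable hs h0 h1 hμ (min_le_left _ _) hV he
  refine ⟨X, hX, hlow, ?_⟩
  set n : ℝ := (Fintype.card V : ℝ) with hndef
  have hn6 : (6 : ℝ) ≤ n := by rw [hndef]; exact_mod_cast hn
  have hdeg : ∀ v ∈ X, μ / 2 * n ≤ ∑ y ∈ X, g v y := by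
    intro v hv
    have h2 := hins {v} (singleton_subset_iff.2 hv)
    have h3 := weight_mono h0 (subset_refl {v}) (sdiff_subset : X \ {v} ⊆ X)
    rw [cast_card_sdiff (singleton_subset_iff.2 hv)] at h2
    rw [← weight_singleton]
    refine le_trans ?_ (h2.trans h3)
    simp only [card_singleton, Nat.cast_one, mul_one]
    nlinarith
  intro v hv a ha
  set f : ℕ → V → ℝ := fun i => ∑ j ∈ range (i + 1), ((avg g) ^ (2 * j)) (fun z => g z a) with hf
  have hga : ∀ z, 0 ≤ (fun z => g z a) z := fun z => h0 z a
  have hf0 : ∀ i v, 0 ≤ f i v := fun i v => by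
    simp only [hf, Finset.sum_apply]
    exact sum_nonneg fun j _ => avg_pow_nonneg h0 hga _ _
  have hfm : ∀ i v, f i v ≤ f (i + 1) v := fun i v => by
    simp only [hf, Finset.sum_apply]
    rw [sum_range_succ _ (i + 1)]
    linarith [avg_pow_nonneg h0 hga (2 * (i + 1)) v]
  have hfT : ∀ i v, avg g (avg g (f i)) v ≤ f (i + 1) v := fun i v => by
    simp only [hf, map_sum, Finset.sum_apply]
    rw [sum_range_succ' _ (i + 1)]
    have : ∀ j, avg g (avg g (((avg g) ^ (2 * j)) fun z => g z a)) =
        ((avg g) ^ (2 * (j + 1))) fun z => g z a := fun j => by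
      rw [show 2 * (j + 1) = 2 * j + 1 + 1 by ring, pow_succ', pow_succ']
      rfl
    simp only [this]
    linarith [avg_pow_nonneg h0 hga (2 * 0) v]
  have hθ1 : θ ≤ 1 := by
    have : μ ≤ 1 := min_le_right _ _
    rw [hθdef]; nlinarith
  have hex := expansion_exhausts hs h0 h1 hμ (min_le_right _ _) hθdef hX
    (by nlinarith) hins hdeg (A := fun i => X.filter fun v => θ ^ (2 * i) ≤ f i v)
    (B := fun i => X.filter fun v => θ ^ (2 * i + 1) ≤ avg g (f i) v)
    (fun i => filter_subset _ _) (fun i => filter_subset _ _)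
    (fun i v hv => by
      rw [mem_filter] at hv ⊢
      refine ⟨hv.1, le_trans ?_ (hv.2.trans (hfm i v))⟩
      exact pow_le_pow_of_le_one hθ.le hθ1 (by omega))
    (fun i v hv h => by
      rw [mem_filter]
      refine ⟨hv, ?_⟩
      rw [pow_succ']
      exact avg_ge h0 (hf0 i) (by positivity) (fun z hz => (mem_filter.1 hz).2) hV h)
    (fun i v hv h => by
      rw [mem_filter]
      refine ⟨hv, le_trans ?_ (hfT i v)⟩
      rw [show 2 * (i + 1) = 2 * i + 1 + 1 by ring, pow_succ']
      exact avg_ge h0 (avg_nonneg h0 (hf0 i)) (by positivity)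
        (fun z hz => (mem_filter.1 hz).2) hV h)
    (by
      refine (hdeg a ha).trans ?_
      have : ∑ y ∈ X, g a y = #(X.filter fun y => G a y) := by
        simp [hg]
      rw [this]
      refine Nat.cast_le.2 (card_le_card fun y hy => ?_)
      rw [mem_filter] at hy ⊢
      refine ⟨hy.1, ?_⟩
      simp [hf, hg, hG a y hy.2])
    hI'
  have hvI : v ∈ X.filter fun v => θ ^ (2 * I) ≤ f I v := by rw [hex]; exact hv
  have hval := (mem_filter.1 hvI).2
  simp only [hf, Finset.sum_apply] at hval
  obtain ⟨j, hj, hjv⟩ : ∃ j ∈ range (I + 1), θ ^ (2 * I) / (I + 1) ≤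
      ((avg g) ^ (2 * j)) (fun z => g z a) v := by
    refine exists_le_of_sum_le ⟨0, by simp⟩ ?_
    rw [sum_const, card_range, nsmul_eq_mul]
    refine le_trans (le_of_eq ?_) hval
    push_cast
    field_simp
  refine ⟨j, by simpa [Nat.lt_succ_iff] using hj, ?_⟩
  rw [card_walk G hV, mul_comm]
  exact mul_le_mul_of_nonneg_left hjv (by positivity)

end Walks

section Sampling
variable {ι S : Type} [Fintype ι] [DecidableEq ι] [Fintype S]

lemma card_ne_add_one (i : ι) : Fintype.card ι = Fintype.card {k // k ≠ i} + 1 := by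
  have h : Fintype.card {k // k ≠ i} = Fintype.card ι - 1 := by
    rw [Fintype.card_subtype_compl (fun k => k = i), Fintype.card_subtype_eq]
  have : 0 < Fintype.card ι := Fintype.card_pos_iff.2 ⟨i⟩
  omega

lemma sum_pi_eval (i : ι) (F : S → ℝ) :
    (Fintype.card S : ℝ) * ∑ ω : ι → S, F (ω i) =
      (Fintype.card S : ℝ) ^ Fintype.card ι * ∑ s, F s := by
  rw [← Fintype.sum_equiv (Equiv.funSplitAt i S).symm (fun x => F x.1) (fun ω => F (ω i))
    (fun x => by simp [Equiv.funSplitAt, Equiv.piSplitAt])]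
  rw [Fintype.sum_prod_type]
  simp only [sum_const, card_univ, nsmul_eq_mul, Fintype.card_fun, ← mul_sum]
  rw [← mul_assoc]
  congr 1
  push_cast
  rw [← pow_succ']
  congr 1
  exact (card_ne_add_one i).symm

lemma sum_pi_eval_two {i j : ι} (hij : i ≠ j) (F : S → S → ℝ) :
    (Fintype.card S : ℝ) ^ 2 * ∑ ω : ι → S, F (ω i) (ω j) =
      (Fintype.card S : ℝ) ^ Fintype.card ι * ∑ s, ∑ t, F s t := by
  rw [← Fintype.sum_equiv (Equiv.funSplitAt i S).symm (fun x => F x.1 (x.2 ⟨j, hij.symm⟩))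
    (fun ω => F (ω i) (ω j))
    (fun x => by simp [Equiv.funSplitAt, Equiv.piSplitAt, hij.symm])]
  rw [Fintype.sum_prod_type, pow_two, mul_assoc]
  rw [card_ne_add_one i, pow_succ', mul_assoc]
  congr 1
  rw [mul_sum, mul_sum]
  refine sum_congr rfl fun s _ => ?_
  convert sum_pi_eval (⟨j, hij.symm⟩ : {k // k ≠ i}) (fun t => F s t)

lemma card_pi_hits_le (T : Finset S) :
    (#{ω : ι → S | ∃ i, ω i ∈ T} : ℝ) * Fintype.card S ≤
      Fintype.card ι * #T * (Fintype.card S : ℝ) ^ Fintype.card ι := by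
  have h : (#{ω : ι → S | ∃ i, ω i ∈ T} : ℝ) ≤
      ∑ i : ι, ∑ ω : ι → S, if ω i ∈ T then (1 : ℝ) else 0 := by
    rw [sum_comm, card_filter]
    push_cast
    refine sum_le_sum fun ω _ => ?_
    split_ifs with hex
    · obtain ⟨i, hi⟩ := hex
      refine le_trans ?_ (single_le_sum (f := fun i => if ω i ∈ T then (1 : ℝ) else 0)
        (fun i _ => by split_ifs <;> norm_num) (mem_univ i))
      simp [hi]
    · exact sum_nonneg fun i _ => by split_ifs <;> norm_num
  refine (mul_le_mul_of_nonneg_right h (by positivity)).trans (le_of_eq ?_)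
  rw [mul_comm, mul_sum]
  simp only [sum_pi_eval (S := S) _ (fun s => if s ∈ T then (1 : ℝ) else 0)]
  simp
  ring

lemma card_pi_not_injective_le :
    (#{ω : ι → S | ¬ Function.Injective ω} : ℝ) * Fintype.card S ≤
      (Fintype.card ι : ℝ) ^ 2 * (Fintype.card S : ℝ) ^ Fintype.card ι := by
  rcases Nat.eq_zero_or_pos (Fintype.card S) with h0 | hpos
  · rw [h0]; simp; positivity
  have hS : (0 : ℝ) < Fintype.card S := by exact_mod_cast hpos
  have h : (#{ω : ι → S | ¬ Function.Injective ω} : ℝ) ≤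
      ∑ i : ι, ∑ j : ι, ∑ ω : ι → S, if i ≠ j ∧ ω i = ω j then (1 : ℝ) else 0 := by
    have : ∑ i : ι, ∑ j : ι, ∑ ω : ι → S, (if i ≠ j ∧ ω i = ω j then (1 : ℝ) else 0) =
        ∑ ω : ι → S, ∑ i : ι, ∑ j : ι, (if i ≠ j ∧ ω i = ω j then (1 : ℝ) else 0) := by
      rw [sum_comm]
      simp_rw [sum_comm (s := (univ : Finset ι)) (t := (univ : Finset (ι → S)))]
      exact sum_congr rfl fun _ _ => sum_comm
    rw [this, card_filter]
    push_cast
    refine sum_le_sum fun ω _ => ?_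
    split_ifs with hex
    · exact sum_nonneg fun i _ => sum_nonneg fun j _ => by split_ifs <;> norm_num
    · simp only [Function.Injective, not_forall] at hex
      obtain ⟨i, j, hij, hne⟩ := hex
      refine le_trans ?_ (single_le_sum (f := fun i => ∑ j,
          if i ≠ j ∧ ω i = ω j then (1 : ℝ) else 0)
        (fun i _ => sum_nonneg fun j _ => by split_ifs <;> norm_num) (mem_univ i))
      refine le_trans ?_ (single_le_sum (f := fun j => if i ≠ j ∧ ω i = ω j then (1 : ℝ) else 0)
        (fun j _ => by split_ifs <;> norm_num) (mem_univ j))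
      simp [hij, hne]
  have h2 : ∀ i j : ι, (∑ ω : ι → S, if i ≠ j ∧ ω i = ω j then (1 : ℝ) else 0) *
      Fintype.card S ≤ (Fintype.card S : ℝ) ^ Fintype.card ι := by
    intro i j
    by_cases hij : i = j
    · simp [hij]
    · have := sum_pi_eval_two hij (fun s t : S => if s = t then (1 : ℝ) else 0)
      simp only [ne_eq, hij, not_false_eq_true, true_and]
      simp only [sum_ite_eq, mem_univ, if_true, sum_const, card_univ, nsmul_eq_mul,
        mul_one] at this
      have h3 : (Fintype.card S : ℝ) * ((∑ ω : ι → S, if ω i = ω j then (1 : ℝ) else 0) *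
          Fintype.card S) = Fintype.card S * (Fintype.card S : ℝ) ^ Fintype.card ι := by
        rw [mul_comm (Fintype.card S : ℝ) (_ ^ _), ← this]; ring
      exact (mul_left_cancel₀ hS.ne' h3).le
  refine (mul_le_mul_of_nonneg_right h (by positivity)).trans ?_
  rw [sum_mul]
  calc _ ≤ ∑ i : ι, ∑ j : ι, (Fintype.card S : ℝ) ^ Fintype.card ι := by
        refine sum_le_sum fun i _ => ?_
        rw [sum_mul]
        exact sum_le_sum fun j _ => h2 i j
    _ = _ := by simp; ring

end Sampling

/-- A symmetric ternary relation holding only on triples of distinct elements. -/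
structure IsHypergraph {V : Type} (A : V → V → V → Prop) : Prop where
  rot : ∀ {x y z}, A x y z → A y z x
  swap : ∀ {x y z}, A x y z → A y x z
  ne : ∀ {x y z}, A x y z → x ≠ y

/-- Every three consecutive entries of the list are related. -/
def TightPath {V : Type} (A : V → V → V → Prop) : List V → Prop
  | a :: b :: c :: l => A a b c ∧ TightPath A (b :: c :: l)
  | _ => True

/-- The pair `x`, `y` is an edge of the link of `u`, inside the set `X u`. -/
def InLink {V : Type} (A : V → V → V → Prop) (X : V → Finset V) (u x y : V) : Prop :=
  x ∈ X u ∧ y ∈ X u ∧ A u x y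

/-- Interleave `u₀, u₁, …` with `p₀, p₁, …` as `u₀, p₀, p₁, u₁, p₂, p₃, …`. -/
def weave {V : Type} : List V → List V → List V
  | u :: us, p :: q :: ps => u :: p :: q :: weave us ps
  | u :: _, [] => [u]
  | _, _ => []

section Paths
variable {V : Type} {A : V → V → V → Prop}

lemma tightPath_append {a b : V} : ∀ {l₁ l₂ : List V}, TightPath A (l₁ ++ [a, b]) →
    TightPath A ([a, b] ++ l₂) → TightPath A (l₁ ++ [a, b] ++ l₂)
  | [], _, _, h => h
  | [x], _, h, h' => by
    simp only [List.cons_append, List.nil_append, TightPath] at h h' ⊢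
    exact ⟨h.1, h'⟩
  | [x, y], l₂, h, h' => by
    have := tightPath_append (l₁ := [y]) (l₂ := l₂) (a := a) (b := b)
    simp only [List.cons_append, List.nil_append, TightPath] at h h' this ⊢
    exact ⟨h.1, this h.2 h'⟩
  | x :: y :: z :: l₁, l₂, h, h' => by
    have := tightPath_append (l₁ := y :: z :: l₁) (l₂ := l₂) (a := a) (b := b)
    simp only [List.cons_append, TightPath] at h h' this ⊢
    exact ⟨h.1, this h.2 h'⟩

lemma tightPath_weave (hA : IsHypergraph A) {a b : V} : ∀ {us ps : List V} {x y : V},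
    ps.length + 2 = 2 * us.length →
    (∀ u ∈ us, A u x y ∧ Walk (A u) y ps a ∧ A u a b) →
    TightPath A ([x, y] ++ weave us ps ++ [a, b])
  | [], _, _, _, h, _ => by simp at h
  | u :: us, [], x, y, _, hu => by
    obtain ⟨h1, h2, h3⟩ := hu u (by simp)
    simp only [Walk] at h2
    simp only [weave, List.cons_append, List.nil_append, TightPath]
    exact ⟨hA.rot h1, hA.swap h2, h3, trivial⟩
  | u :: us, [p], x, y, h, hu => by simp at h; omega
  | u :: us, p :: q :: ps, x, y, h, hu => by
    obtain ⟨h1, h2, h3⟩ := hu u (by simp)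
    have ih := tightPath_weave hA (us := us) (ps := ps) (x := p) (y := q) (a := a) (b := b)
      (by simp at h; omega) (fun u' hu' => by
        obtain ⟨h1, h2, h3⟩ := hu u' (by simp [hu'])
        exact ⟨h2.2.1, h2.2.2, h3⟩)
    simp only [Walk] at h2
    simp only [weave, List.cons_append, List.nil_append, TightPath] at ih ⊢
    exact ⟨hA.rot h1, hA.swap h2.1, h2.2.1, ih⟩

lemma weave_perm : ∀ {us ps : List V}, ps.length + 2 = 2 * us.length →
    (weave us ps).Perm (us ++ ps)
  | [], _, h => by simp at h
  | [u], [], _ => by simp [weave]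
  | u :: v :: us, [], h => by simp at h
  | u :: us, [p], h => by simp at h; omega
  | u :: us, p :: q :: ps, h => by
    have ih := weave_perm (us := us) (ps := ps) (by simp at h; omega)
    simp only [weave, List.cons_append]
    refine List.Perm.cons u ?_
    have h2 := (ih.cons q).cons p
    refine h2.trans ?_
    refine List.Perm.trans ?_ List.perm_append_comm
    simp only [List.cons_append]
    exact (List.perm_append_comm.cons q).cons p

end Paths

lemma exists_path_of_common {I : ℕ} {c ζ : ℝ} (hc : 0 < c) (hζ : 0 < ζ) :
    ∃ (ε : ℝ) (n₀ : ℕ), 0 < ε ∧ ∀ (V : Type) [Fintype V] (A : V → V → V → Prop)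
      (X : V → Finset V), IsHypergraph A → n₀ ≤ Fintype.card V →
      (∀ u, ∀ v ∈ X u, ∀ a ∈ X u, ∃ j ≤ I, c * (Fintype.card V : ℝ) ^ (2 * j) ≤
        #{p : Fin (2 * j) → V | Walk (A u) v (List.ofFn p) a}) →
      ∀ x y a b, ζ * Fintype.card V ≤ #{u | InLink A X u x y ∧ InLink A X u a b} →
      ∀ F : Finset V, #F ≤ ε * Fintype.card V →
      ∃ l : List V, l.length ≤ 3 * I + 1 ∧ l.Nodup ∧ (∀ v ∈ l, v ∉ F) ∧
        TightPath A ([x, y] ++ l ++ [a, b]) := by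
  set K : ℝ := I + 1 with hK
  have hK1 : 1 ≤ K := by simp [hK]
  have hK0 : 0 < K := by linarith
  -- number of usable centres is at least `2 κ n`
  set κ : ℝ := c * ζ / (8 * K) with hκ
  have hκ0 : 0 < κ := by positivity
  set ε : ℝ := min (κ / 2) (c / (8 * K)) with hε
  refine ⟨ε, ⌈6 * K / κ⌉₊ + ⌈16 * K ^ 2 / c⌉₊ + 1, by positivity, ?_⟩
  intro V _ A X hA hn hwalk x y a b hU F hF
  set n : ℝ := (Fintype.card V : ℝ) with hnn
  have hn1 : 6 * K ≤ κ * n := by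
    have h1 : 6 * K / κ ≤ n := by
      refine (Nat.le_ceil _).trans ?_
      rw [hnn]; exact_mod_cast (by omega : ⌈6 * K / κ⌉₊ ≤ Fintype.card V)
    rw [div_le_iff₀ hκ0] at h1; linarith
  have hn2 : 16 * K ^ 2 ≤ c * n := by
    have h1 : 16 * K ^ 2 / c ≤ n := by
      refine (Nat.le_ceil _).trans ?_
      rw [hnn]; exact_mod_cast (by omega : ⌈16 * K ^ 2 / c⌉₊ ≤ Fintype.card V)
    rw [div_le_iff₀ hc] at h1; linarith
  have hn0 : 0 < n := by rw [hnn]; exact_mod_cast (by omega : 0 < Fintype.card V)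
  have hF1 : (#F : ℝ) ≤ κ / 2 * n := hF.trans (by gcongr; exact min_le_left _ _)
  have hF2 : 8 * K * (#F : ℝ) ≤ c * n := by
    have : (#F : ℝ) ≤ c / (8 * K) * n := hF.trans (by gcongr; exact min_le_right _ _)
    rw [div_mul_eq_mul_div, le_div_iff₀ (by positivity)] at this
    linarith
  set U : Finset V := {u | InLink A X u x y ∧ InLink A X u a b} with hUdef
  have hj : ∀ u ∈ U, ∃ j ≤ I, c * n ^ (2 * j) ≤
      #{p : Fin (2 * j) → V | Walk (A u) y (List.ofFn p) a} := by
    intro u hu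
    simp only [hUdef, mem_filter, mem_univ, true_and] at hu
    exact hwalk u y hu.1.2.1 a hu.2.1
  choose! J hJI hJ using hj
  obtain ⟨j, hjI, hjU⟩ : ∃ j ∈ range (I + 1), ζ * n / K ≤ #{u ∈ U | J u = j} := by
    refine exists_le_card_fiber_of_nsmul_le_card_of_maps_to (fun u hu => ?_) ⟨0, by simp⟩ ?_
    · simp only [mem_range]; have := hJI u hu; omega
    · rw [card_range, nsmul_eq_mul]; push_cast; rw [← hK]
      rw [mul_div_cancel₀ _ hK0.ne']; exact hU
  set U' : Finset V := {u ∈ U | J u = j} with hU'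
  have hjI' : (j : ℝ) ≤ K := by
    rw [hK]; simp only [mem_range] at hjI; exact_mod_cast hjI.le
  have hU'0 : (0 : ℝ) < #U' := lt_of_lt_of_le (by positivity) hjU
  -- the walks
  set bad : Finset (Fin (2 * j) → V) :=
    univ.filter (fun p => (∃ i, p i ∈ F) ∨ ¬ Function.Injective p) with hbad
  have hbadcard : (#bad : ℝ) ≤ c / 2 * n ^ (2 * j) := by
    have h1 := card_pi_hits_le (ι := Fin (2 * j)) F
    have h2 := card_pi_not_injective_le (ι := Fin (2 * j)) (S := V)
    have h3 : (#bad : ℝ) ≤ #{ω : Fin (2 * j) → V | ∃ i, ω i ∈ F} +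
        #{ω : Fin (2 * j) → V | ¬ Function.Injective ω} := by
      rw [hbad, filter_or]; exact_mod_cast card_union_le _ _
    simp only [Fintype.card_fin] at h1 h2
    push_cast at h1 h2
    rw [← hnn] at h1 h2
    have h4 : (#bad : ℝ) * n ≤ (c / 2 * n ^ (2 * j)) * n := by
      calc (#bad : ℝ) * n ≤ (2 * j * #F) * n ^ (2 * j) + (2 * j) ^ 2 * n ^ (2 * j) := by
            refine (mul_le_mul_of_nonneg_right h3 hn0.le).trans ?_
            rw [add_mul]
            convert add_le_add h1 h2
        _ = (2 * j * #F + (2 * j) ^ 2) * n ^ (2 * j) := by ring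
        _ ≤ (2 * K * #F + (2 * K) ^ 2) * n ^ (2 * j) := by gcongr
        _ ≤ (c / 2 * n) * n ^ (2 * j) := by gcongr; nlinarith
        _ = _ := by ring
    exact le_of_mul_le_mul_right h4 hn0
  have hsum : c * n ^ (2 * j) * #U' ≤
      ∑ p : Fin (2 * j) → V, (#{u ∈ U' | Walk (A u) y (List.ofFn p) a} : ℝ) := by
    have h1 : ∑ p : Fin (2 * j) → V, #{u ∈ U' | Walk (A u) y (List.ofFn p) a} =
        ∑ u ∈ U', #{p : Fin (2 * j) → V | Walk (A u) y (List.ofFn p) a} := by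
      simp only [card_filter]
      exact sum_comm
    rw [← Nat.cast_sum, h1, Nat.cast_sum, mul_comm, ← nsmul_eq_mul]
    refine card_nsmul_le_sum _ _ _ fun u hu => ?_
    simp only [hU', mem_filter] at hu
    have := hJ u hu.1
    rwa [hu.2] at this
  obtain ⟨p, hpbad, hp⟩ : ∃ p, p ∉ bad ∧
      c / 4 * #U' ≤ #{u ∈ U' | Walk (A u) y (List.ofFn p) a} := by
    by_contra! hcon
    have h1 : ∑ p : Fin (2 * j) → V, (#{u ∈ U' | Walk (A u) y (List.ofFn p) a} : ℝ) ≤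
        ∑ p : Fin (2 * j) → V, ((if p ∈ bad then (#U' : ℝ) else 0) + c / 4 * #U') := by
      refine sum_le_sum fun p _ => ?_
      split_ifs with hpb
      · have : (#{u ∈ U' | Walk (A u) y (List.ofFn p) a} : ℝ) ≤ #U' := by
          exact_mod_cast card_filter_le _ _
        nlinarith
      · have := hcon p hpb; linarith
    rw [sum_add_distrib, ← sum_filter, filter_mem_eq_inter, univ_inter] at h1
    simp only [sum_const, nsmul_eq_mul, card_univ, Fintype.card_fun, Fintype.card_fin] at h1
    push_cast at h1
    rw [← hnn] at h1
    have h2 : (#bad : ℝ) * #U' ≤ c / 2 * n ^ (2 * j) * #U' := by gcongr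
    have h3 : 0 < c * n ^ (2 * j) * #U' := by positivity
    nlinarith
  simp only [hbad, mem_filter, mem_univ, true_and, not_or, not_exists, not_not] at hpbad
  obtain ⟨hpF, hpinj⟩ := hpbad
  set W : Finset V := {u ∈ U' | Walk (A u) y (List.ofFn p) a} \ (F ∪ univ.image p) with hW
  have hWcard : j + 1 ≤ #W := by
    have h1 := le_card_sdiff (F ∪ univ.image p) {u ∈ U' | Walk (A u) y (List.ofFn p) a}
    have h2 : #(F ∪ univ.image p) ≤ #F + 2 * j := by
      refine (card_union_le _ _).trans ?_
      have := card_image_le (f := p) (s := univ)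
      simp at this
      omega
    have h3 : 2 * κ * n ≤ c / 4 * #U' := by
      calc 2 * κ * n = c / 4 * (ζ * n / K) := by rw [hκ]; field_simp; ring
        _ ≤ _ := by gcongr
    have h4 : (#{u ∈ U' | Walk (A u) y (List.ofFn p) a} : ℝ) ≤ #W + (#F + 2 * j) := by
      have : #{u ∈ U' | Walk (A u) y (List.ofFn p) a} ≤ #W + (#F + 2 * j) := by
        rw [← hW] at h1; omega
      exact_mod_cast this
    have h5 : ((j + 1 : ℕ) : ℝ) ≤ #W := by push_cast; nlinarith
    exact_mod_cast h5
  obtain ⟨W', hW'W, hW'card⟩ := exists_subset_card_eq hWcard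
  have hlen : (List.ofFn p).length + 2 = 2 * W'.toList.length := by
    simp [hW'card]; ring
  have hperm := weave_perm hlen
  have hmemW : ∀ u ∈ W', u ∈ U ∧ Walk (A u) y (List.ofFn p) a ∧ u ∉ F ∧ ∀ i, p i ≠ u := by
    intro u hu
    have := hW'W hu
    simp only [hW, hU', mem_sdiff, mem_filter, mem_union, mem_image, mem_univ, true_and,
      not_or, not_exists] at this
    exact ⟨this.1.1.1, this.1.2, this.2.1, this.2.2⟩
  refine ⟨weave W'.toList (List.ofFn p), ?_, ?_, ?_, ?_⟩
  · rw [hperm.length_eq]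
    simp [hW'card]
    simp only [mem_range] at hjI
    omega
  · rw [hperm.nodup_iff, List.nodup_append]
    refine ⟨W'.nodup_toList, List.nodup_ofFn.2 hpinj, ?_⟩
    intro u hu v hv huv
    rw [mem_toList] at hu
    rw [List.mem_ofFn] at hv
    obtain ⟨i, rfl⟩ := hv
    exact (hmemW u hu).2.2.2 i huv.symm
  · intro v hv
    rw [hperm.mem_iff, List.mem_append, mem_toList, List.mem_ofFn] at hv
    rcases hv with hv | ⟨i, rfl⟩
    · exact (hmemW v hv).2.2.1
    · exact hpF i
  · refine tightPath_weave hA hlen fun u hu => ?_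
    rw [mem_toList] at hu
    obtain ⟨h1, h2, -⟩ := hmemW u hu
    simp only [hUdef, mem_filter, mem_univ, true_and] at h1
    exact ⟨h1.1.2.2, h2, h1.2.2.2⟩

lemma weight_ite_eq_card {V : Type} (G : V → V → Prop) (S T : Finset V) :
    weight (fun x y => if G x y then 1 else 0) S T = #{q ∈ S ×ˢ T | G q.1 q.2} := by
  rw [weight, ← sum_product', card_filter]
  push_cast
  rfl

lemma card_common_edges {V : Type} [Fintype V] {G G' : V → V → Prop} {X Y : Finset V} {α : ℝ}
    (hX : 2 * Fintype.card V < 3 * #X) (hY : 2 * Fintype.card V < 3 * #Y)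
    (hG : (5 / 9 + α / 2) * (Fintype.card V : ℝ) ^ 2 - (Fintype.card V - #X) ^ 2 ≤
      weight (fun x y => if G x y then 1 else 0) X X)
    (hG' : (5 / 9 + α / 2) * (Fintype.card V : ℝ) ^ 2 - (Fintype.card V - #Y) ^ 2 ≤
      weight (fun x y => if G' x y then 1 else 0) Y Y) :
    α * (Fintype.card V : ℝ) ^ 2 ≤
      #{q : V × V | (q.1 ∈ X ∧ q.2 ∈ X ∧ G q.1 q.2) ∧ q.1 ∈ Y ∧ q.2 ∈ Y ∧ G' q.1 q.2} := by
  rw [weight_ite_eq_card] at hG hG'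
  set n : ℝ := (Fintype.card V : ℝ)
  set C : Finset (V × V) :=
    {q : V × V | (q.1 ∈ X ∧ q.2 ∈ X ∧ G q.1 q.2) ∧ q.1 ∈ Y ∧ q.2 ∈ Y ∧ G' q.1 q.2}
  have h1 : (X ∩ Y) ×ˢ (X ∩ Y) ⊆ C ∪ ((X ×ˢ X).filter (fun q => ¬ G q.1 q.2) ∪
      (Y ×ˢ Y).filter (fun q => ¬ G' q.1 q.2)) := by
    intro q hq
    simp only [C, mem_product, mem_inter, mem_union, mem_filter, mem_univ, true_and] at hq ⊢
    tauto
  have h2 := (card_le_card h1).trans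
    ((card_union_le _ _).trans (Nat.add_le_add_left (card_union_le _ _) _))
  have h3 := card_filter_add_card_filter_not (s := X ×ˢ X) (fun q => G q.1 q.2)
  have h4 := card_filter_add_card_filter_not (s := Y ×ˢ Y) (fun q => G' q.1 q.2)
  have h5 := card_union_add_card_inter X Y
  have h6 : #(X ∪ Y) ≤ Fintype.card V := card_le_univ _
  have h7 : #X ≤ Fintype.card V := card_le_univ _
  have h8 : #Y ≤ Fintype.card V := card_le_univ _
  rw [card_product] at h2 h3 h4
  have e2 : (#(X ∩ Y) : ℝ) * #(X ∩ Y) ≤ #C + (#{q ∈ X ×ˢ X | ¬ G q.1 q.2} +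
    #{q ∈ Y ×ˢ Y | ¬ G' q.1 q.2}) := by exact_mod_cast h2
  have e3 : (#{q ∈ X ×ˢ X | G q.1 q.2} : ℝ) + #{q ∈ X ×ˢ X | ¬ G q.1 q.2} = #X * #X := by
    exact_mod_cast h3
  have e4 : (#{q ∈ Y ×ˢ Y | G' q.1 q.2} : ℝ) + #{q ∈ Y ×ˢ Y | ¬ G' q.1 q.2} = #Y * #Y := by
    exact_mod_cast h4
  have e5 : (#X : ℝ) + #Y - n ≤ #(X ∩ Y) := by
    have : (#X : ℝ) + #Y ≤ n + #(X ∩ Y) := by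
      simp only [n]; exact_mod_cast (by omega : #X + #Y ≤ Fintype.card V + #(X ∩ Y))
    linarith
  have e6 : 2 * n < 3 * #X := by simp only [n]; exact_mod_cast hX
  have e7 : 2 * n < 3 * #Y := by simp only [n]; exact_mod_cast hY
  have e8 : (#X : ℝ) ≤ n := by simp only [n]; exact_mod_cast h7
  have e9 : (#Y : ℝ) ≤ n := by simp only [n]; exact_mod_cast h8
  have e10 : ((#X : ℝ) + #Y - n) * (#X + #Y - n) ≤ #(X ∩ Y) * #(X ∩ Y) :=
    mul_self_le_mul_self (by linarith) e5
  have e11 : ((#X : ℝ) - #Y) ^ 2 ≤ n ^ 2 / 9 := by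
    have : ((#X : ℝ) - #Y) ^ 2 ≤ (n / 3) ^ 2 := sq_le_sq' (by linarith) (by linarith)
    linarith
  nlinarith

lemma exists_path_of_sharing {I : ℕ} {c ζ β : ℝ} (hc : 0 < c) (hζ : 0 < ζ) (hβ : 0 < β) :
    ∃ (ε : ℝ) (n₀ L : ℕ), 0 < ε ∧ ∀ (V : Type) [Fintype V] (A : V → V → V → Prop)
      (X : V → Finset V), IsHypergraph A → n₀ ≤ Fintype.card V →
      (∀ u, ∀ v ∈ X u, ∀ a ∈ X u, ∃ j ≤ I, c * (Fintype.card V : ℝ) ^ (2 * j) ≤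
        #{p : Fin (2 * j) → V | Walk (A u) v (List.ofFn p) a}) →
      (∀ u v, β * (Fintype.card V : ℝ) ^ 2 ≤
        #{q : V × V | InLink A X u q.1 q.2 ∧ InLink A X v q.1 q.2}) →
      ∀ x y z w, ζ * Fintype.card V ≤ #{u | InLink A X u x y} →
      ζ * Fintype.card V ≤ #{u | InLink A X u z w} →
      ∀ F : Finset V, #F ≤ ε * Fintype.card V →
      ∃ l : List V, l.length ≤ L ∧ l.Nodup ∧ (∀ v ∈ l, v ∉ F) ∧
        TightPath A ([x, y] ++ l ++ [z, w]) := by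
  obtain ⟨ε, n₁, hε, h⟩ := exists_path_of_common (I := I) (c := c) (ζ := β / 4 * ζ) hc
    (by positivity)
  set K : ℕ := 2 + (3 * I + 1) with hK
  refine ⟨min (ε / 2) (β / 8), n₁ + ⌈2 * K / ε⌉₊ + 1, 2 * (3 * I + 1) + 2, by positivity, ?_⟩
  intro V _ A X hA hn hwalk hshare x y z w hxy hzw F hF
  set n : ℝ := (Fintype.card V : ℝ) with hnn
  have hn0 : 0 < n := by rw [hnn]; exact_mod_cast (by omega : 0 < Fintype.card V)
  have hnK : K ≤ ε / 2 * n := by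
    have h1 : 2 * K / ε ≤ n := by
      refine (Nat.le_ceil _).trans ?_
      rw [hnn]; exact_mod_cast (by omega : ⌈2 * K / ε⌉₊ ≤ Fintype.card V)
    rw [div_le_iff₀ hε] at h1; linarith
  have hF1 : (#F : ℝ) ≤ ε / 2 * n := hF.trans (by gcongr; exact min_le_left _ _)
  have hF2 : (#F : ℝ) ≤ β / 8 * n := hF.trans (by gcongr; exact min_le_right _ _)
  set U : Finset V := {u | InLink A X u x y} with hU
  set U' : Finset V := {u | InLink A X u z w} with hU'
  have hU0 : (0 : ℝ) < #U := lt_of_lt_of_le (by positivity) hxy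
  have hU'0 : (0 : ℝ) < #U' := lt_of_lt_of_le (by positivity) hzw
  obtain ⟨q, hqF, hq1, hq2⟩ : ∃ q : V × V, (q.1 ∉ F ∧ q.2 ∉ F) ∧
      β / 4 * #U ≤ #{u ∈ U | InLink A X u q.1 q.2} ∧
      β / 4 * #U' ≤ #{u ∈ U' | InLink A X u q.1 q.2} := by
    by_contra! hcon
    have h1 : (∑ q : V × V, #{u ∈ U | InLink A X u q.1 q.2} *
        #{u ∈ U' | InLink A X u q.1 q.2}) =
        ∑ u ∈ U, ∑ v ∈ U', #{q : V × V | InLink A X u q.1 q.2 ∧ InLink A X v q.1 q.2} := by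
      simp only [card_filter, sum_mul_sum]
      rw [sum_comm]
      refine sum_congr rfl fun u _ => ?_
      rw [sum_comm]
      refine sum_congr rfl fun v _ => sum_congr rfl fun q _ => ?_
      by_cases h1 : InLink A X u q.1 q.2 <;> by_cases h2 : InLink A X v q.1 q.2 <;> simp [h1, h2]
    have h2 : β * n ^ 2 * (#U * #U') ≤ ((∑ u ∈ U, ∑ v ∈ U',
        #{q : V × V | InLink A X u q.1 q.2 ∧ InLink A X v q.1 q.2} : ℕ) : ℝ) := by
      push_cast
      calc β * n ^ 2 * (#U * #U') = ∑ u ∈ U, ∑ v ∈ U', β * n ^ 2 := by simp; ring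
        _ ≤ _ := sum_le_sum fun u _ => sum_le_sum fun v _ => hshare u v
    rw [← h1] at h2
    push_cast at h2
    have h3 : ∀ q : V × V, (#{u ∈ U | InLink A X u q.1 q.2} : ℝ) *
        #{u ∈ U' | InLink A X u q.1 q.2} ≤
        ((if q.1 ∈ F then (1 : ℝ) else 0) + (if q.2 ∈ F then 1 else 0) + β / 4) *
          (#U * #U') := by
      intro q
      have a1 : (#{u ∈ U | InLink A X u q.1 q.2} : ℝ) ≤ #U := by
        exact_mod_cast card_filter_le _ _
      have a2 : (#{u ∈ U' | InLink A X u q.1 q.2} : ℝ) ≤ #U' := by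
        exact_mod_cast card_filter_le _ _
      have a3 : (0 : ℝ) ≤ #{u ∈ U | InLink A X u q.1 q.2} := by positivity
      have a4 : (0 : ℝ) ≤ #{u ∈ U' | InLink A X u q.1 q.2} := by positivity
      by_cases hqF : q.1 ∈ F ∨ q.2 ∈ F
      · calc _ ≤ (#U : ℝ) * #U' := by gcongr
          _ = 1 * (#U * #U') := by ring
          _ ≤ _ := by
            gcongr
            rcases hqF with h | h
            · simp only [h, if_true]; split_ifs <;> linarith
            · simp only [h, if_true]; split_ifs <;> linarith
      · push Not at hqF
        simp only [hqF.1, hqF.2, if_false, zero_add]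
        by_cases hq1 : β / 4 * #U ≤ #{u ∈ U | InLink A X u q.1 q.2}
        · calc _ ≤ (#U : ℝ) * (β / 4 * #U') := by
                gcongr; exact (hcon q hqF hq1).le
            _ = _ := by ring
        · calc _ ≤ (β / 4 * #U) * (#U' : ℝ) := by
                gcongr; exact (not_le.1 hq1).le
            _ = _ := by ring
    have h4 := h2.trans (sum_le_sum fun q _ => h3 q)
    rw [← sum_mul, sum_add_distrib, sum_add_distrib] at h4
    have h5 : ∑ q : V × V, (if q.1 ∈ F then (1 : ℝ) else 0) = #F * n := by
      have : (univ.filter fun q : V × V => q.1 ∈ F) = F ×ˢ univ := by ext; simp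
      rw [sum_boole, this, card_product]
      simp [hnn]
    have h6 : ∑ q : V × V, (if q.2 ∈ F then (1 : ℝ) else 0) = #F * n := by
      rw [Fintype.sum_prod_type]
      simp [hnn, mul_comm]
    have h7 : ∑ q : V × V, (β / 4 : ℝ) = β / 4 * n ^ 2 := by
      simp [hnn]; ring
    rw [h5, h6, h7] at h4
    have h8 := le_of_mul_le_mul_right h4 (by positivity)
    have : 0 < β * n ^ 2 := by positivity
    nlinarith
  obtain ⟨a, b⟩ := q
  simp only at hqF hq1 hq2
  have hFab : ((#(F ∪ {a, b}) : ℕ) : ℝ) ≤ #F + 2 := by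
    exact_mod_cast (card_union_le _ _).trans (Nat.add_le_add_left card_le_two _)
  have hK' : (K : ℝ) = 2 + (3 * I + 1 : ℕ) := by rw [hK]; push_cast; ring
  have hI0 : (0 : ℝ) ≤ (3 * I + 1 : ℕ) := by positivity
  obtain ⟨l₁, hl₁, hd₁, hF₁, ht₁⟩ := h V A X hA (by omega) hwalk x y a b (by
      rw [filter_filter] at hq1
      refine le_trans ?_ hq1
      calc β / 4 * ζ * n = β / 4 * (ζ * n) := by ring
        _ ≤ _ := by gcongr) (F ∪ {a, b}) (by rw [← hnn]; linarith)
  have hl₁' : ((#(F ∪ {a, b} ∪ l₁.toFinset) : ℕ) : ℝ) ≤ #(F ∪ {a, b}) + (3 * I + 1 : ℕ) := by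
    exact_mod_cast (card_union_le _ _).trans
      (Nat.add_le_add_left ((List.toFinset_card_le l₁).trans hl₁) _)
  obtain ⟨l₂, hl₂, hd₂, hF₂, ht₂⟩ := h V A X hA (by omega) hwalk a b z w (by
      rw [filter_filter] at hq2
      simp only [and_comm (b := InLink A X _ a b)] at hq2
      refine le_trans ?_ hq2
      calc β / 4 * ζ * n = β / 4 * (ζ * n) := by ring
        _ ≤ _ := by gcongr) (F ∪ {a, b} ∪ l₁.toFinset) (by rw [← hnn]; linarith)
  have hab : a ≠ b := by
    rintro rfl
    have h1 : (0 : ℝ) < #{u ∈ U | InLink A X u a a} := lt_of_lt_of_le (by positivity) hq1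
    have h2 : 0 < #{u ∈ U | InLink A X u a a} := by exact_mod_cast h1
    obtain ⟨u, hu⟩ := card_pos.1 h2
    exact hA.ne (hA.rot (mem_filter.1 hu).2.2.2) rfl
  simp only [mem_union, mem_insert, mem_singleton, not_or, List.mem_toFinset] at hF₁ hF₂
  refine ⟨l₁ ++ [a, b] ++ l₂, ?_, ?_, ?_, ?_⟩
  · simp; omega
  · rw [List.append_assoc, List.nodup_append]
    refine ⟨hd₁, ?_, ?_⟩
    · simp only [List.cons_append, List.nil_append, List.nodup_cons, List.mem_cons, not_or]
      exact ⟨⟨hab, fun h => (hF₂ a h).1.2.1 rfl⟩, fun h => (hF₂ b h).1.2.2 rfl, hd₂⟩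
    · rintro v hv u hu rfl
      simp only [List.cons_append, List.nil_append, List.mem_cons] at hu
      rcases hu with rfl | rfl | hu
      · exact (hF₁ v hv).2.1 rfl
      · exact (hF₁ v hv).2.2 rfl
      · exact (hF₂ v hu).2 hv
  · intro v hv
    simp only [List.mem_append, List.mem_cons, List.not_mem_nil, or_false] at hv
    rcases hv with (hv | rfl | rfl) | hv
    · exact (hF₁ v hv).1
    · exact hqF.1
    · exact hqF.2
    · exact (hF₂ v hv).1.1
  · have := tightPath_append (A := A) (l₁ := [x, y] ++ l₁) (l₂ := l₂ ++ [z, w]) ht₁ (by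
      simpa using ht₂)
    simpa using this

/-- A family of pairwise disjoint triples of pairwise disjoint subsets of `W`, each triple spanning
a complete tripartite subgraph of `A` whose first two sets are completely joined by `P`. -/
structure IsTiling {V β : Type} (A : V → V → V → Prop) (P : V → V → Prop) (W : Finset V)
    (T : β → Fin 3 → Finset V) : Prop where
  sub : ∀ b c, T b c ⊆ W
  disj : ∀ p q : β × Fin 3, p ≠ q → Disjoint (T p.1 p.2) (T q.1 q.2)
  edge : ∀ b, ∀ x ∈ T b 0, ∀ y ∈ T b 1, ∀ z ∈ T b 2, A x y z ∧ P x y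

/-- There is a tiling inside `W` with `k` tiles, all of whose parts have size `s`. -/
def HasTiling {V : Type} (A : V → V → V → Prop) (P : V → V → Prop) (W : Finset V)
    (s k : ℕ) : Prop :=
  ∃ T : Fin k → Fin 3 → Finset V, IsTiling A P W T ∧ ∀ i c, #(T i c) = s

/-- Interleave three lists as `x₀, y₀, z₀, x₁, y₁, z₁, …`. -/
def interleave {V : Type} : List V → List V → List V → List V
  | x :: xs, y :: ys, z :: zs => x :: y :: z :: interleave xs ys zs
  | _, _, _ => []

section Tilings
variable {V : Type} {A : V → V → V → Prop} {P : V → V → Prop}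

lemma exists_disjoint_subsets (S : Finset V) (r s : ℕ) (h : r * s ≤ #S) :
    ∃ Q : Fin r → Finset V, (∀ i, #(Q i) = s ∧ Q i ⊆ S) ∧
      ∀ i j, i ≠ j → Disjoint (Q i) (Q j) := by
  induction r generalizing S with
  | zero => exact ⟨fun _ => ∅, fun i => i.elim0, fun i => i.elim0⟩
  | succ r ih =>
    obtain ⟨S₀, hS₀, hc⟩ := exists_subset_card_eq (show s ≤ #S by nlinarith)
    obtain ⟨Q, hQ, hd⟩ := ih (S \ S₀) (by rw [card_sdiff_of_subset hS₀, hc]; rw [add_mul] at h; omega)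
    have hdis : ∀ i, Disjoint S₀ (Q i) := fun i =>
      disjoint_of_subset_right (hQ i).2 disjoint_sdiff
    refine ⟨Fin.cons S₀ Q, fun i => ?_, fun i j => ?_⟩
    · refine Fin.cases ⟨hc, hS₀⟩ (fun i => ?_) i
      simpa using ⟨(hQ i).1, (hQ i).2.trans sdiff_subset⟩
    · refine Fin.cases (Fin.cases (by simp) (fun j _ => ?_) j) (fun i => Fin.cases (fun _ => ?_)
        (fun j hij => ?_) j) i
      · simpa using hdis j
      · simpa using (hdis i).symm
      · simpa using hd i j (fun h => hij (by rw [h]))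

lemma IsTiling.hasTiling {β : Type} [Fintype β] {W : Finset V} {T : β → Fin 3 → Finset V}
    (hT : IsTiling A P W T) {s : ℕ} (r : β → ℕ) (hr : ∀ b c, r b * s ≤ #(T b c)) :
    HasTiling A P W s (∑ b, r b) := by
  choose Q hQ hd using fun b c => exists_disjoint_subsets (T b c) (r b) s (hr b c)
  have hcard : Fintype.card (Σ b, Fin (r b)) = ∑ b, r b := by simp
  let e : Fin (∑ b, r b) ≃ Σ b, Fin (r b) := (Fintype.equivFinOfCardEq hcard).symm
  refine ⟨fun i c => Q (e i).1 c (e i).2, ⟨?_, ?_, ?_⟩, ?_⟩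
  · exact fun i c => (hQ _ _ _).2.trans (hT.sub _ _)
  · rintro ⟨i, c⟩ ⟨j, d⟩ hne
    dsimp only
    by_cases hb : ((e i).1, c) = ((e j).1, d)
    · simp only [Prod.mk.injEq] at hb
      obtain ⟨hb, rfl⟩ := hb
      have hij : e i ≠ e j := fun h => hne (by rw [e.injective h])
      revert hb hij
      generalize e i = u
      generalize e j = v
      obtain ⟨b, u⟩ := u
      obtain ⟨b', v⟩ := v
      rintro rfl hij
      exact hd _ _ _ _ (fun h => hij (by simp only at h; rw [h]))
    · exact disjoint_of_subset_left (hQ _ _ _).2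
        (disjoint_of_subset_right (hQ _ _ _).2 (hT.disj _ _ hb))
  · exact fun i x hx y hy z hz =>
      hT.edge _ x ((hQ _ _ _).2 hx) y ((hQ _ _ _).2 hy) z ((hQ _ _ _).2 hz)
  · exact fun i c => (hQ _ _ _).1

lemma HasTiling.union {W W' : Finset V} {s k k' : ℕ} (hW : Disjoint W W')
    (h : HasTiling A P W s k) (h' : HasTiling A P W' s k') :
    HasTiling A P (W ∪ W') s (k + k') := by
  obtain ⟨T, hT, hc⟩ := h
  obtain ⟨T', hT', hc'⟩ := h'
  have : IsTiling A P (W ∪ W') (Sum.elim T T') := by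
    refine ⟨?_, ?_, ?_⟩
    · rintro (b | b) c
      · exact (hT.sub b c).trans subset_union_left
      · exact (hT'.sub b c).trans subset_union_right
    · rintro ⟨b | b, c⟩ ⟨b' | b', c'⟩ hne
      · exact hT.disj (b, c) (b', c') (fun h => hne (by simp_all))
      · exact disjoint_of_subset_left (hT.sub b c) (disjoint_of_subset_right (hT'.sub b' c') hW)
      · exact disjoint_of_subset_left (hT'.sub b c)
          (disjoint_of_subset_right (hT.sub b' c') hW.symm)
      · exact hT'.disj (b, c) (b', c') (fun h => hne (by simp_all))
    · rintro (b | b)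
      · exact hT.edge b
      · exact hT'.edge b
  have := this.hasTiling (s := s) (fun _ => 1) (by rintro (b | b) c <;> simp [hc, hc'])
  simpa using this

lemma HasTiling.mono {W W' : Finset V} {s k : ℕ} (hW : W ⊆ W') (h : HasTiling A P W s k) :
    HasTiling A P W' s k := by
  obtain ⟨T, hT, hc⟩ := h
  exact ⟨T, ⟨fun b c => (hT.sub b c).trans hW, hT.disj, hT.edge⟩, hc⟩

lemma interleave_perm : ∀ {xs ys zs : List V}, xs.length = ys.length → ys.length = zs.length →
    (interleave xs ys zs).Perm (xs ++ ys ++ zs)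
  | [], [], [], _, _ => by simp [interleave]
  | [], _ :: _, _, h, _ => by simp at h
  | _ :: _, [], _, h, _ => by simp at h
  | _, [], _ :: _, _, h => by simp at h
  | _, _ :: _, [], _, h => by simp at h
  | x :: xs, y :: ys, z :: zs, h, h' => by
    have ih := interleave_perm (xs := xs) (ys := ys) (zs := zs) (by simpa using h)
      (by simpa using h')
    simp only [interleave, List.cons_append, List.append_assoc]
    refine List.Perm.cons x ?_
    have h1 : (xs ++ y :: (ys ++ z :: zs)).Perm (y :: (xs ++ (ys ++ z :: zs))) :=
      List.perm_middle
    refine List.Perm.trans ?_ h1.symm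
    refine List.Perm.cons y ?_
    rw [← List.append_assoc]
    exact (ih.cons z).trans List.perm_middle.symm

lemma tightPath_interleave (hA : IsHypergraph A) {X Y Z : Finset V}
    (hXYZ : ∀ x ∈ X, ∀ y ∈ Y, ∀ z ∈ Z, A x y z) {a b : V} (ha : a ∈ X) (hb : b ∈ Y) :
    ∀ {xs ys zs : List V}, (∀ x ∈ xs, x ∈ X) → (∀ y ∈ ys, y ∈ Y) → (∀ z ∈ zs, z ∈ Z) →
    TightPath A (interleave xs ys zs ++ [a, b])
  | [], _, _, _, _, _ => by simp [interleave, TightPath]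
  | _ :: _, [], _, _, _, _ => by simp [interleave, TightPath]
  | _ :: _, _ :: _, [], _, _, _ => by simp [interleave, TightPath]
  | x :: xs, y :: ys, z :: zs, hx, hy, hz => by
    have ih := tightPath_interleave hA hXYZ ha hb (xs := xs) (ys := ys) (zs := zs)
      (fun x h => hx x (by simp [h])) (fun x h => hy x (by simp [h]))
      (fun x h => hz x (by simp [h]))
    have hx0 := hx x (by simp)
    have hy0 := hy y (by simp)
    have hz0 := hz z (by simp)
    have key : ∃ p q l, interleave xs ys zs ++ [a, b] = p :: q :: l ∧ p ∈ X ∧ q ∈ Y := by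
      match xs, ys, zs, hx, hy with
      | [], _, _, _, _ => exact ⟨a, b, [], by simp [interleave], ha, hb⟩
      | _ :: _, [], _, _, _ => exact ⟨a, b, [], by simp [interleave], ha, hb⟩
      | _ :: _, _ :: _, [], _, _ => exact ⟨a, b, [], by simp [interleave], ha, hb⟩
      | p :: _, q :: _, _ :: _, hx, hy =>
        exact ⟨p, q, _, by simp only [interleave, List.cons_append]; rfl, hx p (by simp), hy q (by simp)⟩
    obtain ⟨p, q, l, he, hp, hq⟩ := key
    rw [he] at ih
    simp only [interleave, List.cons_append, he, TightPath]
    exact ⟨hXYZ x hx0 y hy0 z hz0, hA.rot (hXYZ p hp y hy0 z hz0),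
      hA.rot (hA.rot (hXYZ p hp q hq z hz0)), ih⟩

lemma exists_disjoint_lists (Q : ℕ → List V → Prop) (F₀ : Finset V) (q L : ℕ)
    (h : ∀ i < q, ∀ F : Finset V, #F ≤ #F₀ + q * L →
      ∃ l : List V, l.length ≤ L ∧ (∀ v ∈ l, v ∉ F) ∧ Q i l) :
    ∃ C : ℕ → List V, ∀ i < q, (C i).length ≤ L ∧ (∀ v ∈ C i, v ∉ F₀) ∧ Q i (C i) ∧
      ∀ j < i, ∀ v ∈ C i, v ∉ C j := by
  suffices H : ∀ k ≤ q, ∃ C : ℕ → List V, ∀ i < k, (C i).length ≤ L ∧ (∀ v ∈ C i, v ∉ F₀) ∧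
      Q i (C i) ∧ ∀ j < i, ∀ v ∈ C i, v ∉ C j from H q le_rfl
  intro k
  induction k with
  | zero => exact fun _ => ⟨fun _ => [], by simp⟩
  | succ k ih =>
    intro hk
    obtain ⟨C, hC⟩ := ih (by omega)
    have hcard : #(F₀ ∪ (range k).biUnion fun i => (C i).toFinset) ≤ #F₀ + q * L := by
      refine (card_union_le _ _).trans (Nat.add_le_add_left ?_ _)
      refine (card_biUnion_le_card_mul _ _ L fun i hi => ?_).trans ?_
      · exact (List.toFinset_card_le _).trans (hC i (mem_range.1 hi)).1
      · rw [card_range]; exact Nat.mul_le_mul_right _ (by omega)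
    obtain ⟨l, hl, hF, hQ⟩ := h k (by omega) _ hcard
    simp only [mem_union, mem_biUnion, mem_range, List.mem_toFinset, not_or, not_exists,
      not_and] at hF
    refine ⟨Function.update C k l, fun i hi => ?_⟩
    rcases Nat.lt_succ_iff_lt_or_eq.1 hi with hi | rfl
    · have hne : i ≠ k := by omega
      rw [Function.update_of_ne hne]
      obtain ⟨h1, h2, h3, h4⟩ := hC i hi
      refine ⟨h1, h2, h3, fun j hj => ?_⟩
      rw [Function.update_of_ne (by omega)]
      exact h4 j hj
    · simp only [Function.update_self]
      refine ⟨hl, fun v hv => (hF v hv).1, hQ, fun j hj v hv => ?_⟩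
      rw [Function.update_of_ne (by omega)]
      exact (hF v hv).2 j hj

lemma TightPath.getElem : ∀ {l : List V}, TightPath A l → ∀ i (h : i + 2 < l.length),
    A l[i] l[i + 1] l[i + 2]
  | [], _, i, h => by simp at h
  | [_], _, i, h => by simp at h
  | [_, _], _, i, h => by simp at h
  | a :: b :: c :: l, ht, 0, _ => ht.1
  | a :: b :: c :: l, ht, i + 1, h => by
    have := TightPath.getElem (l := b :: c :: l) ht.2 i (by simpa using h)
    simpa using this

lemma exists_cycle_of_list {x y : V} {l : List V} (hd : (x :: y :: l).Nodup)
    (ht : TightPath A (x :: y :: l ++ [x, y])) :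
    ∃ f : ZMod (l.length + 2) → V, Function.Injective f ∧
      ∀ i, A (f i) (f (i + 1)) (f (i + 2)) := by
  have hlt : ∀ i : ZMod (l.length + 2), i.val < (x :: y :: l).length := fun i => by
    have := ZMod.val_lt i
    simp only [List.length_cons]; omega
  refine ⟨fun i => (x :: y :: l)[i.val]'(hlt i), fun i j hij => ?_, fun i => ?_⟩
  · exact ZMod.val_injective _ ((List.Nodup.getElem_inj_iff hd).1 hij)
  · have hmod : ∀ j (hj : j < (x :: y :: l ++ [x, y]).length),
        (x :: y :: l ++ [x, y])[j] = (x :: y :: l)[j % (l.length + 2)]'(by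
          have := Nat.mod_lt j (show 0 < l.length + 2 by omega)
          simp only [List.length_cons]; omega) := by
      intro j hj
      by_cases hj' : j < (x :: y :: l).length
      · rw [List.getElem_append_left hj']
        congr 1
        rw [Nat.mod_eq_of_lt (by simp only [List.length_cons] at hj'; omega)]
      · push Not at hj'
        rw [List.getElem_append_right hj']
        simp only [List.length_cons, List.length_append, List.length_nil] at hj hj'
        obtain rfl | rfl : j = l.length + 2 ∨ j = l.length + 2 + 1 := by omega
        · simp
        · have : (l.length + 2 + 1) % (l.length + 2) = 1 := by
            rw [Nat.add_mod_left]; exact Nat.mod_eq_of_lt (by omega)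
          simp [this]
    have h := ht.getElem i.val (by have := hlt i; simp at this ⊢; omega)
    rw [hmod, hmod, hmod] at h
    have h0 : i.val % (l.length + 2) = i.val := Nat.mod_eq_of_lt (ZMod.val_lt i)
    have h1 : (i + 1).val = (i.val + 1) % (l.length + 2) := by
      rw [ZMod.val_add, ZMod.val_one_eq_one_mod, Nat.add_mod_mod]
    have h2 : (i + 2).val = (i.val + 2) % (l.length + 2) := by
      rw [ZMod.val_add, ZMod.val_two_eq_two_mod, Nat.add_mod_mod]
    simp only [h0, ← h1, ← h2] at h
    exact h

end Tilings

section Assembly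
variable {V : Type} {A : V → V → V → Prop} {P : V → V → Prop}

lemma exists_list_avoiding (X U : Finset V) (x x' : V) {s u : ℕ} (hs : s ≤ #X)
    (hu : #(U ∩ X) ≤ u) : ∃ l : List V, l.length = s - (2 + u) ∧ l.Nodup ∧
      ∀ v ∈ l, v ∈ X ∧ v ∉ U ∧ v ≠ x ∧ v ≠ x' := by
  have h1 : s - (2 + u) ≤ #(X \ (U ∪ {x, x'})) := by
    have h2 := card_sdiff_add_card_inter X (U ∪ {x, x'})
    have h3 : #(X ∩ (U ∪ {x, x'})) ≤ u + 2 := by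
      rw [inter_comm, union_inter_distrib_right]
      refine (card_union_le _ _).trans (Nat.add_le_add hu ?_)
      exact (card_le_card inter_subset_left).trans card_le_two
    omega
  obtain ⟨S, hS, hc⟩ := exists_subset_card_eq h1
  refine ⟨S.toList, by simp [hc], nodup_toList _, fun v hv => ?_⟩
  have := hS (mem_toList.1 hv)
  simp only [mem_sdiff, mem_union, mem_insert, mem_singleton, not_or] at this
  exact ⟨this.1, this.2.1, this.2.2.1, this.2.2.2⟩

lemma length_flatMap_range (S : ℕ → List V) (k : ℕ) :
    ((List.range k).flatMap S).length = ∑ i ∈ range k, (S i).length := by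
  induction k with
  | zero => simp
  | succ k ih => rw [List.range_succ, List.flatMap_append, List.length_append, ih,
      Finset.sum_range_succ]; simp

lemma exists_cycle_of_hasTiling (hA : IsHypergraph A) {L N s q : ℕ} {W : Finset V}
    (hconn : ∀ x y z w, P x y → P z w → ∀ F : Finset V, #F ≤ N →
      ∃ l : List V, l.length ≤ L ∧ l.Nodup ∧ (∀ v ∈ l, v ∉ F) ∧
        TightPath A ([x, y] ++ l ++ [z, w]))
    (hT : HasTiling A P W s q) (hs : 2 ≤ s) (hq : 0 < q) (hN : (5 + L) * q ≤ N) :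
    ∃ (ℓ : ℕ) (f : ZMod ℓ → V), Function.Injective f ∧
      (∀ i, A (f i) (f (i + 1)) (f (i + 2))) ∧ 3 * s * q ≤ ℓ + (6 + 3 * L) * q := by
  obtain ⟨T, hT, hc⟩ := hT
  have hpick : ∀ i c, ∃ a b, a ∈ T i c ∧ b ∈ T i c ∧ a ≠ b := fun i c => by
    have : 1 < #(T i c) := by rw [hc]; omega
    obtain ⟨a, ha, b, hb, hab⟩ := one_lt_card.1 this
    exact ⟨a, b, ha, hb, hab⟩
  choose a b ha hb hab using hpick
  have hin : ∀ {i j c d v}, v ∈ T i c → v ∈ T j d → i = j ∧ c = d := by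
    intro i j c d v h h'
    by_contra hne
    have hd := hT.disj (i, c) (j, d) (fun h => hne (by simpa using h))
    exact disjoint_left.1 hd h h'
  let φ : ℕ → Fin q := fun k => ⟨k % q, Nat.mod_lt _ hq⟩
  have hφ : ∀ i j, i < q → j < q → φ i = φ j → i = j := by
    intro i j hi hj h
    simpa [φ, Nat.mod_eq_of_lt hi, Nat.mod_eq_of_lt hj] using h
  -- reserved vertices and connecting paths
  set F₀ : Finset V := univ.biUnion fun i => {a i 0, a i 1, a i 2, b i 0, b i 1} with hF₀
  have hF₀c : #F₀ ≤ q * 5 := by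
    refine (card_biUnion_le_card_mul _ _ 5 fun i _ => card_le_five).trans ?_
    simp
  have hmemF₀ : ∀ i, a i 0 ∈ F₀ ∧ a i 1 ∈ F₀ ∧ a i 2 ∈ F₀ ∧ b i 0 ∈ F₀ ∧ b i 1 ∈ F₀ := by
    intro i
    simp only [hF₀, mem_biUnion, mem_univ, true_and]
    exact ⟨⟨i, by simp⟩, ⟨i, by simp⟩, ⟨i, by simp⟩, ⟨i, by simp⟩, ⟨i, by simp⟩⟩
  have hP : ∀ i, ∀ x ∈ T i 0, ∀ y ∈ T i 1, P x y := fun i x hx y hy =>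
    (hT.edge i x hx y hy _ (ha i 2)).2
  obtain ⟨C, hC⟩ := exists_disjoint_lists (fun k l => l.Nodup ∧ TightPath A
      ([b (φ k) 0, b (φ k) 1] ++ l ++ [a (φ (k + 1)) 0, a (φ (k + 1)) 1])) F₀ q L (by
    intro k _ F hF
    obtain ⟨l, h1, h2, h3, h4⟩ := hconn _ _ _ _ (hP (φ k) _ (hb _ 0) _ (hb _ 1))
      (hP (φ (k + 1)) _ (ha _ 0) _ (ha _ 1)) F (by nlinarith)
    exact ⟨l, h1, h3, h2, h4⟩)
  set U : Finset V := (range q).biUnion fun i => (C i).toFinset with hU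
  have hUc : #U ≤ q * L := by
    refine (card_biUnion_le_card_mul _ _ L fun i hi => ?_).trans (by simp)
    exact (List.toFinset_card_le _).trans (hC i (mem_range.1 hi)).1
  have hCU : ∀ k < q, ∀ v ∈ C k, v ∈ U := fun k hk v hv => by
    simp only [hU, mem_biUnion, mem_range, List.mem_toFinset]
    exact ⟨k, hk, hv⟩
  have hF₀U : ∀ v ∈ F₀, v ∉ U := by
    intro v hv hvU
    simp only [hU, mem_biUnion, mem_range, List.mem_toFinset] at hvU
    obtain ⟨k, hk, hvk⟩ := hvU
    exact (hC k hk).2.1 v hvk hv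
  set u : Fin q → ℕ := fun i => #(U ∩ univ.biUnion (T i)) with hu
  have hlist := fun i c => exists_list_avoiding (T i c) U (a i c) (b i c) (s := s) (u := u i)
    (hc i c).ge (card_le_card (inter_subset_inter_left (subset_biUnion_of_mem (T i) (mem_univ c))))
  choose X hXl hXd hX using hlist
  have husum : ∑ i, u i ≤ q * L := by
    refine le_trans ?_ hUc
    rw [← card_biUnion]
    · exact card_le_card (biUnion_subset.2 fun i _ => inter_subset_left)
    · intro i _ j _ hij
      refine disjoint_of_subset_left inter_subset_right
        (disjoint_of_subset_right inter_subset_right ?_)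
      rw [disjoint_left]
      intro v hv hv'
      simp only [mem_biUnion, mem_univ, true_and] at hv hv'
      obtain ⟨c, hv⟩ := hv
      obtain ⟨d, hv'⟩ := hv'
      exact hij (hin hv hv').1
  -- the segments of the cycle
  set Y : Fin q → Fin 3 → List V := fun i c => a i c :: X i c with hY
  have hYmem : ∀ i c, ∀ v ∈ Y i c, v ∈ T i c := by
    intro i c v hv
    rcases List.mem_cons.1 hv with rfl | hv
    · exact ha i c
    · exact (hX i c v hv).1
  have hYU : ∀ i c, ∀ v ∈ Y i c, v ∉ U := by
    intro i c v hv
    rcases List.mem_cons.1 hv with rfl | hv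
    · apply hF₀U
      have := hmemF₀ i
      fin_cases c
      exacts [this.1, this.2.1, this.2.2.1]
    · exact (hX i c v hv).2.1
  have hYb : ∀ i c, ∀ v ∈ Y i c, v ≠ b i c := by
    intro i c v hv
    rcases List.mem_cons.1 hv with rfl | hv
    · exact hab i c
    · exact (hX i c v hv).2.2.2
  have hYd : ∀ i c, (Y i c).Nodup := fun i c =>
    List.nodup_cons.2 ⟨fun h => (hX i c _ h).2.2.1 rfl, hXd i c⟩
  have hYl : ∀ i c, (Y i c).length = s - (2 + u i) + 1 := fun i c => by simp [hY, hXl]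
  set I : Fin q → List V := fun i => interleave (Y i 0) (Y i 1) (Y i 2) with hI
  have hIperm : ∀ i, (I i).Perm (Y i 0 ++ Y i 1 ++ Y i 2) := fun i =>
    interleave_perm (by simp [hYl]) (by simp [hYl])
  have hImem : ∀ i, ∀ v ∈ I i, ∃ c, v ∈ Y i c := by
    intro i v hv
    rw [(hIperm i).mem_iff] at hv
    simp only [List.mem_append] at hv
    rcases hv with (hv | hv) | hv
    exacts [⟨0, hv⟩, ⟨1, hv⟩, ⟨2, hv⟩]
  have hId : ∀ i, (I i).Nodup := by
    intro i
    rw [(hIperm i).nodup_iff, List.nodup_append, List.nodup_append]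
    refine ⟨⟨hYd i 0, hYd i 1, ?_⟩, hYd i 2, ?_⟩
    · rintro v hv w hw rfl
      have := (hin (hYmem i _ v hv) (hYmem i _ v hw)).2
      exact absurd this (by decide)
    · rintro v hv w hw rfl
      rcases List.mem_append.1 hv with hv | hv
      · exact absurd (hin (hYmem i _ v hv) (hYmem i _ v hw)).2 (by decide)
      · exact absurd (hin (hYmem i _ v hv) (hYmem i _ v hw)).2 (by decide)
  set S : ℕ → List V := fun k => I (φ k) ++ ([b (φ k) 0, b (φ k) 1] ++ C k) with hS
  have hSmem : ∀ k < q, ∀ v ∈ S k, (∃ c, v ∈ T (φ k) c ∧ v ∉ U) ∨ v ∈ C k := by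
    intro k hk v hv
    simp only [hS, List.mem_append, List.mem_cons, List.not_mem_nil, or_false] at hv
    rcases hv with hv | (rfl | rfl) | hv
    · obtain ⟨c, hv⟩ := hImem _ v hv
      exact Or.inl ⟨c, hYmem _ c v hv, hYU _ c v hv⟩
    · exact Or.inl ⟨0, hb _ _, hF₀U _ (hmemF₀ _).2.2.2.1⟩
    · exact Or.inl ⟨1, hb _ _, hF₀U _ (hmemF₀ _).2.2.2.2⟩
    · exact Or.inr hv
  have hSd : ∀ k < q, (S k).Nodup := by
    intro k hk
    obtain ⟨h1, h2, ⟨h3, h4⟩, h5⟩ := hC k hk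
    rw [hS]
    simp only [List.nodup_append]
    refine ⟨hId _, ⟨?_, h3, ?_⟩, ?_⟩
    · simp only [List.nodup_cons, List.mem_singleton, List.not_mem_nil, not_false_eq_true,
        List.nodup_nil, and_true]
      intro h
      exact absurd (hin (hb (φ k) 0) (h ▸ hb (φ k) 1)).2 (by decide)
    · rintro v hv w hw rfl
      simp only [List.mem_cons, List.not_mem_nil, or_false] at hv
      rcases hv with rfl | rfl
      · exact h2 _ hw (hmemF₀ _).2.2.2.1
      · exact h2 _ hw (hmemF₀ _).2.2.2.2
    · rintro v hv w hw rfl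
      obtain ⟨c, hv⟩ := hImem _ v hv
      simp only [List.mem_append, List.mem_cons, List.not_mem_nil, or_false] at hw
      rcases hw with (rfl | rfl) | hw
      · obtain ⟨-, rfl⟩ := hin (hYmem _ _ _ hv) (hb (φ k) 0)
        exact hYb _ _ _ hv rfl
      · obtain ⟨-, rfl⟩ := hin (hYmem _ _ _ hv) (hb (φ k) 1)
        exact hYb _ _ _ hv rfl
      · exact hYU _ _ _ hv (hCU k hk v hw)
  have hSdis : ∀ j k, j < k → k < q → List.Disjoint (S j) (S k) := by
    intro j k hjk hk v hv hv'
    rcases hSmem j (hjk.trans hk) v hv with ⟨c, h1, h2⟩ | h1 <;>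
      rcases hSmem k hk v hv' with ⟨d, h3, h4⟩ | h3
    · exact hjk.ne (hφ _ _ (hjk.trans hk) hk (hin h1 h3).1)
    · exact h2 (hCU k hk v h3)
    · exact h4 (hCU j (hjk.trans hk) v h1)
    · exact (hC k hk).2.2.2 j hjk v h3 h1
  set B : ℕ → List V := fun k => a (φ k) 2 :: interleave (X (φ k) 0) (X (φ k) 1) (X (φ k) 2) ++
    ([b (φ k) 0, b (φ k) 1] ++ C k) with hB
  have hSB : ∀ k, S k = [a (φ k) 0, a (φ k) 1] ++ B k := fun k => by
    simp [hS, hI, hY, hB, interleave]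
  have hSt : ∀ k < q, TightPath A (S k ++ [a (φ (k + 1)) 0, a (φ (k + 1)) 1]) := by
    intro k hk
    have h1 : TightPath A (I (φ k) ++ [b (φ k) 0, b (φ k) 1]) :=
      tightPath_interleave hA (X := T (φ k) 0) (Y := T (φ k) 1) (Z := T (φ k) 2)
        (fun x hx y hy z hz => (hT.edge _ x hx y hy z hz).1) (hb _ _) (hb _ _) (hYmem _ _)
        (hYmem _ _) (hYmem _ _)
    have h2 := tightPath_append (l₂ := C k ++ [a (φ (k + 1)) 0, a (φ (k + 1)) 1]) h1 (by
      simpa using (hC k hk).2.2.1.2)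
    simpa [hS] using h2
  have hWt : ∀ k ≤ q, TightPath A ((List.range k).flatMap S ++ [a (φ k) 0, a (φ k) 1]) := by
    intro k
    induction k with
    | zero => intro _; simp [TightPath]
    | succ k ih =>
      intro hk
      have h1 := hSt k (by omega)
      rw [hSB, List.append_assoc] at h1
      have h2 := tightPath_append (ih (by omega)) h1
      rw [List.range_succ, List.flatMap_append]
      simpa [hSB] using h2
  have hWd : ((List.range q).flatMap S).Nodup := by
    rw [List.nodup_flatMap]
    refine ⟨fun k hk => hSd k (List.mem_range.1 hk), ?_⟩
    refine List.Pairwise.imp_of_mem ?_ List.pairwise_lt_range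
    intro j k _ hk hjk
    exact hSdis j k hjk (List.mem_range.1 hk)
  have hWl : 3 * s * q ≤ ((List.range q).flatMap S).length + (6 + 3 * L) * q := by
    rw [length_flatMap_range]
    have h1 : ∀ k ∈ range q, 3 * s ≤ (S k).length + 6 + 3 * u (φ k) := by
      intro k _
      simp only [hS, List.length_append, (hIperm _).length_eq, hYl]
      omega
    have h2 := sum_le_sum h1
    simp only [sum_add_distrib, ← mul_sum, sum_const, card_range, smul_eq_mul] at h2
    have h3 : ∑ k ∈ range q, u (φ k) = ∑ i, u i := by
      rw [← Fin.sum_univ_eq_sum_range (fun k => u (φ k))]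
      refine sum_congr rfl fun i _ => ?_
      congr 1
      exact Fin.ext (Nat.mod_eq_of_lt i.2)
    rw [h3] at h2
    nlinarith
  have h0 : φ q = φ 0 := by simp [φ]
  have hWq := hWt q le_rfl
  rw [h0] at hWq
  obtain ⟨l, hl⟩ : ∃ l, (List.range q).flatMap S = a (φ 0) 0 :: a (φ 0) 1 :: l := by
    obtain ⟨q', rfl⟩ : ∃ q', q = q' + 1 := ⟨q - 1, by omega⟩
    rw [List.range_succ_eq_map, List.flatMap_cons, hSB]
    exact ⟨_, by simp only [List.cons_append, List.nil_append]; rfl⟩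
  rw [hl] at hWq hWd hWl
  obtain ⟨f, hf, hfA⟩ := exists_cycle_of_list hWd hWq
  exact ⟨_, f, hf, hfA, by simpa using hWl⟩

end Assembly

section Matching
variable {ι : Type}

/-- The list of end points of a list of pairs. -/
def ends (l : List (ι × ι)) : List ι := l.flatMap fun p => [p.1, p.2]

/-- A list of pairwise disjoint edges. -/
def IsMatching (R : ι → ι → Prop) (l : List (ι × ι)) : Prop :=
  (∀ p ∈ l, R p.1 p.2) ∧ (ends l).Nodup

variable {R : ι → ι → Prop}

lemma ends_cons (p : ι × ι) (l : List (ι × ι)) : ends (p :: l) = p.1 :: p.2 :: ends l := by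
  simp [ends]

lemma mem_ends {l : List (ι × ι)} {v : ι} : v ∈ ends l ↔ ∃ p ∈ l, v = p.1 ∨ v = p.2 := by
  simp [ends]

lemma perm_ends {l l' : List (ι × ι)} (h : l.Perm l') : (ends l).Perm (ends l') :=
  h.flatMap_right _

lemma IsMatching.perm {l l' : List (ι × ι)} (h : IsMatching R l) (hp : l.Perm l') :
    IsMatching R l' :=
  ⟨fun p hp' => h.1 p (hp.mem_iff.2 hp'), (perm_ends hp).nodup_iff.1 h.2⟩

lemma IsMatching.nodup {l : List (ι × ι)} (h : IsMatching R l) : l.Nodup := by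
  induction l with
  | nil => simp
  | cons p l ih =>
    obtain ⟨h1, h2⟩ := h
    rw [ends_cons, List.nodup_cons, List.nodup_cons] at h2
    refine List.nodup_cons.2 ⟨fun hp => h2.1 ?_, ih ⟨fun q hq => h1 q (by simp [hq]), h2.2.2⟩⟩
    exact List.mem_cons_of_mem _ (mem_ends.2 ⟨p, hp, Or.inl rfl⟩)

lemma IsMatching.ne {l : List (ι × ι)} (h : IsMatching R l) {p q : ι × ι} (hp : p ∈ l)
    (hq : q ∈ l) : p.1 ≠ q.2 ∧ (p.1 = q.1 → p = q) ∧ (p.2 = q.2 → p = q) := by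
  by_cases hpq : p = q
  · subst hpq
    have := (h.perm (List.perm_cons_erase hp)).2
    simp only [ends_cons, List.nodup_cons, List.mem_cons, not_or] at this
    exact ⟨this.1.1, fun _ => rfl, fun _ => rfl⟩
  · have hperm : l.Perm (p :: q :: (l.erase p).erase q) :=
      (List.perm_cons_erase hp).trans
        ((List.perm_cons_erase ((List.mem_erase_of_ne (Ne.symm hpq)).2 hq)).cons p)
    have := (h.perm hperm).2
    simp only [ends_cons, List.nodup_cons, List.mem_cons, not_or] at this
    exact ⟨this.1.2.2.1, fun h => absurd h this.1.2.1, fun h => absurd h this.2.1.2.1⟩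

lemma ends_map_swap_perm (C : ι × ι → Prop) (l : List (ι × ι)) :
    (ends (l.map fun p => if C p then p.swap else p)).Perm (ends l) := by
  induction l with
  | nil => simp [ends]
  | cons p l ih =>
    rw [List.map_cons, ends_cons, ends_cons]
    split_ifs
    · exact (List.Perm.swap _ _ _).trans ((ih.cons _).cons _)
    · exact (ih.cons _).cons _

lemma length_ends (l : List (ι × ι)) : (ends l).length = 2 * l.length := by
  induction l with
  | nil => simp [ends]
  | cons p l ih => rw [ends_cons]; simp [ih]; ring

/-- The two elements of a set of size at least two: one avoids any given element. -/
lemma exists_mem_ne_of_two_le {s : Finset ι} (h : 2 ≤ #s) (a : ι) : ∃ b ∈ s, b ≠ a := by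
  by_contra! hcon
  have : s ⊆ {a} := fun b hb => mem_singleton.2 (hcon b hb)
  have := card_le_card this
  simp at this
  omega

lemma four_mul_sq_le {ν h w m : ℝ} (hh : 0 ≤ h) (hhν : h ≤ ν) (hνm : ν ≤ m) (hw : 0 ≤ w)
    (hy : w + 2 * ν ≤ 3 * m) : 4 * ν ^ 2 - h ^ 2 + 2 * h * w ≤ 2 * m ^ 2 + (w + 2 * ν) * m := by
  rcases le_total w m with hwm | hwm
  · nlinarith [sq_nonneg (h - w), mul_nonneg hw (sub_nonneg.2 hwm), mul_nonneg (hh.trans hhν)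
      (sub_nonneg.2 hνm), mul_nonneg (sub_nonneg.2 hνm) (hh.trans (hhν.trans hνm))]
  · have h1 : 2 * h * w - h ^ 2 ≤ 2 * ν * w - ν ^ 2 := by
      nlinarith [mul_nonneg (sub_nonneg.2 hhν) (show 0 ≤ 2 * w - h - ν by linarith)]
    have hν0 : 0 ≤ ν := hh.trans hhν
    have hm0 : 0 ≤ m := hν0.trans hνm
    rcases le_total (2 * ν) m with h2 | h2
    · nlinarith [mul_nonneg (sub_nonneg.2 h2) (sub_nonneg.2 hwm), mul_nonneg hν0 hm0,
        mul_nonneg (sub_nonneg.2 hνm) hν0, mul_nonneg (sub_nonneg.2 hνm) hm0]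
    · nlinarith [mul_nonneg (sub_nonneg.2 h2) (sub_nonneg.2 hy),
        mul_nonneg (sub_nonneg.2 hνm) (show 0 ≤ 5 * m - ν by linarith)]

lemma IsMatching.augment {p : ι × ι} {l : List (ι × ι)} {x y : ι} (h : IsMatching R (p :: l))
    (hx : x ∉ ends (p :: l)) (hy : y ∉ ends (p :: l)) (hxy : x ≠ y) (h1 : R p.1 x)
    (h2 : R p.2 y) : IsMatching R ((p.1, x) :: (p.2, y) :: l) := by
  obtain ⟨ha, hb⟩ := h
  refine ⟨fun q hq => ?_, ?_⟩
  · simp only [List.mem_cons] at hq ha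
    rcases hq with rfl | rfl | hq
    exacts [h1, h2, ha q (Or.inr hq)]
  · simp only [ends_cons, List.nodup_cons, List.mem_cons, not_or] at hx hy hb ⊢
    grind

lemma IsMatching.augment_two {p q : ι × ι} {l : List (ι × ι)} {x y : ι}
    (h : IsMatching R (p :: q :: l)) (hx : x ∉ ends (p :: q :: l)) (hy : y ∉ ends (p :: q :: l))
    (hxy : x ≠ y) (h1 : R p.1 x) (h2 : R q.1 y) (h3 : R p.2 q.2) :
    IsMatching R ((p.1, x) :: (q.1, y) :: (p.2, q.2) :: l) := by
  obtain ⟨ha, hb⟩ := h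
  refine ⟨fun r hr => ?_, ?_⟩
  · simp only [List.mem_cons] at hr ha
    rcases hr with rfl | rfl | rfl | hr
    exacts [h1, h2, h3, ha r (Or.inr (Or.inr hr))]
  · simp only [ends_cons, List.nodup_cons, List.mem_cons, not_or] at hx hy hb ⊢
    grind

set_option maxHeartbeats 400000 in
lemma card_edges_le_of_no_larger_matching [Fintype ι]
    (hs : ∀ {x y}, R x y → R y x) (hi : ∀ x, ¬ R x x)
    {Y : Finset ι} (hY : ∀ {x y}, R x y → x ∈ Y) {m : ℕ} (hm : #Y ≤ 3 * m)
    {l : List (ι × ι)} (hl : IsMatching R l) (hlm : l.length ≤ m)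
    (hmax : ∀ l', IsMatching R l' → l'.length ≠ l.length + 1) :
    weight (fun x y => if R x y then (1 : ℝ) else 0) Y Y ≤
      2 * (m : ℝ) ^ 2 + #Y * m + 4 * m := by
  set W : Finset ι := Y \ (ends l).toFinset with hW
  set D : ι → Finset ι := fun v => {y ∈ W | R v y} with hD
  -- orient the matching edges
  obtain ⟨l, hl, hlm, hmax, hWeq, hor⟩ : ∃ l₁ : List (ι × ι), IsMatching R l₁ ∧
      l₁.length ≤ m ∧ (∀ l', IsMatching R l' → l'.length ≠ l₁.length + 1) ∧
      W = Y \ (ends l₁).toFinset ∧ ∀ p ∈ l₁, 2 ≤ #(D p.1) ∨ #(D p.2) ≤ 1 := by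
    have hperm := ends_map_swap_perm (fun p => 2 ≤ #(D p.2)) l
    refine ⟨_, ⟨?_, hperm.nodup_iff.2 hl.2⟩, by simpa using hlm, by simpa using hmax, ?_, ?_⟩
    · intro p hp
      obtain ⟨q, hq, rfl⟩ := List.mem_map.1 hp
      split_ifs
      · exact hs (hl.1 q hq)
      · exact hl.1 q hq
    · rw [hW]; congr 1; ext v; simp [hperm.mem_iff]
    · intro p hp
      obtain ⟨q, hq, rfl⟩ := List.mem_map.1 hp
      split_ifs with h
      · exact Or.inl h
      · exact Or.inr (by omega)
  have hWmem : ∀ {v}, v ∈ W ↔ v ∈ Y ∧ v ∉ ends l := by simp [hWeq]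
  clear_value W
  clear hW
  set VM : Finset ι := (ends l).toFinset with hVM
  have hVMc : #VM = 2 * l.length := by
    rw [hVM, List.toFinset_card_of_nodup hl.2, length_ends]
  have hVMY : VM ⊆ Y := by
    intro v hv
    rw [hVM, List.mem_toFinset, mem_ends] at hv
    obtain ⟨p, hp, rfl | rfl⟩ := hv
    · exact hY (hl.1 p hp)
    · exact hY (hs (hl.1 p hp))
  have hYu : VM ∪ W = Y := by rw [hWeq, union_sdiff_of_subset hVMY]
  have hdis : Disjoint VM W := by rw [hWeq]; exact disjoint_sdiff
  have hYc : #Y = 2 * l.length + #W := by rw [← hYu, card_union_of_disjoint hdis, hVMc]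
  -- no augmentation is possible
  have hWind : ∀ x ∈ W, ∀ y ∈ W, ¬ R x y := by
    intro x hx y hy hxy
    have hne : x ≠ y := fun h => hi x (h ▸ hxy)
    refine hmax ((x, y) :: l) ⟨?_, ?_⟩ rfl
    · intro p hp
      rcases List.mem_cons.1 hp with rfl | hp
      exacts [hxy, hl.1 p hp]
    · rw [ends_cons, List.nodup_cons, List.nodup_cons]
      exact ⟨by simp [hne, (hWmem.1 hx).2], (hWmem.1 hy).2, hl.2⟩
  have haug : ∀ p ∈ l, ∀ x ∈ D p.1, ∀ y ∈ D p.2, x = y := by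
    intro p hp x hx y hy
    by_contra hxy
    simp only [hD, mem_filter] at hx hy
    have hperm := List.perm_cons_erase hp
    have hmem : ∀ {v}, v ∉ ends l → v ∉ ends (p :: l.erase p) := fun hv hv' =>
      hv ((perm_ends hperm).mem_iff.2 hv')
    refine hmax _ ((hl.perm hperm).augment (hmem (hWmem.1 hx.1).2) (hmem (hWmem.1 hy.1).2) hxy
      hx.2 hy.2) ?_
    have := hperm.length_eq
    simp only [List.length_cons] at this ⊢
    omega
  have haug2 : ∀ p ∈ l, ∀ q ∈ l, 2 ≤ #(D p.1) → 2 ≤ #(D q.1) → ¬ R p.2 q.2 := by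
    intro p hp q hq hp2 hq2 hR
    by_cases hpq : p = q
    · subst hpq; exact hi _ hR
    obtain ⟨x, hx⟩ := card_pos.1 (show 0 < #(D p.1) by omega)
    obtain ⟨y, hy, hxy⟩ := exists_mem_ne_of_two_le hq2 x
    simp only [hD, mem_filter] at hx hy
    have hperm := List.perm_cons_erase hp
    have hperm2 : l.Perm (p :: q :: (l.erase p).erase q) :=
      hperm.trans ((List.perm_cons_erase ((List.mem_erase_of_ne (Ne.symm hpq)).2 hq)).cons p)
    have hmem : ∀ {v}, v ∉ ends l → v ∉ ends (p :: q :: (l.erase p).erase q) := fun hv hv' =>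
      hv ((perm_ends hperm2).mem_iff.2 hv')
    refine hmax _ ((hl.perm hperm2).augment_two (hmem (hWmem.1 hx.1).2) (hmem (hWmem.1 hy.1).2)
      hxy.symm hx.2 hy.2 hR) ?_
    have := hperm2.length_eq
    simp only [List.length_cons] at this ⊢
    omega
  -- counting
  set H : Finset (ι × ι) := {p ∈ l.toFinset | 2 ≤ #(D p.1)} with hH
  set Q : Finset ι := H.image Prod.snd with hQ
  set g : ι → ι → ℝ := fun x y => if R x y then (1 : ℝ) else 0 with hg
  have hHl : ∀ p ∈ H, p ∈ l := fun p hp => by simpa using (mem_filter.1 hp).1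
  have hQc : #Q = #H := card_image_of_injOn fun p hp q hq h =>
    (hl.ne (hHl p hp) (hHl q hq)).2.2 h
  have hHc : #H ≤ l.length := (card_filter_le _ _).trans (List.toFinset_card_le l)
  have hVMVM : weight g VM VM ≤ 4 * (l.length : ℝ) ^ 2 - (#H : ℝ) ^ 2 := by
    have h1 : ∀ x ∈ VM, ∀ y ∈ VM, g x y ≤
        1 - (if x ∈ Q then (1 : ℝ) else 0) * (if y ∈ Q then 1 else 0) := by
      intro x hx y hy
      by_cases hQ' : x ∈ Q ∧ y ∈ Q
      · have : ¬ R x y := by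
          obtain ⟨p, hp, rfl⟩ := mem_image.1 hQ'.1
          obtain ⟨q, hq, rfl⟩ := mem_image.1 hQ'.2
          exact haug2 p (hHl p hp) q (hHl q hq) (mem_filter.1 hp).2 (mem_filter.1 hq).2
        simp [hg, this, hQ']
      · have : (if x ∈ Q then (1 : ℝ) else 0) * (if y ∈ Q then 1 else 0) = 0 := by
          rw [not_and_or] at hQ'
          rcases hQ' with h | h <;> simp [h]
        rw [this, hg]
        dsimp only
        split_ifs <;> norm_num
    have hQVM : Q ⊆ VM := by
      intro v hv
      obtain ⟨p, hp, rfl⟩ := mem_image.1 hv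
      rw [hVM, List.mem_toFinset, mem_ends]
      exact ⟨p, hHl p hp, Or.inr rfl⟩
    calc weight g VM VM ≤ ∑ x ∈ VM, ∑ y ∈ VM,
          (1 - (if x ∈ Q then (1 : ℝ) else 0) * (if y ∈ Q then 1 else 0)) :=
          sum_le_sum fun x hx => sum_le_sum fun y hy => h1 x hx y hy
      _ = 4 * (l.length : ℝ) ^ 2 - (#H : ℝ) ^ 2 := by
          simp only [sum_sub_distrib, ← mul_sum, ← sum_mul]
          rw [← sum_filter, filter_mem_eq_inter, inter_eq_right.2 hQVM]
          simp [hVMc, hQc]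
          ring
  have hdW : ∀ v, ∑ y ∈ W, g v y = #(D v) := by
    intro v
    simp [hg, hD]
  have hVMW : weight g VM W ≤ 2 * l.length + #H * #W := by
    have hVMimg : VM = l.toFinset.image Prod.fst ∪ l.toFinset.image Prod.snd := by
      ext v
      simp only [hVM, List.mem_toFinset, mem_ends, mem_union, mem_image]
      constructor
      · rintro ⟨p, hp, rfl | rfl⟩
        exacts [Or.inl ⟨p, hp, rfl⟩, Or.inr ⟨p, hp, rfl⟩]
      · rintro (⟨p, hp, rfl⟩ | ⟨p, hp, rfl⟩)
        exacts [⟨p, hp, Or.inl rfl⟩, ⟨p, hp, Or.inr rfl⟩]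
    have h1 : ∀ p ∈ l.toFinset, (#(D p.1) : ℝ) + #(D p.2) ≤
        2 + (if 2 ≤ #(D p.1) then (#W : ℝ) else 0) := by
      intro p hp
      rw [List.mem_toFinset] at hp
      split_ifs with hheavy
      · have h2 : D p.2 = ∅ := by
          rw [eq_empty_iff_forall_notMem]
          intro y hy
          obtain ⟨x, hx, hxy⟩ := exists_mem_ne_of_two_le hheavy y
          exact hxy (haug p hp x hx y hy)
        have h3 : (#(D p.1) : ℝ) ≤ #W := by exact_mod_cast card_filter_le W (fun y => R p.1 y)
        rw [h2, card_empty, Nat.cast_zero]; linarith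
      · have h2 := (hor p hp).resolve_left hheavy
        have : #(D p.1) + #(D p.2) ≤ 2 := by omega
        rw [add_zero, ← Nat.cast_add]
        exact_mod_cast this
    have hmemS : ∀ p, p ∈ (l.toFinset : Set (ι × ι)) → p ∈ l := fun p hp =>
      List.mem_toFinset.1 (mem_coe.1 hp)
    calc weight g VM W ≤ ∑ p ∈ l.toFinset, (#(D p.1) : ℝ) + ∑ p ∈ l.toFinset, (#(D p.2) : ℝ) := by
          rw [weight]
          simp only [hdW]
          rw [hVMimg]
          have h2 := sum_union_inter (s₁ := l.toFinset.image Prod.fst)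
            (s₂ := l.toFinset.image Prod.snd) (f := fun v => (#(D v) : ℝ))
          have h3 : (0 : ℝ) ≤ ∑ v ∈ l.toFinset.image Prod.fst ∩ l.toFinset.image Prod.snd,
            (#(D v) : ℝ) := sum_nonneg fun _ _ => Nat.cast_nonneg _
          rw [sum_image (s := l.toFinset) (g := Prod.fst) (fun p hp q hq h =>
              (hl.ne (hmemS p hp) (hmemS q hq)).2.1 h),
            sum_image (s := l.toFinset) (g := Prod.snd) (fun p hp q hq h =>
              (hl.ne (hmemS p hp) (hmemS q hq)).2.2 h)] at h2
          linarith
      _ ≤ ∑ p ∈ l.toFinset, (2 + (if 2 ≤ #(D p.1) then (#W : ℝ) else 0)) := by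
          rw [← sum_add_distrib]
          exact sum_le_sum h1
      _ = 2 * l.length + #H * #W := by
          rw [sum_add_distrib, ← sum_filter, ← hH]
          simp [List.toFinset_card_of_nodup hl.nodup]
          ring
  have hWW : weight g W W = 0 :=
    sum_eq_zero fun x hx => sum_eq_zero fun y hy => by simp [hg, hWind x hx y hy]
  have hsym : ∀ x y, g x y = g y x := fun x y => by
    simp only [hg]
    congr 1
    exact propext ⟨hs, hs⟩
  have htotal : weight g Y Y = weight g VM VM + 2 * weight g VM W + weight g W W := by
    rw [← hYu, weight_union_left hdis, weight_union_right _ hdis, weight_union_right _ hdis,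
      weight_comm hsym W VM]
    ring
  have hlmR : (l.length : ℝ) ≤ m := by exact_mod_cast hlm
  have hHcR : (#H : ℝ) ≤ l.length := by exact_mod_cast hHc
  have hYcR : (#Y : ℝ) = 2 * l.length + #W := by exact_mod_cast hYc
  have hmR : (#Y : ℝ) ≤ 3 * m := by exact_mod_cast hm
  have := four_mul_sq_le (h := #H) (ν := l.length) (w := #W) (m := m) (by positivity) hHcR hlmR
    (by positivity) (by linarith)
  rw [htotal, hWW, hYcR]
  linarith

/-- A graph with many edges, all of them inside `Y`, has a large matching. -/
lemma exists_matching [Fintype ι] (hs : ∀ {x y}, R x y → R y x) (hi : ∀ x, ¬ R x x)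
    {Y : Finset ι} (hY : ∀ {x y}, R x y → x ∈ Y) {m : ℕ} (hm : #Y ≤ 3 * m)
    (he : 2 * (m : ℝ) ^ 2 + #Y * m + 4 * m <
      weight (fun x y => if R x y then (1 : ℝ) else 0) Y Y) :
    ∃ M : Fin (m + 1) × Bool → ι, Function.Injective M ∧ ∀ k, R (M (k, false)) (M (k, true)) := by
  obtain ⟨l, hl, hlen⟩ : ∃ l, IsMatching R l ∧ l.length = m + 1 := by
    by_contra hcon
    set Pr : ℕ → Prop := fun k => ∃ l, IsMatching R l ∧ l.length = k with hPr
    have h0 : Pr 0 := ⟨[], ⟨by simp, by simp [ends]⟩, rfl⟩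
    obtain ⟨l, hl, hlen⟩ := Nat.findGreatest_spec (P := Pr) (Nat.zero_le m) h0
    have hle := Nat.findGreatest_le (P := Pr) m
    refine absurd he (not_lt.2 (card_edges_le_of_no_larger_matching (R := R) (hs := fun h => hs h)
      hi (hY := fun h => hY h) hm hl
      (by omega) fun l' hl' hl'' => ?_))
    by_cases h : l.length = m
    · exact hcon ⟨l', hl', by omega⟩
    · exact Nat.findGreatest_is_greatest (P := Pr) (n := m) (k := l.length + 1) (by omega)
        (by omega) ⟨l', hl', hl''⟩
  refine ⟨fun k => if k.2 then (l[k.1.val]'(by omega)).2 else (l[k.1.val]'(by omega)).1, ?_, ?_⟩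
  · have hk : ∀ k k' : Fin (m + 1), l[k.val]'(by omega) = l[k'.val]'(by omega) → k = k' :=
      fun k k' h => Fin.ext ((List.Nodup.getElem_inj_iff hl.nodup).1 h)
    have hne := fun k k' : Fin (m + 1) => hl.ne (List.getElem_mem (show k.val < l.length by omega))
      (List.getElem_mem (show k'.val < l.length by omega))
    rintro ⟨k, _ | _⟩ ⟨k', _ | _⟩ h
    · simp only [Bool.false_eq_true, if_false] at h
      rw [hk k k' ((hne k k').2.1 h)]
    · exact absurd (by simpa using h) (hne k k').1
    · exact absurd (by simpa using h.symm) (hne k' k).1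
    · simp only [if_true] at h
      rw [hk k k' ((hne k k').2.2 h)]
  · intro k
    simpa using hl.1 _ (List.getElem_mem _)

end Matching

section Boxes

lemma exists_injective_common {Y S : Type} [Fintype Y] [Fintype S] (t : ℕ) {c : ℝ} (hc : 0 < c)
    (hY : 0 < Fintype.card Y)
    (hS : 2 * ((t + 1 : ℕ) : ℝ) ^ 2 < c ^ (t + 1) * Fintype.card S) (R : S → Y → Prop)
    (hR : c * (Fintype.card S * Fintype.card Y) ≤ #{p : S × Y | R p.1 p.2}) :
    ∃ z : Fin (t + 1) → S, Function.Injective z ∧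
      c ^ (t + 1) / 2 * Fintype.card Y ≤ #{y : Y | ∀ i, R (z i) y} := by
  have hYR : (0 : ℝ) < Fintype.card Y := by exact_mod_cast hY
  have hSR : (0 : ℝ) < Fintype.card S := by
    by_contra h
    have : c ^ (t + 1) * (Fintype.card S : ℝ) ≤ 0 :=
      mul_nonpos_of_nonneg_of_nonpos (by positivity) (not_lt.1 h)
    have h2 : (0 : ℝ) ≤ 2 * ((t + 1 : ℕ) : ℝ) ^ 2 := by positivity
    linarith
  set d : Y → ℝ := fun y => #{s : S | R s y} with hd
  have hsum : ∑ y, d y = #{p : S × Y | R p.1 p.2} := by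
    rw [card_filter, Fintype.sum_prod_type_right]
    push_cast
    refine sum_congr rfl fun y _ => ?_
    simp [hd]
  have hdouble : ∑ z : Fin (t + 1) → S, (#{y : Y | ∀ i, R (z i) y} : ℝ) =
      ∑ y, d y ^ (t + 1) := by
    have h1 : ∀ y, d y ^ (t + 1) =
        ∑ z : Fin (t + 1) → S, if ∀ i, R (z i) y then (1 : ℝ) else 0 := by
      intro y
      have := Fintype.card_piFinset_const (α := S) {s : S | R s y} (t + 1)
      rw [hd]
      dsimp only
      rw [← Nat.cast_pow, ← this, sum_boole]
      congr 2
      ext z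
      simp [Fintype.mem_piFinset]
    simp only [h1]
    rw [sum_comm]
    refine sum_congr rfl fun z _ => ?_
    rw [sum_boole]
  have hpow : c ^ (t + 1) * (Fintype.card S : ℝ) ^ (t + 1) * Fintype.card Y ≤
      ∑ y, d y ^ (t + 1) := by
    have h1 := pow_sum_div_card_le_sum_pow (s := (univ : Finset Y)) (f := d)
      (fun y _ => by simp [hd]) t
    rw [card_univ] at h1
    refine le_trans ?_ h1
    rw [le_div_iff₀ (by positivity)]
    calc _ = (c * (Fintype.card S * Fintype.card Y)) ^ (t + 1) := by ring
      _ ≤ _ := by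
        rw [hsum]
        gcongr
  by_contra! hcon
  have hni := card_pi_not_injective_le (ι := Fin (t + 1)) (S := S)
  rw [Fintype.card_fin] at hni
  have hle : ∑ z : Fin (t + 1) → S, (#{y : Y | ∀ i, R (z i) y} : ℝ) ≤
      ∑ z : Fin (t + 1) → S, (c ^ (t + 1) / 2 * Fintype.card Y +
        if ¬ Function.Injective z then (Fintype.card Y : ℝ) else 0) := by
    refine sum_le_sum fun z _ => ?_
    by_cases hz : ¬ Function.Injective z
    · rw [if_pos hz]
      have : (#{y : Y | ∀ i, R (z i) y} : ℝ) ≤ Fintype.card Y := by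
        exact_mod_cast card_le_univ _
      have h2 : 0 ≤ c ^ (t + 1) / 2 * (Fintype.card Y : ℝ) := by positivity
      linarith
    · rw [if_neg hz]
      have := hcon z (not_not.1 hz)
      linarith
  rw [sum_add_distrib, sum_const, card_univ, ← sum_filter, sum_const, nsmul_eq_mul, nsmul_eq_mul,
    Fintype.card_fun, Fintype.card_fin] at hle
  push_cast at hle hni
  set N : ℝ := ((#{ω : Fin (t + 1) → S | ¬ Function.Injective ω} : ℕ) : ℝ) with hN
  set q : ℝ := (Fintype.card S : ℝ)
  set C : ℝ := c ^ (t + 1)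
  set y : ℝ := (Fintype.card Y : ℝ)
  have hq1 : 0 < q ^ (t + 1) := by positivity
  have hkey : C * q ^ (t + 1) * y ≤ q ^ (t + 1) * (C / 2 * y) + N * y := by
    refine (hpow.trans hdouble.symm.le).trans (hle.trans (le_of_eq ?_))
    rfl
  have h3 : C * q ^ (t + 1) / 2 ≤ N := by
    have : (C * q ^ (t + 1) / 2) * y ≤ N * y := by nlinarith
    exact le_of_mul_le_mul_right this hYR
  have h4 : C * q ^ (t + 1) / 2 * q ≤ ((t : ℝ) + 1) ^ 2 * q ^ (t + 1) :=
    (mul_le_mul_of_nonneg_right h3 hSR.le).trans hni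
  have h5 : C * q / 2 ≤ ((t : ℝ) + 1) ^ 2 := by
    have : (C * q / 2) * q ^ (t + 1) ≤ ((t : ℝ) + 1) ^ 2 * q ^ (t + 1) := by
      calc _ = C * q ^ (t + 1) / 2 * q := by ring
        _ ≤ _ := h4
    exact le_of_mul_le_mul_right this hq1
  push_cast at hS
  linarith

/-- A dense set of `k`-tuples contains a large box. -/
lemma exists_box (k t : ℕ) : ∀ c : ℝ, 0 < c → ∃ s₀ : ℕ, ∀ (S : Type) [Fintype S],
    s₀ ≤ Fintype.card S → ∀ F : Finset (Fin k → S), c * (Fintype.card S : ℝ) ^ k ≤ #F →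
    ∃ T : Fin k → Finset S, (∀ i, #(T i) = t + 1) ∧ ∀ x, (∀ i, x i ∈ T i) → x ∈ F := by
  induction k with
  | zero =>
    intro c hc
    refine ⟨0, fun S _ _ F hF => ⟨fun i => i.elim0, fun i => i.elim0, fun x _ => ?_⟩⟩
    have : 0 < #F := by
      rw [pow_zero, mul_one] at hF
      exact_mod_cast hc.trans_le hF
    obtain ⟨y, hy⟩ := card_pos.1 this
    rwa [Subsingleton.elim x y]
  | succ k ih =>
    intro c hc
    obtain ⟨s₁, hs₁⟩ := ih (c ^ (t + 1) / 2) (by positivity)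
    obtain ⟨s₂, hs₂⟩ := exists_nat_gt (2 * ((t + 1 : ℕ) : ℝ) ^ 2 / c ^ (t + 1))
    refine ⟨max 1 (max s₁ s₂), fun S _ hS F hF => ?_⟩
    have h1S : 1 ≤ Fintype.card S := (le_max_left _ _).trans hS
    have hS2 : (s₂ : ℝ) ≤ Fintype.card S := by
      exact_mod_cast (le_max_right _ _).trans ((le_max_right _ _).trans hS)
    have hcount : #{p : S × (Fin k → S) | (Fin.cons p.1 p.2 : Fin (k + 1) → S) ∈ F} = #F := by
      refine card_bij (fun p _ => (Fin.cons p.1 p.2 : Fin (k + 1) → S)) ?_ ?_ ?_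
      · intro p hp
        simpa using hp
      · intro p _ q _ h
        exact Prod.ext (Fin.cons_injective2 h).1 (Fin.cons_injective2 h).2
      · intro x hx
        exact ⟨(x 0, Fin.tail x), by simpa using hx, by simp⟩
    obtain ⟨z, hz, hcz⟩ := exists_injective_common (Y := Fin k → S) (S := S) t hc
      (by rw [Fintype.card_fun, Fintype.card_fin]; positivity)
      (by
        rw [div_lt_iff₀ (by positivity)] at hs₂
        rw [mul_comm (c ^ (t + 1))]
        exact hs₂.trans_le (mul_le_mul_of_nonneg_right hS2 (by positivity)))
      (fun s y => (Fin.cons s y : Fin (k + 1) → S) ∈ F)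
      (by
        rw [Fintype.card_fun, Fintype.card_fin]
        push_cast
        rw [← pow_succ']
        refine hF.trans (le_of_eq ?_)
        rw [← hcount]
        congr)
    rw [Fintype.card_fun, Fintype.card_fin] at hcz
    push_cast at hcz
    obtain ⟨T, hT, hTF⟩ := hs₁ S ((le_max_left _ _).trans ((le_max_right _ _).trans hS)) _ hcz
    refine ⟨Fin.cons (univ.image z) T, fun i => ?_, fun x hx => ?_⟩
    · refine Fin.cases ?_ (fun i => ?_) i
      · simp [card_image_of_injective _ hz]
      · simpa using hT i
    · have h0 := hx 0
      simp only [Fin.cons_zero, mem_image, mem_univ, true_and] at h0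
      obtain ⟨j, hj⟩ := h0
      have h1 := hTF (Fin.tail x) (fun i => by simpa [Fin.tail] using hx i.succ)
      simp only [mem_filter, mem_univ, true_and] at h1
      have h2 := h1 j
      rwa [hj, Fin.cons_self_tail] at h2

end Boxes

section Sampling

lemma sum_block_marginal {β V : Type} [Fintype β] {s : ℕ} (hs : 0 < s)
    {ψ : β × Fin 3 × Fin s → V} (hψ : Function.Injective ψ) (F : V → ℝ) :
    ∑ σ : β × (Fin 3 → Fin s), ∑ c, F (ψ (σ.1, c, σ.2 c)) =
      (s : ℝ) ^ 2 * ∑ w ∈ univ.image ψ, F w := by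
  have hsR : (0 : ℝ) < s := by exact_mod_cast hs
  rw [sum_image (fun _ _ _ _ h => hψ h), Fintype.sum_prod_type, Fintype.sum_prod_type, mul_sum]
  refine sum_congr rfl fun b _ => ?_
  rw [sum_comm, Fintype.sum_prod_type, mul_sum]
  refine sum_congr rfl fun c _ => ?_
  have := sum_pi_eval (S := Fin s) c (fun a => F (ψ (b, c, a)))
  simp only [Fintype.card_fin] at this
  have h2 : (s : ℝ) * ∑ ω : Fin 3 → Fin s, F (ψ (b, c, ω c)) =
      s * ((s : ℝ) ^ 2 * ∑ a, F (ψ (b, c, a))) := by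
    rw [this]; ring
  exact mul_left_cancel₀ hsR.ne' h2

lemma sum_sum_ne (m : ℕ) (a : Fin 3 → Fin 3 → ℝ) :
    ∑ p : Fin m × Fin 3, ∑ q : Fin m × Fin 3, (if p.1 ≠ q.1 then a p.2 q.2 else 0) =
      m * (m - 1) * ∑ c, ∑ d, a c d := by
  have h1 : ∀ i : Fin m, ∀ x : ℝ, ∑ j : Fin m, (if i ≠ j then x else 0) = (m - 1) * x := by
    intro i x
    have : ∀ j : Fin m, (if i ≠ j then x else 0) = x - if i = j then x else 0 := by
      intro j
      by_cases h : i = j <;> simp [h]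
    simp only [this, sum_sub_distrib, sum_ite_eq, mem_univ, if_true]
    simp
    ring
  simp only [Fintype.sum_prod_type]
  calc _ = ∑ i : Fin m, ∑ c : Fin 3, ∑ d : Fin 3, ∑ j : Fin m,
        (if i ≠ j then a c d else 0) :=
        sum_congr rfl fun i _ => sum_congr rfl fun c _ => sum_comm
    _ = _ := by
      simp only [h1, ← mul_sum]
      simp
      ring

lemma sum_pattern_edges {S V : Type} [Fintype S] (x : Fin 3 → S → V) {W : Finset V} {K : ℝ}
    (hx : ∀ F : V → ℝ, ∑ t, ∑ c, F (x c t) = K * ∑ w ∈ W, F w) (g : V → V → ℝ) (m : ℕ) :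
    (Fintype.card S : ℝ) ^ 2 * ∑ ω : Fin m → S, ∑ p : Fin m × Fin 3, ∑ q : Fin m × Fin 3,
      (if p.1 ≠ q.1 then g (x p.2 (ω p.1)) (x q.2 (ω q.1)) else 0) =
    (Fintype.card S : ℝ) ^ m * (m * (m - 1) * (K ^ 2 * weight g W W)) := by
  have h1 : ∀ p q : Fin m × Fin 3, (Fintype.card S : ℝ) ^ 2 * ∑ ω : Fin m → S,
      (if p.1 ≠ q.1 then g (x p.2 (ω p.1)) (x q.2 (ω q.1)) else 0) =
      if p.1 ≠ q.1 then (Fintype.card S : ℝ) ^ m * ∑ t, ∑ t', g (x p.2 t) (x q.2 t') else 0 := by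
    intro p q
    split_ifs with h
    · have := sum_pi_eval_two h (fun t t' => g (x p.2 t) (x q.2 t'))
      rwa [Fintype.card_fin] at this
    · simp
  rw [sum_comm]
  simp_rw [sum_comm (s := (univ : Finset (Fin m → S)))]
  rw [mul_sum]
  simp_rw [mul_sum (s := (univ : Finset (Fin m × Fin 3))), h1]
  rw [sum_sum_ne m (fun c d => (Fintype.card S : ℝ) ^ m * ∑ t, ∑ t', g (x c t) (x d t'))]
  have h2 : ∑ c : Fin 3, ∑ d : Fin 3, ∑ t, ∑ t', g (x c t) (x d t') = K ^ 2 * weight g W W := by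
    calc _ = ∑ t, ∑ c, ∑ t', ∑ d, g (x c t) (x d t') := by
          rw [sum_comm (s := (univ : Finset S))]
          refine sum_congr rfl fun c _ => ?_
          rw [sum_comm]
          exact sum_congr rfl fun t _ => sum_comm
      _ = ∑ t, ∑ c, (fun v => K * ∑ w ∈ W, g v w) (x c t) :=
          sum_congr rfl fun t _ => sum_congr rfl fun c _ => hx (fun w => g (x c t) w)
      _ = _ := by
          rw [hx (fun v => K * ∑ w ∈ W, g v w), ← mul_sum, weight]
          ring
  simp only [← mul_sum]
  rw [h2]
  ring

lemma sum_pattern_hits {S V : Type} [Fintype S] (x : Fin 3 → S → V) {W : Finset V} {K : ℝ}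
    (hx : ∀ F : V → ℝ, ∑ t, ∑ c, F (x c t) = K * ∑ w ∈ W, F w) (X : Finset V) (m : ℕ) :
    (Fintype.card S : ℝ) * ∑ ω : Fin m → S, (#{p : Fin m × Fin 3 | x p.2 (ω p.1) ∈ X} : ℝ) =
    (Fintype.card S : ℝ) ^ m * (m * (K * #(X ∩ W))) := by
  have h1 : ∀ ω : Fin m → S, (#{p : Fin m × Fin 3 | x p.2 (ω p.1) ∈ X} : ℝ) =
      ∑ i : Fin m, ∑ c, if x c (ω i) ∈ X then (1 : ℝ) else 0 := by
    intro ω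
    rw [card_filter, Fintype.sum_prod_type]
    push_cast
    rfl
  simp only [h1]
  rw [sum_comm, mul_sum]
  have h2 : ∀ i : Fin m, (Fintype.card S : ℝ) * ∑ ω : Fin m → S, ∑ c,
      (if x c (ω i) ∈ X then (1 : ℝ) else 0) = (Fintype.card S : ℝ) ^ m * (K * #(X ∩ W)) := by
    intro i
    have := sum_pi_eval i (fun t => ∑ c, if x c t ∈ X then (1 : ℝ) else 0)
    rw [Fintype.card_fin] at this
    rw [this, hx (fun v => if v ∈ X then (1 : ℝ) else 0)]
    congr 2
    rw [sum_boole, filter_mem_eq_inter, inter_comm]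
  simp only [h2]
  simp
  ring

lemma frequently_pattern_dense {S V : Type} [Fintype S] [Nonempty S] (x : Fin 3 → S → V)
    {W : Finset V} {K : ℝ} (hx : ∀ F : V → ℝ, ∑ t, ∑ c, F (x c t) = K * ∑ w ∈ W, F w)
    {R : V → V → Prop} {X : Finset V} {α : ℝ} (hα : 0 < α)
    (hR : (2 / 9 + α) * (#W : ℝ) ^ 2 + #(X ∩ W) * #W / 3 ≤
      weight (fun v w => if R v w then (1 : ℝ) else 0) W W)
    {m : ℕ} (hm : 2 ≤ m) (hmα : 2 ≤ α * (m - 1)) :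
    α / 4 * (Fintype.card S : ℝ) ^ m ≤ #{ω : Fin m → S |
      2 * (m : ℝ) ^ 2 + #{p : Fin m × Fin 3 | x p.2 (ω p.1) ∈ X} * m + 4 * m <
        ∑ p : Fin m × Fin 3, ∑ q : Fin m × Fin 3,
          if p.1 ≠ q.1 ∧ R (x p.2 (ω p.1)) (x q.2 (ω q.1)) then (1 : ℝ) else 0} := by
  have hS : (0 : ℝ) < Fintype.card S := by exact_mod_cast Fintype.card_pos
  have hKW : 3 * (Fintype.card S : ℝ) = K * #W := by
    have := hx (fun _ => 1)
    simp at this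
    linarith
  have hW : (0 : ℝ) < #W := by
    rcases Nat.eq_zero_or_pos #W with h | h
    · rw [h] at hKW; simp at hKW
    · exact_mod_cast h
  have hmR : (2 : ℝ) ≤ m := by exact_mod_cast hm
  set e : (Fin m → S) → ℝ := fun ω => ∑ p : Fin m × Fin 3, ∑ q : Fin m × Fin 3,
    if p.1 ≠ q.1 ∧ R (x p.2 (ω p.1)) (x q.2 (ω q.1)) then (1 : ℝ) else 0 with he
  set y : (Fin m → S) → ℝ := fun ω => #{p : Fin m × Fin 3 | x p.2 (ω p.1) ∈ X} with hy
  set G : Finset (Fin m → S) := {ω | 2 * (m : ℝ) ^ 2 + y ω * m + 4 * m < e ω} with hG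
  set Ω : ℝ := (Fintype.card S : ℝ) ^ m with hΩ
  have hΩ0 : 0 < Ω := by positivity
  have hsumE : (Fintype.card S : ℝ) ^ 2 * ∑ ω, e ω = Ω * (m * (m - 1) *
      (K ^ 2 * weight (fun v w => if R v w then (1 : ℝ) else 0) W W)) := by
    rw [hΩ, ← sum_pattern_edges x hx]
    simp only [he, ite_and]
  have hsumY : (Fintype.card S : ℝ) * ∑ ω, y ω = Ω * (m * (K * #(X ∩ W))) := sum_pattern_hits x hx X m
  -- normalise
  set ξ : ℝ := #(X ∩ W) / #W with hξ
  have hξ0 : 0 ≤ ξ := by positivity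
  have hξ1 : ξ ≤ 1 := by
    rw [hξ, div_le_one hW]
    exact_mod_cast card_le_card inter_subset_right
  have hXW : (#(X ∩ W) : ℝ) = ξ * #W := by rw [hξ]; field_simp
  have hY : ∑ ω, y ω = Ω * (3 * m * ξ) := by
    apply mul_left_cancel₀ hS.ne'
    rw [hsumY, hXW]
    linear_combination -(Ω * m * ξ) * hKW
  have hE : Ω * (m * (m - 1) * (2 + 9 * α + 3 * ξ)) ≤ ∑ ω, e ω := by
    have h1 : (Fintype.card S : ℝ) ^ 2 * (Ω * (m * (m - 1) * (2 + 9 * α + 3 * ξ))) ≤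
        (Fintype.card S : ℝ) ^ 2 * ∑ ω, e ω := by
      rw [hsumE]
      have h2 : K ^ 2 * ((2 / 9 + α) * (#W : ℝ) ^ 2 + #(X ∩ W) * #W / 3) ≤
          K ^ 2 * weight (fun v w => if R v w then (1 : ℝ) else 0) W W :=
        mul_le_mul_of_nonneg_left hR (sq_nonneg K)
      have h3 : K ^ 2 * ((2 / 9 + α) * (#W : ℝ) ^ 2 + #(X ∩ W) * #W / 3) =
          (Fintype.card S : ℝ) ^ 2 * (2 + 9 * α + 3 * ξ) := by
        rw [hXW]
        linear_combination -((2 / 9 + α + ξ / 3) * (K * #W + 3 * Fintype.card S)) * hKW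
      calc _ = Ω * (m * (m - 1) * ((Fintype.card S : ℝ) ^ 2 * (2 + 9 * α + 3 * ξ))) := by ring
        _ ≤ _ := by
          have : (0 : ℝ) ≤ m * (m - 1) := by nlinarith
          rw [← h3]
          exact mul_le_mul_of_nonneg_left (mul_le_mul_of_nonneg_left h2 this) hΩ0.le
    exact le_of_mul_le_mul_left h1 (by positivity)
  have hub : ∀ ω, e ω - (2 * (m : ℝ) ^ 2 + y ω * m + 4 * m) ≤
      if ω ∈ G then 9 * (m : ℝ) ^ 2 else 0 := by
    intro ω
    split_ifs with h
    · have h1 : e ω ≤ ∑ p : Fin m × Fin 3, ∑ q : Fin m × Fin 3, (1 : ℝ) :=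
        sum_le_sum fun p _ => sum_le_sum fun q _ => by split_ifs <;> norm_num
      have h2 : ∑ p : Fin m × Fin 3, ∑ q : Fin m × Fin 3, (1 : ℝ) = 9 * (m : ℝ) ^ 2 := by
        simp only [sum_const, card_univ, Fintype.card_prod, Fintype.card_fin, nsmul_eq_mul]
        push_cast
        ring
      have h3 : 0 ≤ y ω := by simp [hy]
      nlinarith [mul_nonneg h3 (by positivity : (0 : ℝ) ≤ m)]
    · simp only [hG, mem_filter, mem_univ, true_and, not_lt] at h
      linarith
  have hsum := sum_le_sum fun ω (_ : ω ∈ (univ : Finset (Fin m → S))) => hub ω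
  have hY' : ∑ ω, y ω * m = Ω * (3 * m * ξ) * m := by rw [← sum_mul, hY]
  rw [sum_sub_distrib, sum_add_distrib, sum_add_distrib, hY', sum_ite_mem, univ_inter] at hsum
  rw [sum_const, sum_const, sum_const] at hsum
  simp only [card_univ, nsmul_eq_mul, Fintype.card_fun, Fintype.card_fin] at hsum
  push_cast at hsum
  rw [← hΩ] at hsum
  have hmain : Ω * (9 * m * (α * (m - 1) - 1)) ≤ #G * (9 * (m : ℝ) ^ 2) := by
    have h0 : 0 ≤ Ω * m * (1 - ξ) := mul_nonneg (by positivity) (by linarith)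
    nlinarith
  have h5 : Ω * (9 * m * (α * m / 4)) ≤ Ω * (9 * m * (α * (m - 1) - 1)) := by
    have : α * m / 4 ≤ α * (m - 1) - 1 := by nlinarith
    gcongr
  have h6 : (α / 4 * Ω) * (9 * (m : ℝ) ^ 2) ≤ #G * (9 * (m : ℝ) ^ 2) := by
    calc _ = Ω * (9 * m * (α * m / 4)) := by ring
      _ ≤ _ := h5.trans hmain
  exact le_of_mul_le_mul_right h6 (by positivity)

end Sampling

/-- The vertex with coordinates `p` of a choice `ω` of blocks and of one vertex in each part. -/
def blockVertex {β V : Type} {s m : ℕ} (ψ : β × Fin 3 × Fin s → V)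
    (ω : Fin m → β × (Fin 3 → Fin s)) (p : Fin m × Fin 3) : V :=
  ψ ((ω p.1).1, p.2, (ω p.1).2 p.2)

section FrequentMatching

lemma frequently_exists_matching {V β : Type} [Fintype β] [Nonempty β] {s : ℕ} (hs : 0 < s)
    {ψ : β × Fin 3 × Fin s → V} (hψ : Function.Injective ψ) {W : Finset V}
    (hW : W = univ.image ψ) {R : V → V → Prop} (hsymm : ∀ x y, R x y → R y x)
    {X : Finset V} (hX : ∀ x y, R x y → x ∈ X) {α : ℝ} (hα : 0 < α)
    (hR : (2 / 9 + α) * (#W : ℝ) ^ 2 + #(X ∩ W) * #W / 3 ≤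
      weight (fun v w => if R v w then (1 : ℝ) else 0) W W)
    {m : ℕ} (hm : 2 ≤ m) (hmα : 2 ≤ α * (m - 1)) :
    α / 4 * (Fintype.card (β × (Fin 3 → Fin s)) : ℝ) ^ m ≤
      #{ω : Fin m → β × (Fin 3 → Fin s) | ∃ M : Fin (m + 1) × Bool → Fin m × Fin 3,
        Function.Injective M ∧
          ∀ k, R (blockVertex ψ ω (M (k, false))) (blockVertex ψ ω (M (k, true)))} := by
  have : Nonempty (Fin s) := ⟨⟨0, hs⟩⟩
  have h1 := frequently_pattern_dense (S := β × (Fin 3 → Fin s))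
    (x := fun c σ => ψ (σ.1, c, σ.2 c)) (K := (s : ℝ) ^ 2) (W := W)
    (fun F => by rw [hW]; exact sum_block_marginal hs hψ F) hα hR hm hmα
  refine h1.trans (Nat.cast_le.2 (card_le_card fun ω hω => ?_))
  simp only [mem_filter, mem_univ, true_and] at hω ⊢
  set Y : Finset (Fin m × Fin 3) := {p | blockVertex ψ ω p ∈ X} with hY
  set Rω : Fin m × Fin 3 → Fin m × Fin 3 → Prop := fun p q =>
    p.1 ≠ q.1 ∧ R (blockVertex ψ ω p) (blockVertex ψ ω q) with hRω
  have hRs : ∀ {p q}, Rω p q → Rω q p := fun h => ⟨h.1.symm, hsymm _ _ h.2⟩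
  have hRY : ∀ {p q}, Rω p q → p ∈ Y := fun h => by
    simp only [hY, mem_filter, mem_univ, true_and]
    exact hX _ _ h.2
  obtain ⟨M, hM, hM'⟩ := exists_matching (R := Rω) (hs := fun h => hRs h) (fun x h => h.1 rfl)
    (Y := Y) (hY := fun h => hRY h) (m := m)
    (by
      refine (card_le_univ Y).trans ?_
      simp [mul_comm])
    (by
      refine lt_of_lt_of_eq hω ?_
      rw [weight]
      trans ∑ p, ∑ q, if Rω p q then (1 : ℝ) else 0
      · refine sum_congr rfl fun p _ => sum_congr rfl fun q _ => ?_
        congr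
      have h0 : ∀ p q, p ∉ Y ∨ q ∉ Y → (if Rω p q then (1 : ℝ) else 0) = 0 := by
        intro p q h
        refine if_neg fun hR => ?_
        rcases h with h | h
        exacts [h (hRY hR), h (hRY (hRs hR))]
      rw [← sum_subset (s₁ := Y) (subset_univ Y) (fun p _ hp => sum_eq_zero fun q _ => h0 p q (Or.inl hp))]
      refine sum_congr rfl fun p _ => ?_
      rw [← sum_subset (subset_univ Y) (fun q _ hq => h0 p q (Or.inr hq))]
      refine sum_congr rfl fun q _ => ?_
      congr)
  exact ⟨M, hM, fun k => (hM' k).2⟩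

lemma exists_frequent_matching {α c : ℝ} (hα : 0 < α) (hc : 0 < c) {m : ℕ} (hm : 2 ≤ m)
    (hmα : 2 ≤ α * (m - 1)) :
    ∃ c' : ℝ, 0 < c' ∧ ∀ (V β : Type) [Fintype V] [Fintype β] [Nonempty β] (s : ℕ), 0 < s →
    ∀ ψ : β × Fin 3 × Fin s → V, Function.Injective ψ → ∀ W : Finset V, W = univ.image ψ →
    ∀ (R : V → V → V → Prop) (X : V → Finset V), (∀ u x y, R u x y → R u y x) →
    (∀ u x y, R u x y → x ∈ X u) → ∀ U : Finset V, c * Fintype.card V ≤ #U →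
    (∀ u ∈ U, (2 / 9 + α) * (#W : ℝ) ^ 2 + #(X u ∩ W) * #W / 3 ≤
      weight (fun v w => if R u v w then (1 : ℝ) else 0) W W) →
    ∃ M : Fin (m + 1) × Bool → Fin m × Fin 3, Function.Injective M ∧
      c' * (Fintype.card V * (Fintype.card (β × (Fin 3 → Fin s)) : ℝ) ^ m) ≤
      #{p : V × (Fin m → β × (Fin 3 → Fin s)) | p.1 ∈ U ∧
        ∀ k, R p.1 (blockVertex ψ p.2 (M (k, false))) (blockVertex ψ p.2 (M (k, true)))} := by
  have : Nonempty (Fin m) := ⟨⟨0, by omega⟩⟩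
  set C : ℕ := Fintype.card (Fin (m + 1) × Bool → Fin m × Fin 3) with hC
  have hC0 : (0 : ℝ) < C := by exact_mod_cast Fintype.card_pos
  refine ⟨c * (α / 4) / C, by positivity, ?_⟩
  intro V β _ _ _ s hs ψ hψ W hW R X hsymm hX U hU hdense
  have : Nonempty (Fin s) := ⟨⟨0, hs⟩⟩
  have : Nonempty V := ⟨ψ (Classical.arbitrary β, 0, ⟨0, hs⟩)⟩
  have hV : (0 : ℝ) < Fintype.card V := by exact_mod_cast Fintype.card_pos
  set q : ℝ := (Fintype.card (β × (Fin 3 → Fin s)) : ℝ) ^ m with hq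
  have hq0 : 0 < q := by
    have : (0 : ℝ) < Fintype.card (β × (Fin 3 → Fin s)) := by exact_mod_cast Fintype.card_pos
    positivity
  set Pr : (Fin (m + 1) × Bool → Fin m × Fin 3) →
      V × (Fin m → β × (Fin 3 → Fin s)) → Prop := fun M p => Function.Injective M ∧ p.1 ∈ U ∧
        ∀ k, R p.1 (blockVertex ψ p.2 (M (k, false))) (blockVertex ψ p.2 (M (k, true))) with hPr
  have hlow : c * Fintype.card V * (α / 4 * q) ≤ (#{p | ∃ M, Pr M p} : ℝ) := by
    have h1 : (#{p | ∃ M, Pr M p} : ℝ) =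
        ∑ u, (#{ω : Fin m → β × (Fin 3 → Fin s) | ∃ M, Pr M (u, ω)} : ℝ) := by
      simp only [card_filter]
      rw [Fintype.sum_prod_type]
      push_cast
      rfl
    rw [h1]
    calc c * Fintype.card V * (α / 4 * q) ≤ #U * (α / 4 * q) :=
          mul_le_mul_of_nonneg_right hU (by positivity)
      _ = ∑ u ∈ U, α / 4 * q := by rw [sum_const, nsmul_eq_mul]
      _ ≤ ∑ u ∈ U, (#{ω : Fin m → β × (Fin 3 → Fin s) | ∃ M, Pr M (u, ω)} : ℝ) := by
        refine sum_le_sum fun u hu => ?_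
        refine (frequently_exists_matching hs hψ hW (hsymm u) (hX u) hα (hdense u hu) hm
          hmα).trans (Nat.cast_le.2 (card_le_card fun ω hω => ?_))
        simp only [mem_filter, mem_univ, true_and] at hω ⊢
        obtain ⟨M, hM, hM'⟩ := hω
        exact ⟨M, hM, hu, hM'⟩
      _ ≤ _ := sum_le_sum_of_subset_of_nonneg (subset_univ U) fun _ _ _ => Nat.cast_nonneg _
  have hup : (#{p | ∃ M, Pr M p} : ℝ) ≤ ∑ M, (#{p | Pr M p} : ℝ) := by
    have : ({p | ∃ M, Pr M p} : Finset _) ⊆ univ.biUnion fun M => ({p | Pr M p} : Finset _) := by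
      intro p hp
      simpa using hp
    exact_mod_cast (card_le_card this).trans card_biUnion_le
  obtain ⟨M, -, hM⟩ := exists_le_of_sum_le (s := univ)
    (f := fun _ : Fin (m + 1) × Bool → Fin m × Fin 3 =>
      c * (α / 4) / C * (Fintype.card V * q)) (g := fun M => (#{p | Pr M p} : ℝ)) univ_nonempty
    (by
      refine le_trans (le_of_eq ?_) (hlow.trans hup)
      rw [sum_const, card_univ, ← hC, nsmul_eq_mul]
      field_simp)
  have hpos : 0 < #{p | Pr M p} := by
    have : (0 : ℝ) < #{p | Pr M p} := lt_of_lt_of_le (by positivity) hM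
    exact_mod_cast this
  obtain ⟨p, hp⟩ := card_pos.1 hpos
  refine ⟨M, (mem_filter.1 hp).2.1, hM.trans (Nat.cast_le.2 (card_le_card fun p hp => ?_))⟩
  simp only [mem_filter, mem_univ, true_and] at hp ⊢
  exact hp.2

end FrequentMatching

section Blowup

lemma exists_box_curried (m t : ℕ) {c : ℝ} (hc : 0 < c) : ∃ s₀ : ℕ, ∀ s ≥ s₀,
    ∀ F : Finset (Fin m → Fin 3 → Fin s), c * ((s : ℝ) ^ 3) ^ m ≤ #F →
    ∃ T : Fin m × Fin 3 → Finset (Fin s), (∀ p, #(T p) = t + 1) ∧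
      ∀ a : Fin m → Fin 3 → Fin s, (∀ i d, a i d ∈ T (i, d)) → a ∈ F := by
  obtain ⟨s₀, h⟩ := exists_box (m * 3) t c hc
  refine ⟨s₀, fun s hs F hF => ?_⟩
  let e : (Fin (m * 3) → Fin s) ≃ (Fin m → Fin 3 → Fin s) :=
    (finProdFinEquiv.symm.arrowCongr (Equiv.refl _)).trans (Equiv.curry _ _ _)
  obtain ⟨T, hT, hTF⟩ := h (Fin s) (by simpa using hs) (F.map e.symm.toEmbedding) (by
    rw [card_map, Fintype.card_fin, mul_comm m 3, pow_mul]
    exact hF)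
  refine ⟨fun p => T (finProdFinEquiv p), fun p => hT _, fun a ha => ?_⟩
  have := hTF (e.symm a) (fun i => by
    have := ha (finProdFinEquiv.symm i).1 (finProdFinEquiv.symm i).2
    beta_reduce at this
    rw [Prod.mk.eta, Equiv.apply_symm_apply] at this
    exact this)
  simpa using this

lemma card_not_injective_fst_le {β : Type} [Fintype β] (s m : ℕ) :
    (#{ω : Fin m → β × (Fin 3 → Fin s) | ¬ Function.Injective fun i => (ω i).1} : ℝ) *
      Fintype.card β ≤ (m : ℝ) ^ 2 * (Fintype.card (β × (Fin 3 → Fin s)) : ℝ) ^ m := by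
  have h1 : #{ω : Fin m → β × (Fin 3 → Fin s) | ¬ Function.Injective fun i => (ω i).1} =
      #{σ : Fin m → β | ¬ Function.Injective σ} * (s ^ 3) ^ m := by
    have : #(({σ : Fin m → β | ¬ Function.Injective σ} : Finset _) ×ˢ
        (univ : Finset (Fin m → Fin 3 → Fin s))) =
        #{σ : Fin m → β | ¬ Function.Injective σ} * (s ^ 3) ^ m := by
      rw [card_product, card_univ]
      simp
    rw [← this]
    refine card_bij (fun ω _ => (fun i => (ω i).1, fun i => (ω i).2)) ?_ ?_ ?_
    · intro ω hω
      simpa using hω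
    · intro ω _ ω' _ h
      simp only [Prod.mk.injEq] at h
      funext i
      exact Prod.ext (congrFun h.1 i) (congrFun h.2 i)
    · rintro ⟨σ, a⟩ h
      exact ⟨fun i => (σ i, a i), by simpa using h, rfl⟩
  have h2 := card_pi_not_injective_le (ι := Fin m) (S := β)
  rw [Fintype.card_fin] at h2
  rw [h1, Fintype.card_prod, Fintype.card_fun, Fintype.card_fin, Fintype.card_fin]
  push_cast
  rw [mul_pow, ← mul_assoc, mul_right_comm]
  exact mul_le_mul_of_nonneg_right h2 (by positivity)

lemma card_blockVertex_mem_le {V β : Type} [Fintype β] {s : ℕ} (hs : 0 < s)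
    {ψ : β × Fin 3 × Fin s → V} (hψ : Function.Injective ψ) (m : ℕ) (D : Finset V) :
    (#{ω : Fin m → β × (Fin 3 → Fin s) | ∃ p, blockVertex ψ ω p ∈ D} : ℝ) *
      (Fintype.card β * s) ≤ m * #D * (Fintype.card (β × (Fin 3 → Fin s)) : ℝ) ^ m := by
  have hsR : (0 : ℝ) < s := by exact_mod_cast hs
  set T : Finset (β × (Fin 3 → Fin s)) := {σ | ∃ c, ψ (σ.1, c, σ.2 c) ∈ D} with hT
  have hTc : (#T : ℝ) ≤ (s : ℝ) ^ 2 * #D := by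
    have h1 := sum_block_marginal hs hψ (fun v => if v ∈ D then (1 : ℝ) else 0)
    have h2 : (#T : ℝ) ≤ ∑ σ : β × (Fin 3 → Fin s), ∑ c,
        if ψ (σ.1, c, σ.2 c) ∈ D then (1 : ℝ) else 0 := by
      rw [hT, card_filter]
      push_cast
      refine sum_le_sum fun σ _ => ?_
      split_ifs with h
      · obtain ⟨c, hc⟩ := h
        refine le_trans (le_of_eq ?_) (single_le_sum (f := fun c =>
          if ψ (σ.1, c, σ.2 c) ∈ D then (1 : ℝ) else 0) (fun c _ => ?_) (mem_univ c))
        · simp [hc]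
        · split_ifs <;> norm_num
      · exact sum_nonneg fun c _ => by split_ifs <;> norm_num
    have h3 : ∑ w ∈ univ.image ψ, (if w ∈ D then (1 : ℝ) else 0) ≤ #D := by
      rw [sum_boole, filter_mem_eq_inter]
      exact_mod_cast card_le_card inter_subset_right
    refine h2.trans (h1.le.trans ?_)
    exact mul_le_mul_of_nonneg_left h3 (by positivity)
  have hhit := card_pi_hits_le (ι := Fin m) T
  rw [Fintype.card_fin] at hhit
  have hsub : (#{ω : Fin m → β × (Fin 3 → Fin s) | ∃ p, blockVertex ψ ω p ∈ D} : ℝ) ≤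
      #{ω : Fin m → β × (Fin 3 → Fin s) | ∃ i, ω i ∈ T} := by
    refine Nat.cast_le.2 (card_le_card fun ω hω => ?_)
    simp only [mem_filter, mem_univ, true_and] at hω ⊢
    obtain ⟨p, hp⟩ := hω
    exact ⟨p.1, by simp only [hT, mem_filter, mem_univ, true_and]; exact ⟨p.2, hp⟩⟩
  set N : ℝ := ((#{ω : Fin m → β × (Fin 3 → Fin s) | ∃ p, blockVertex ψ ω p ∈ D} : ℕ) : ℝ)
  have hcard : (Fintype.card (β × (Fin 3 → Fin s)) : ℝ) = (Fintype.card β * s) * (s : ℝ) ^ 2 := by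
    rw [Fintype.card_prod, Fintype.card_fun, Fintype.card_fin, Fintype.card_fin]
    push_cast
    ring
  set Q : ℝ := (Fintype.card (β × (Fin 3 → Fin s)) : ℝ)
  have h4 : (N * (Fintype.card β * s)) * (s : ℝ) ^ 2 ≤ (m * #D * Q ^ m) * (s : ℝ) ^ 2 := by
    calc _ = N * Q := by rw [hcard]; ring
      _ ≤ _ := mul_le_mul_of_nonneg_right hsub (by positivity)
      _ ≤ m * #T * Q ^ m := by convert hhit
      _ ≤ m * ((s : ℝ) ^ 2 * #D) * Q ^ m := by gcongr
      _ = _ := by ring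
  exact le_of_mul_le_mul_right h4 (by positivity)

lemma card_avoiding_ge {V β : Type} [Fintype V] [Fintype β] [Nonempty β] {s : ℕ} (hs : 0 < s)
    {ψ : β × Fin 3 × Fin s → V} (hψ : Function.Injective ψ) {m : ℕ} {D : Finset V} {c ε : ℝ}
    (hD : (#D : ℝ) ≤ ε * Fintype.card V)
    (hcard : (Fintype.card V : ℝ) ≤ 6 * (Fintype.card β * s))
    (hε0 : 0 ≤ ε) (hq : 8 * (m : ℝ) ^ 2 ≤ c * Fintype.card β) (hε : ε * (1 + 6 * m) ≤ c / 4)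
    {P : Finset (V × (Fin m → β × (Fin 3 → Fin s)))}
    (hP : c * (Fintype.card V * (Fintype.card (β × (Fin 3 → Fin s)) : ℝ) ^ m) ≤ #P) :
    c / 2 * (Fintype.card V * (Fintype.card (β × (Fin 3 → Fin s)) : ℝ) ^ m) ≤
      #{p ∈ P | p.1 ∉ D ∧ (∀ r, blockVertex ψ p.2 r ∉ D) ∧
        Function.Injective fun i => (p.2 i).1} := by
  have hβ : (0 : ℝ) < Fintype.card β := by exact_mod_cast Fintype.card_pos
  have hsR : (0 : ℝ) < s := by exact_mod_cast hs
  have h1 := card_not_injective_fst_le (β := β) s m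
  have h2 := card_blockVertex_mem_le hs hψ m D
  set Q : ℝ := (Fintype.card (β × (Fin 3 → Fin s)) : ℝ) ^ m with hQ
  have hQ0 : 0 ≤ Q := by positivity
  set n : ℝ := (Fintype.card V : ℝ) with hn
  have hn0 : 0 ≤ n := Nat.cast_nonneg _
  set B₁ : Finset (Fin m → β × (Fin 3 → Fin s)) :=
    {ω | ¬ Function.Injective fun i => (ω i).1} with hB₁
  set B₂ : Finset (Fin m → β × (Fin 3 → Fin s)) := {ω | ∃ p, blockVertex ψ ω p ∈ D} with hB₂
  set G := {p ∈ P | p.1 ∉ D ∧ (∀ r, blockVertex ψ p.2 r ∉ D) ∧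
        Function.Injective fun i => (p.2 i).1} with hG
  have hsub : P ⊆ G ∪ (D ×ˢ univ ∪ (univ ×ˢ B₂ ∪ univ ×ˢ B₁)) := by
    intro p hp
    simp only [hG, hB₁, hB₂, mem_union, mem_filter, mem_product, mem_univ, true_and, and_true]
    by_cases h1 : p.1 ∈ D
    · exact Or.inr (Or.inl h1)
    by_cases h2 : ∃ r, blockVertex ψ p.2 r ∈ D
    · exact Or.inr (Or.inr (Or.inl h2))
    by_cases h3 : Function.Injective fun i => (p.2 i).1
    · exact Or.inl ⟨hp, h1, not_exists.1 h2, h3⟩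
    · exact Or.inr (Or.inr (Or.inr h3))
  have hle : (#P : ℝ) ≤ #G + (#D * Q + (n * #B₂ + n * #B₁)) := by
    have h3 := (card_le_card hsub).trans ((card_union_le _ _).trans (Nat.add_le_add_left
      ((card_union_le _ _).trans (Nat.add_le_add_left (card_union_le _ _) _)) _))
    rw [card_product, card_product, card_product, card_univ, card_univ, Fintype.card_fun,
      Fintype.card_fin] at h3
    rw [hQ, hn]
    exact_mod_cast h3
  have hB₁' : (#B₁ : ℝ) ≤ c / 8 * Q := by
    have : (#B₁ : ℝ) * Fintype.card β ≤ (c / 8 * Q) * Fintype.card β := by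
      refine h1.trans ?_
      nlinarith
    exact le_of_mul_le_mul_right this hβ
  have hB₂' : (#B₂ : ℝ) ≤ 6 * m * ε * Q := by
    have h5 : (#D : ℝ) ≤ 6 * ε * (Fintype.card β * s) := by nlinarith
    have : (#B₂ : ℝ) * (Fintype.card β * s) ≤ (6 * m * ε * Q) * (Fintype.card β * s) := by
      refine h2.trans ?_
      calc (m : ℝ) * #D * Q ≤ m * (6 * ε * (Fintype.card β * s)) * Q := by gcongr
        _ = _ := by ring
    exact le_of_mul_le_mul_right this (by positivity)
  have h6 : (#D : ℝ) * Q ≤ ε * n * Q := mul_le_mul_of_nonneg_right hD hQ0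
  have h7 := mul_le_mul_of_nonneg_left hB₁' hn0
  have h8 := mul_le_mul_of_nonneg_left hB₂' hn0
  have h9 := mul_le_mul_of_nonneg_left hε (mul_nonneg hn0 hQ0)
  nlinarith

end Blowup

section Blowup

lemma exists_blowup (m t τ : ℕ) {c : ℝ} (hc : 0 < c) : ∃ s₀ : ℕ, ∀ s ≥ s₀, 0 < s →
    ∀ (V β : Type) [Fintype V] [Fintype β] [Nonempty β] (ψ : β × Fin 3 × Fin s → V),
    Function.Injective ψ → ∀ (D : Finset V) (ε : ℝ), (#D : ℝ) ≤ ε * Fintype.card V → 0 ≤ ε →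
    (Fintype.card V : ℝ) ≤ 6 * (Fintype.card β * s) → 8 * (m : ℝ) ^ 2 ≤ c * Fintype.card β →
    ε * (1 + 6 * m) ≤ c / 4 →
    2 * ((t + 1 : ℕ) : ℝ) ^ 2 < (c / 2) ^ (t + 1) * Fintype.card V →
    ∀ P : Finset (V × (Fin m → β × (Fin 3 → Fin s))),
    c * (Fintype.card V * (Fintype.card (β × (Fin 3 → Fin s)) : ℝ) ^ m) ≤ #P →
    ∃ (σ : Fin m → β) (z : Fin (t + 1) → V) (T : Fin m × Fin 3 → Finset (Fin s)),
      Function.Injective σ ∧ Function.Injective z ∧ (∀ p, #(T p) = τ + 1) ∧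
      ∀ (j : Fin (t + 1)) (a : Fin m → Fin 3 → Fin s), (∀ i d, a i d ∈ T (i, d)) → (z j, fun i => (σ i, a i)) ∈ P ∧ z j ∉ D ∧
        ∀ r, blockVertex ψ (fun i => (σ i, a i)) r ∉ D := by
  obtain ⟨s₀, hbox⟩ := exists_box_curried m τ (c := (c / 2) ^ (t + 1) / 2) (by positivity)
  refine ⟨s₀, ?_⟩
  intro s hs hs0 V β _ _ _ ψ hψ D ε hD hε0 hcard hq hε ht P hP
  have hcount := card_avoiding_ge hs0 hψ hD hcard hε0 hq hε hP
  set G := {p ∈ P | p.1 ∉ D ∧ (∀ r, blockVertex ψ p.2 r ∉ D) ∧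
        Function.Injective fun i => (p.2 i).1} with hG
  have hfib : (#G : ℝ) = ∑ σ : Fin m → β,
      (#{p : V × (Fin m → Fin 3 → Fin s) | (p.1, fun i => (σ i, p.2 i)) ∈ G} : ℝ) := by
    have h1 := card_eq_sum_card_fiberwise (f := fun p : V × (Fin m → β × (Fin 3 → Fin s)) =>
      fun i => (p.2 i).1) (s := G) (t := univ) (fun _ _ => mem_univ _)
    rw [h1]
    push_cast
    refine sum_congr rfl fun σ _ => ?_
    congr 1
    refine card_bij (fun p _ => (p.1, fun i => (p.2 i).2)) ?_ ?_ ?_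
    · intro p hp
      obtain ⟨hp, rfl⟩ := mem_filter.1 hp
      simpa using hp
    · intro p hp p' hp' h
      have h1 := (mem_filter.1 hp).2
      have h2 := (mem_filter.1 hp').2
      simp only [Prod.mk.injEq] at h
      refine Prod.ext h.1 (funext fun i => Prod.ext ?_ (congrFun h.2 i))
      rw [← h2] at h1
      exact congrFun h1 i
    · rintro ⟨v, a⟩ h
      exact ⟨(v, fun i => (σ i, a i)), by simpa using h, rfl⟩
  have hQ : (Fintype.card (β × (Fin 3 → Fin s)) : ℝ) ^ m =
      (Fintype.card (Fin m → β) : ℝ) * ((s : ℝ) ^ 3) ^ m := by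
    rw [Fintype.card_prod, Fintype.card_fun, Fintype.card_fun, Fintype.card_fin, Fintype.card_fin,
      Fintype.card_fin]
    push_cast
    rw [mul_pow]
  obtain ⟨σ, -, hσ⟩ := exists_le_of_sum_le (s := univ)
    (f := fun _ : Fin m → β => c / 2 * (Fintype.card V * ((s : ℝ) ^ 3) ^ m))
    (g := fun σ => (#{p : V × (Fin m → Fin 3 → Fin s) | (p.1, fun i => (σ i, p.2 i)) ∈ G} : ℝ))
    univ_nonempty
    (by
      refine le_trans (le_of_eq ?_) (hcount.trans hfib.le)
      rw [sum_const, card_univ, nsmul_eq_mul, hQ]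
      ring)
  have hfun : (Fintype.card (Fin m → Fin 3 → Fin s) : ℝ) = ((s : ℝ) ^ 3) ^ m := by simp
  have hs1 : 0 < Fintype.card (Fin m → Fin 3 → Fin s) := by
    have : (0 : ℝ) < s := by exact_mod_cast hs0
    have : (0 : ℝ) < Fintype.card (Fin m → Fin 3 → Fin s) := by rw [hfun]; positivity
    exact_mod_cast this
  obtain ⟨z, hz, hzc⟩ := exists_injective_common (Y := Fin m → Fin 3 → Fin s) (S := V) t
    (c := c / 2) (by positivity) hs1 ht (fun v a => (v, fun i => (σ i, a i)) ∈ G) (by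
      rw [hfun]
      refine hσ.trans (le_of_eq ?_)
      congr)
  rw [hfun] at hzc
  obtain ⟨T, hT, hTF⟩ := hbox s hs _ hzc
  have hmain : ∀ (j : Fin (t + 1)) (a : Fin m → Fin 3 → Fin s), (∀ i d, a i d ∈ T (i, d)) → (z j, fun i => (σ i, a i)) ∈ G := by
    intro j a ha
    have := hTF a ha
    simp only [mem_filter, mem_univ, true_and] at this
    exact this j
  refine ⟨σ, z, T, ?_, hz, hT, fun j a ha => ?_⟩
  · have hne : ∀ p, (T p).Nonempty := fun p => card_pos.1 (by rw [hT]; omega)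
    choose a ha using hne
    exact (mem_filter.1 (hmain 0 (fun i d => a (i, d)) (fun i d => ha _))).2.2.2
  · have := mem_filter.1 (hmain j a ha)
    exact ⟨this.1, this.2.1, this.2.2.1⟩

end Blowup

section Gadget
variable {V β : Type} {A : V → V → V → Prop} {P : V → V → Prop}

lemma exists_gadget {m s t' : ℕ} (ht' : 0 < t') {ψ : β × Fin 3 × Fin s → V}
    (hψ : Function.Injective ψ) {M : Fin (m + 1) × Bool → Fin m × Fin 3}
    (hM : Function.Injective M) {σ : Fin m → β} (hσ : Function.Injective σ)
    {z : Fin (m + 1) × Fin t' → V} (hz : Function.Injective z) (hzψ : ∀ j p, z j ≠ ψ p)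
    {T : Fin m × Fin 3 → Finset (Fin s)} (hT : ∀ p, #(T p) = t') {D : Finset V}
    (hedge : ∀ (j : Fin (m + 1) × Fin t') (a : Fin m → Fin 3 → Fin s),
      (∀ i d, a i d ∈ T (i, d)) → (∀ k,
        A (blockVertex ψ (fun i => (σ i, a i)) (M (k, false)))
          (blockVertex ψ (fun i => (σ i, a i)) (M (k, true))) (z j) ∧
        P (blockVertex ψ (fun i => (σ i, a i)) (M (k, false)))
          (blockVertex ψ (fun i => (σ i, a i)) (M (k, true)))) ∧ z j ∉ D ∧
        ∀ r, blockVertex ψ (fun i => (σ i, a i)) r ∉ D) :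
    ∃ G : Finset V, Disjoint G D ∧ HasTiling A P G t' (m + 1) ∧ #G ≤ (4 * m + 1) * t' ∧
      ∀ b c, #(univ.image (fun a => ψ (b, c, a)) ∩ G) ≤ if ∃ i, σ i = b then t' else 0 := by
  have hne : ∀ p, (T p).Nonempty := fun p => card_pos.1 (by rw [hT]; exact ht')
  choose a₀ ha₀ using hne
  set S : (Fin m × Fin 3) ⊕ Fin (m + 1) → Finset V := Sum.elim
    (fun p => (T p).image fun a => ψ (σ p.1, p.2, a)) (fun k => univ.image fun a => z (k, a)) with hS
  have hSc : ∀ p, #(S p) = t' := by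
    rintro (p | k)
    · rw [hS, Sum.elim_inl, card_image_of_injective, hT]
      intro a b h
      simpa using hψ h
    · rw [hS, Sum.elim_inr, card_image_of_injective]
      · simp
      · intro a b h
        simpa using hz h
  have hSd : ∀ p q, p ≠ q → Disjoint (S p) (S q) := by
    intro p q hpq
    rw [disjoint_left]
    rintro v hp hq
    rcases p with p | p <;> rcases q with q | q <;>
      simp only [hS, Sum.elim_inl, Sum.elim_inr, mem_image, mem_univ, true_and] at hp hq
    · obtain ⟨a, -, rfl⟩ := hp
      obtain ⟨b, -, h⟩ := hq
      have := hψ h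
      simp only [Prod.mk.injEq] at this
      exact hpq (by rw [Prod.ext (hσ this.1) this.2.1])
    · obtain ⟨a, -, rfl⟩ := hp
      obtain ⟨b, h⟩ := hq
      exact hzψ _ _ h
    · obtain ⟨a, -, rfl⟩ := hq
      obtain ⟨b, h⟩ := hp
      exact hzψ _ _ h
    · obtain ⟨a, rfl⟩ := hp
      obtain ⟨b, h⟩ := hq
      have := hz h
      simp only [Prod.mk.injEq] at this
      exact hpq (by rw [this.1])
  refine ⟨univ.biUnion S, ?_, ⟨fun k => ![S (.inl (M (k, false))), S (.inl (M (k, true))),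
    S (.inr k)], ⟨?_, ?_, ?_⟩, ?_⟩, ?_, ?_⟩
  · rw [disjoint_left]
    intro v hv hvD
    obtain ⟨p, -, hp⟩ := mem_biUnion.1 hv
    rcases p with p | k <;>
      simp only [hS, Sum.elim_inl, Sum.elim_inr, mem_image, mem_univ, true_and] at hp
    · obtain ⟨a, ha, rfl⟩ := hp
      have h := (hedge (0, ⟨0, ht'⟩) (fun i d => if (i, d) = p then a else a₀ (i, d)) (by
        intro i d
        split_ifs with h
        · rw [h]; exact ha
        · exact ha₀ _)).2.2 p
      simp only [blockVertex, if_true] at h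
      exact h hvD
    · obtain ⟨a, rfl⟩ := hp
      exact (hedge (k, a) (fun i d => a₀ (i, d)) fun i d => ha₀ _).2.1 hvD
  · intro k c
    fin_cases c
    · exact subset_biUnion_of_mem S (mem_univ (Sum.inl (M (k, false))))
    · exact subset_biUnion_of_mem S (mem_univ (Sum.inl (M (k, true))))
    · exact subset_biUnion_of_mem S (mem_univ (Sum.inr k))
  · have hlab : ∀ k c, (![S (.inl (M (k, false))), S (.inl (M (k, true))), S (.inr k)] :
        Fin 3 → Finset V) c = S ((![.inl (M (k, false)), .inl (M (k, true)), .inr k] :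
        Fin 3 → (Fin m × Fin 3) ⊕ Fin (m + 1)) c) := by
      intro k c
      fin_cases c <;> rfl
    rintro ⟨k, c⟩ ⟨k', c'⟩ hne
    simp only [hlab]
    refine hSd _ _ fun h => hne ?_
    fin_cases c <;> fin_cases c' <;> simp at h
    · have := hM h; simp at this; simp [this]
    · have := hM h; simp at this
    · have := hM h; simp at this
    · have := hM h; simp at this; simp [this]
    · simp [h]
  · intro k x hx y hy u hu
    change x ∈ S (.inl (M (k, false))) at hx
    change y ∈ S (.inl (M (k, true))) at hy
    change u ∈ S (.inr k) at hu
    simp only [hS, Sum.elim_inl, Sum.elim_inr, mem_image, mem_univ, true_and] at hx hy hu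
    obtain ⟨a, ha, rfl⟩ := hx
    obtain ⟨b, hb, rfl⟩ := hy
    obtain ⟨j, rfl⟩ := hu
    have hMne : M (k, true) ≠ M (k, false) := fun h => by simpa using hM h
    have h := (hedge (k, j) (fun i d => if (i, d) = M (k, false) then a else
      if (i, d) = M (k, true) then b else a₀ (i, d)) (by
        intro i d
        split_ifs with h h'
        · rw [h]; exact ha
        · rw [h']; exact hb
        · exact ha₀ _)).1 k
    simpa only [blockVertex, Prod.mk.eta, if_true, if_neg hMne] using h
  · intro k c
    fin_cases c
    · exact hSc (.inl (M (k, false)))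
    · exact hSc (.inl (M (k, true)))
    · exact hSc (.inr k)
  · refine card_biUnion_le.trans ?_
    simp only [hSc, sum_const, card_univ, Fintype.card_sum, Fintype.card_prod, Fintype.card_fin,
      smul_eq_mul]
    exact le_of_eq (by ring)
  · intro b c
    have hmem : ∀ v ∈ univ.image (fun a => ψ (b, c, a)) ∩ univ.biUnion S,
        ∃ i, σ i = b ∧ v ∈ S (.inl (i, c)) := by
      intro v hv
      obtain ⟨h1, h2⟩ := mem_inter.1 hv
      obtain ⟨a, -, rfl⟩ := mem_image.1 h1
      obtain ⟨p, -, hp⟩ := mem_biUnion.1 h2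
      rcases p with p | k
      · have hp' := hp
        simp only [hS, Sum.elim_inl, mem_image] at hp
        obtain ⟨a', -, h⟩ := hp
        have := hψ h
        simp only [Prod.mk.injEq] at this
        obtain ⟨p1, p2⟩ := p
        obtain ⟨h3, rfl, -⟩ := this
        exact ⟨p1, h3, hp'⟩
      · simp only [hS, Sum.elim_inr, mem_image, mem_univ, true_and] at hp
        obtain ⟨a', h⟩ := hp
        exact absurd h (hzψ _ _)
    split_ifs with h
    · obtain ⟨i, rfl⟩ := h
      rw [← hSc (.inl (i, c))]
      refine card_le_card fun v hv => ?_
      obtain ⟨i', hi', hv'⟩ := hmem v hv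
      rwa [hσ hi'] at hv'
    · rw [Nat.le_zero, card_eq_zero, eq_empty_iff_forall_notMem]
      intro v hv
      obtain ⟨i, hi, -⟩ := hmem v hv
      exact h ⟨i, hi⟩

lemma exists_many_gadgets [Fintype β] {m t' C N : ℕ} {B : β → Fin 3 → Finset V}
    (hstep : ∀ D : Finset V, #D ≤ N → ∃ G : Finset V, Disjoint G D ∧ HasTiling A P G t' (m + 1) ∧
      #G ≤ C ∧ ∃ r : β → ℕ, ∑ b, r b ≤ m ∧ ∀ b c, #(B b c ∩ G) ≤ r b * t') (g : ℕ)
    (hg : C * g ≤ N) :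
    ∃ D : Finset V, HasTiling A P D t' ((m + 1) * g) ∧ #D ≤ C * g ∧
      ∃ r : β → ℕ, ∑ b, r b ≤ m * g ∧ ∀ b c, #(B b c ∩ D) ≤ r b * t' := by
  induction g with
  | zero => exact ⟨∅, ⟨fun i => i.elim0, ⟨fun i => i.elim0, fun p => p.1.elim0, fun i => i.elim0⟩,
      fun i => i.elim0⟩, by simp, fun _ => 0, by simp, by simp⟩
  | succ g ih =>
    obtain ⟨D, hD, hDc, r, hr, hrD⟩ := ih (by rw [mul_add] at hg; omega)
    obtain ⟨G, hGD, hG, hGc, r', hr', hrG⟩ := hstep D (hDc.trans (by rw [mul_add] at hg; omega))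
    refine ⟨D ∪ G, ?_, ?_, fun b => r b + r' b, ?_, fun b c => ?_⟩
    · simpa [mul_add] using hD.union hGD.symm hG
    · have := card_union_le D G
      rw [mul_add]; omega
    · rw [sum_add_distrib, mul_add]; omega
    · rw [inter_union_distrib_left, add_mul]
      exact (card_union_le _ _).trans (Nat.add_le_add (hrD b c) (hrG b c))

lemma HasTiling.extend_of_gadgets [Fintype V] [Fintype β] {q s S t' m g : ℕ} {U : Finset V}
    {T : Fin q → Fin 3 → Finset V} (hT : IsTiling A P U T) (hTc : ∀ i c, #(T i c) = s)
    (hs : s = S * t') {D : Finset V} (hD : HasTiling A P D t' ((m + 1) * g)) (f : Fin q → β)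
    (hf : Function.Injective f) {r : β → ℕ} (hr : ∑ b, r b ≤ m * g)
    (hrD : ∀ i c, #(T i c ∩ D) ≤ r (f i) * t') :
    ∃ k, HasTiling A P univ t' k ∧ q * S + g ≤ k := by
  have hT' : IsTiling A P (univ \ D) fun i c => T i c \ D :=
    ⟨fun i c => sdiff_subset_sdiff (subset_univ _) subset_rfl,
      fun p p' h => disjoint_of_subset_left sdiff_subset
        (disjoint_of_subset_right sdiff_subset (hT.disj p p' h)),
      fun i x hx y hy z hz => hT.edge i x (sdiff_subset hx) y (sdiff_subset hy) z (sdiff_subset hz)⟩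
  have h1 := hT'.hasTiling (s := t') (fun i => S - r (f i)) (fun i c => by
    have := card_sdiff_add_card_inter (T i c) D
    have h2 := hrD i c
    rw [hTc, hs] at this
    rw [Nat.sub_mul]
    omega)
  refine ⟨_, (h1.union sdiff_disjoint hD).mono (subset_univ _), ?_⟩
  have h2 : q * S ≤ ∑ i, (S - r (f i)) + ∑ i, r (f i) := by
    rw [← sum_add_distrib]
    calc q * S = ∑ i : Fin q, S := by simp
      _ ≤ _ := sum_le_sum fun i _ => by omega
  have h3 : ∑ i, r (f i) ≤ ∑ b, r b := by
    rw [← sum_image (s := univ) (g := f) (f := r) (fun _ _ _ _ h => hf h)]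
    exact sum_le_sum_of_subset (subset_univ _)
  have h4 : (m + 1) * g = m * g + g := by ring
  omega

end Gadget

/-- Every link has a large, dense part, namely the one induced by `X u`. -/
structure Robust {V : Type} [Fintype V] (α : ℝ) (A : V → V → V → Prop) (X : V → Finset V) :
    Prop where
  large : ∀ u, 2 * Fintype.card V < 3 * #(X u)
  dense : ∀ u, (5 / 9 + α / 2) * (Fintype.card V : ℝ) ^ 2 - (Fintype.card V - #(X u)) ^ 2 ≤
    weight (fun x y => if A u x y then 1 else 0) (X u) (X u)

/-- The pair `x`, `y` is an edge of at least a `ζ`-proportion of the restricted links. -/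
def Popular {V : Type} [Fintype V] (ζ : ℝ) (A : V → V → V → Prop) (X : V → Finset V)
    (x y : V) : Prop := ζ * Fintype.card V ≤ #{u | InLink A X u x y}

/-- The pair `x`, `y` is a popular edge of the restricted link of `u`. -/
def PopularLink {V : Type} [Fintype V] (ζ : ℝ) (A : V → V → V → Prop) (X : V → Finset V)
    (u x y : V) : Prop := InLink A X u x y ∧ Popular ζ A X x y

section Augment
variable {V : Type} [Fintype V] {A : V → V → V → Prop} {X : V → Finset V}

lemma IsHypergraph.inLink_symm {V : Type} {A : V → V → V → Prop} {X : V → Finset V} (hA : IsHypergraph A) {u x y : V} (h : InLink A X u x y) :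
    InLink A X u y x := ⟨h.2.1, h.1, hA.rot (hA.swap h.2.2)⟩

lemma IsHypergraph.popular_symm (hA : IsHypergraph A) {ζ : ℝ} {x y : V}
    (h : Popular ζ A X x y) : Popular ζ A X y x :=
  h.trans (Nat.cast_le.2 (card_le_card fun u hu => by
    simp only [mem_filter, mem_univ, true_and] at hu ⊢
    exact hA.inLink_symm hu))

/-- Few vertices have many unpopular pairs in their links. -/
lemma card_bad_le {ζ : ℝ} (hζ : 0 < ζ) :
    (#{u | ζ * (Fintype.card V : ℝ) ^ 2 <
      #{q : V × V | InLink A X u q.1 q.2 ∧ ¬ Popular (ζ ^ 2) A X q.1 q.2}} : ℝ) ≤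
      ζ * Fintype.card V := by
  rcases isEmpty_or_nonempty V with hV | hV
  · simp
  have hn : (0 : ℝ) < Fintype.card V := by exact_mod_cast Fintype.card_pos
  set n : ℝ := (Fintype.card V : ℝ)
  set B : Finset V := {u | ζ * n ^ 2 <
      #{q : V × V | InLink A X u q.1 q.2 ∧ ¬ Popular (ζ ^ 2) A X q.1 q.2}} with hB
  have h1 : (∑ u : V, (#{q : V × V | InLink A X u q.1 q.2 ∧ ¬ Popular (ζ ^ 2) A X q.1 q.2} : ℝ)) ≤
      ζ ^ 2 * n * n ^ 2 := by
    have h2 : (∑ u : V, (#{q : V × V | InLink A X u q.1 q.2 ∧ ¬ Popular (ζ ^ 2) A X q.1 q.2} : ℝ)) =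
        ∑ q : V × V, (#{u | InLink A X u q.1 q.2 ∧ ¬ Popular (ζ ^ 2) A X q.1 q.2} : ℝ) := by
      simp only [card_filter, Nat.cast_sum]
      exact sum_comm
    rw [h2]
    calc _ ≤ ∑ q : V × V, ζ ^ 2 * n := sum_le_sum fun q _ => ?_
      _ = _ := by rw [sum_const, nsmul_eq_mul, card_univ, Fintype.card_prod]; push_cast; ring
    by_cases h : Popular (ζ ^ 2) A X q.1 q.2
    · simp only [h, not_true_eq_false, and_false, filter_false, card_empty, Nat.cast_zero]
      exact mul_nonneg (sq_nonneg _) hn.le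
    · simp only [h, not_false_eq_true, and_true]
      exact (not_le.1 h).le
  have h3 : (#B : ℝ) * (ζ * n ^ 2) ≤
      ∑ u : V, (#{q : V × V | InLink A X u q.1 q.2 ∧ ¬ Popular (ζ ^ 2) A X q.1 q.2} : ℝ) := by
    rw [← nsmul_eq_mul, ← sum_const]
    refine (sum_le_sum fun u hu => ?_).trans
      (sum_le_sum_of_subset_of_nonneg (subset_univ B) fun _ _ _ => Nat.cast_nonneg _)
    exact (mem_filter.1 hu).2.le
  have h4 : (#B : ℝ) * (ζ * n ^ 2) ≤ (ζ * n) * (ζ * n ^ 2) := by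
    refine (h3.trans h1).trans (le_of_eq ?_); ring
  exact le_of_mul_le_mul_right h4 (by positivity)

/-- The popular part of a good link stays dense on a large set. -/
lemma Robust.weight_popular {α κ ζ ζ' : ℝ} (hR : Robust α A X) (hκα : 4 * κ + ζ ≤ α / 4)
    (hα : 0 < α) {W : Finset V}
    (hW : Fintype.card V - #W ≤ 2 * κ * (Fintype.card V : ℝ)) {u : V}
    (hu : (#{q : V × V | InLink A X u q.1 q.2 ∧ ¬ Popular ζ' A X q.1 q.2} : ℝ) ≤
      ζ * (Fintype.card V : ℝ) ^ 2) :
    (2 / 9 + α / 4) * (#W : ℝ) ^ 2 + #(X u ∩ W) * #W / 3 ≤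
      weight (fun v w => if PopularLink ζ' A X u v w then (1 : ℝ) else 0) W W := by
  have hd := hR.dense u
  have hl : (2 * Fintype.card V : ℝ) < 3 * #(X u) := by exact_mod_cast hR.large u
  rw [weight_ite_eq_card] at hd ⊢
  have hx : (#(X u) : ℝ) ≤ Fintype.card V := Nat.cast_le.2 (card_le_univ _)
  have hh : (#(X u ∩ W) : ℝ) ≤ #(X u) := Nat.cast_le.2 (card_le_card inter_subset_left)
  have hw : (#W : ℝ) ≤ Fintype.card V := Nat.cast_le.2 (card_le_univ _)
  have hsub : ({q ∈ X u ×ˢ X u | A u q.1 q.2} : Finset (V × V)) ⊆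
      (({q ∈ W ×ˢ W | PopularLink ζ' A X u q.1 q.2} : Finset (V × V)) ∪
      ({q : V × V | InLink A X u q.1 q.2 ∧ ¬ Popular ζ' A X q.1 q.2} : Finset (V × V))) ∪
      ((univ \ W) ×ˢ univ ∪ univ ×ˢ (univ \ W)) := by
    rintro ⟨x, y⟩ hq
    simp only [mem_filter, mem_product] at hq
    simp only [mem_union, mem_filter, mem_product, mem_univ, true_and, mem_sdiff, and_true]
    unfold PopularLink
    have : InLink A X u x y := ⟨hq.1.1, hq.1.2, hq.2⟩
    tauto
  have hc := card_le_card hsub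
  have hc2 := hc.trans ((card_union_le _ _).trans (Nat.add_le_add (card_union_le _ _)
    (card_union_le _ _)))
  rw [card_product, card_product, card_univ] at hc2
  have hc3 := (Nat.cast_le (α := ℝ)).2 hc2
  have hWc : (#(univ \ W) : ℝ) = Fintype.card V - #W := by
    rw [card_sdiff_of_subset (subset_univ _), card_univ, Nat.cast_sub (card_le_univ _)]
  push_cast at hc3
  rw [hWc] at hc3
  generalize (#{q ∈ X u ×ˢ X u | A u q.1 q.2} : ℝ) = a at *
  generalize (#{q : V × V | InLink A X u q.1 q.2 ∧ ¬ Popular ζ' A X q.1 q.2} : ℝ) = b at *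
  generalize (#{q ∈ W ×ˢ W | PopularLink ζ' A X u q.1 q.2} : ℝ) = e at *
  have hw0 : (0 : ℝ) ≤ #W := Nat.cast_nonneg _
  have hh0 : (0 : ℝ) ≤ #(X u ∩ W) := Nat.cast_nonneg _
  generalize (Fintype.card V : ℝ) = n at *
  generalize (#W : ℝ) = w at *
  generalize (#(X u ∩ W) : ℝ) = h at *
  generalize (#(X u) : ℝ) = x at *
  have h1 : (n - x) ^ 2 ≤ (n - x) * n / 3 := by nlinarith
  have h2 : (n - w) * n ≤ 2 * κ * n * n := mul_le_mul_of_nonneg_right hW (hw0.trans hw)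
  have h3 : h * w ≤ x * n := mul_le_mul hh hw hw0 (hh0.trans hh)
  have h4 : w ^ 2 ≤ n ^ 2 := pow_le_pow_left₀ hw0 hw 2
  have h5 : (4 * κ + ζ) * n ^ 2 ≤ α / 4 * n ^ 2 := mul_le_mul_of_nonneg_right hκα (sq_nonneg _)
  have h6 : (2 / 9 + α / 4) * w ^ 2 ≤ (2 / 9 + α / 4) * n ^ 2 :=
    mul_le_mul_of_nonneg_left h4 (by linarith)
  nlinarith

end Augment

lemma exists_augmentation {α κ : ℝ} (hα : 0 < α) (hκ : 0 < κ) (hκα : κ ≤ α / 40)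
    (hκ4 : κ ≤ 1 / 4) : ∃ (m : ℕ) (ε : ℝ), 0 < ε ∧ ∀ t', 0 < t' → ∃ s₀, ∀ s ≥ s₀, 0 < s →
    ∃ n₀, ∀ (V β : Type) [Fintype V] [Fintype β] (A : V → V → V → Prop) (X : V → Finset V),
    IsHypergraph A → Robust α A X → n₀ ≤ Fintype.card V →
    ∀ ψ : β × Fin 3 × Fin s → V, Function.Injective ψ → ∀ U : Finset V, (∀ p, ψ p ∉ U) →
    κ * Fintype.card V ≤ #U →
    (Fintype.card V : ℝ) - 3 * (Fintype.card β * s) ≤ 2 * κ * Fintype.card V →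
    ∀ D : Finset V, (#D : ℝ) ≤ ε * Fintype.card V →
    ∃ G : Finset V, Disjoint G D ∧ HasTiling A (Popular ((κ / 2) ^ 2) A X) G t' (m + 1) ∧
      #G ≤ (4 * m + 1) * t' ∧ ∃ r : β → ℕ, ∑ b, r b ≤ m ∧
      ∀ b c, #(univ.image (fun a => ψ (b, c, a)) ∩ G) ≤ r b * t' := by
  obtain ⟨m, hm, hmα⟩ : ∃ m : ℕ, 2 ≤ m ∧ 2 ≤ α / 4 * ((m : ℝ) - 1) := by
    obtain ⟨k, hk⟩ := exists_nat_ge (8 / α)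
    refine ⟨k + 2, by omega, ?_⟩
    rw [div_le_iff₀ hα] at hk
    push_cast
    nlinarith
  obtain ⟨c', hc', hmatch⟩ := exists_frequent_matching (α := α / 4) (c := κ / 2) (by linarith)
    (by linarith) hm hmα
  refine ⟨m, c' / (4 * (1 + 6 * m)), by positivity, ?_⟩
  rintro t' ht'
  obtain ⟨τ, rfl⟩ : ∃ τ, t' = τ + 1 := ⟨t' - 1, by omega⟩
  obtain ⟨s₀, hblow⟩ := exists_blowup m ((m + 1) * τ + m) τ hc'
  refine ⟨s₀, fun s hs hs0 => ?_⟩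
  obtain ⟨n₁, hn₁⟩ := exists_nat_gt
    (2 * (((m + 1) * τ + m + 1 : ℕ) : ℝ) ^ 2 / (c' / 2) ^ ((m + 1) * τ + m + 1))
  obtain ⟨n₂, hn₂⟩ := exists_nat_ge (48 * (m : ℝ) ^ 2 * s / c')
  refine ⟨n₁ + n₂ + 1, ?_⟩
  intro V β _ _ A X hA hR hn ψ hψ U hU hUc hW D hD
  have hn1 : (n₁ : ℝ) + n₂ + 1 ≤ Fintype.card V := by exact_mod_cast hn
  have hn1' : (0 : ℝ) ≤ n₁ := Nat.cast_nonneg _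
  have hn2' : (0 : ℝ) ≤ n₂ := Nat.cast_nonneg _
  set n : ℝ := ((Fintype.card V : ℕ) : ℝ) with hndef
  have hn0 : 0 < n := by linarith
  have hs0' : (0 : ℝ) < s := by exact_mod_cast hs0
  have hκn : κ * n ≤ 1 / 4 * n := mul_le_mul_of_nonneg_right hκ4 hn0.le
  have hn6 : n ≤ 6 * (Fintype.card β * s) := by linarith
  have hβ : Nonempty β := by
    rw [← Fintype.card_pos_iff, Nat.pos_iff_ne_zero]
    intro h
    rw [h, Nat.cast_zero, zero_mul, mul_zero] at hn6
    linarith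
  set W : Finset V := univ.image ψ with hWdef
  have hWc : (#W : ℝ) = 3 * (Fintype.card β * s) := by
    rw [hWdef, card_image_of_injective _ hψ, card_univ, Fintype.card_prod, Fintype.card_prod,
      Fintype.card_fin, Fintype.card_fin]
    push_cast; ring
  set B : Finset V := {u | κ / 2 * n ^ 2 <
      #{q : V × V | InLink A X u q.1 q.2 ∧ ¬ Popular ((κ / 2) ^ 2) A X q.1 q.2}} with hB
  have hBc : (#B : ℝ) ≤ κ / 2 * n := card_bad_le (by linarith)
  have hUB : κ / 2 * n ≤ #(U \ B) := by
    have h1 : #U ≤ #(U \ B) + #B := by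
      have := card_sdiff_add_card_inter U B
      have h2 : #(U ∩ B) ≤ #B := card_le_card inter_subset_right
      omega
    have h2 : (#U : ℝ) ≤ #(U \ B) + #B := by exact_mod_cast h1
    linarith
  obtain ⟨M, hM, hMc⟩ := hmatch V β s hs0 ψ hψ W hWdef (PopularLink ((κ / 2) ^ 2) A X) X
    (fun u x y h => ⟨hA.inLink_symm h.1, hA.popular_symm h.2⟩) (fun u x y h => h.1.1) (U \ B) hUB
    (fun u hu => hR.weight_popular (κ := κ) (ζ := κ / 2) (by linarith) hα (by rw [hWc]; exact hW)
      (not_lt.1 fun h => (mem_sdiff.1 hu).2 (mem_filter.2 ⟨mem_univ _, h⟩)))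
  have hβc : 8 * (m : ℝ) ^ 2 ≤ c' * Fintype.card β := by
    rw [div_le_iff₀ hc'] at hn₂
    have h1 : (n₂ : ℝ) * c' ≤ 6 * (Fintype.card β * s) * c' :=
      mul_le_mul_of_nonneg_right (by linarith) hc'.le
    refine le_of_mul_le_mul_right (a := 6 * (s : ℝ)) ?_ (by linarith)
    linarith
  obtain ⟨σ, z, T, hσ, hz, hT, hedge⟩ := hblow s hs hs0 V β ψ hψ D _ hD (by positivity) hn6 hβc
    (le_of_eq (by field_simp)) (by
      rw [div_lt_iff₀ (by positivity)] at hn₁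
      refine hn₁.trans_le ?_
      rw [mul_comm]
      exact mul_le_mul_of_nonneg_left (by linarith) (by positivity)) _ hMc
  obtain ⟨G, hGD, hG, hGc, hGr⟩ := exists_gadget (A := A) (P := Popular ((κ / 2) ^ 2) A X)
    (m := m) (t' := τ + 1) (D := D) ht' hψ hM hσ (z := fun p => z (finProdFinEquiv p))
    (fun p q h => finProdFinEquiv.injective (hz h)) (fun j p h => by
      choose a ha using fun p : Fin m × Fin 3 => card_pos.1 (by rw [hT p]; omega : 0 < #(T p))
      have := (hedge (finProdFinEquiv j) (fun i d => a (i, d)) fun i d => ha _).1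
      have h2 := (mem_filter.1 this).2.1
      rw [show z (finProdFinEquiv j) = ψ p from h] at h2
      exact hU p (mem_sdiff.1 h2).1) hT (fun j a ha => by
      obtain ⟨h1, h2, h3⟩ := hedge (finProdFinEquiv j) a ha
      refine ⟨fun k => ?_, h2, h3⟩
      obtain ⟨h4, h5⟩ := (mem_filter.1 h1).2.2 k
      exact ⟨hA.rot h4.2.2, h5⟩)
  refine ⟨G, hGD, hG, hGc, fun b => if ∃ i, σ i = b then 1 else 0, ?_, fun b c => ?_⟩
  · rw [← card_filter]
    have : ({b | ∃ i, σ i = b} : Finset β) = univ.image σ := by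
      ext b; simp
    rw [this]
    exact card_image_le.trans (by simp)
  · refine (hGr b c).trans (le_of_eq ?_)
    by_cases h : ∃ i, σ i = b
    · simp only [if_pos h, one_mul]
    · simp only [if_neg h, zero_mul]

/-- Large robust hypergraphs can be tiled up to an `a`-proportion of their vertices. -/
def TilesUpTo (α ζ a : ℝ) : Prop := ∀ s : ℕ, 0 < s → ∃ n₀ : ℕ, ∀ (V : Type) [Fintype V]
  (A : V → V → V → Prop) (X : V → Finset V), IsHypergraph A → Robust α A X →
  n₀ ≤ Fintype.card V →
  ∃ q : ℕ, HasTiling A (Popular ζ A X) univ s q ∧ a * Fintype.card V ≤ 3 * s * q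

lemma exists_indexing {V β : Type} {B : β → Fin 3 → Finset V} {s : ℕ}
    (hB : ∀ p q : β × Fin 3, p ≠ q → Disjoint (B p.1 p.2) (B q.1 q.2))
    (hc : ∀ b c, #(B b c) = s) :
    ∃ ψ : β × Fin 3 × Fin s → V, Function.Injective ψ ∧
      ∀ b c, univ.image (fun a => ψ (b, c, a)) = B b c := by
  let e : ∀ b c, Fin s ≃ B b c := fun b c =>
    (Fintype.equivFinOfCardEq (by rw [Fintype.card_coe, hc])).symm
  refine ⟨fun p => e p.1 p.2.1 p.2.2, ?_, fun b c => ?_⟩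
  · rintro ⟨b, c, a⟩ ⟨b', c', a'⟩ h
    dsimp only at h
    by_cases hp : (b, c) = (b', c')
    · simp only [Prod.mk.injEq] at hp
      obtain ⟨rfl, rfl⟩ := hp
      rw [(e b c).injective (Subtype.ext h)]
    · have h1 := (e b c a).2
      rw [h] at h1
      exact absurd (e b' c' a').2 (disjoint_left.1 (hB _ _ hp) h1)
  · ext v
    simp only [mem_image, mem_univ, true_and]
    refine ⟨?_, fun hv => ⟨(e b c).symm ⟨v, hv⟩, by simp⟩⟩
    rintro ⟨a, rfl⟩
    exact (e b c a).2

lemma exists_padding {V : Type} [Fintype V] {A : V → V → V → Prop} {P : V → V → Prop} {q s : ℕ}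
    (hs : 0 < s) {κ : ℝ} (hn : 3 * s + 1 ≤ κ * (Fintype.card V : ℝ))
    {T : Fin q → Fin 3 → Finset V} (hT : IsTiling A P univ T) (hTc : ∀ i c, #(T i c) = s)
    (hq : 3 * s * q ≤ (1 - 2 * κ) * (Fintype.card V : ℝ)) :
    ∃ (d : ℕ) (ψ : (Fin q ⊕ Fin d) × Fin 3 × Fin s → V) (U : Finset V), Function.Injective ψ ∧
      (∀ p, ψ p ∉ U) ∧ κ * Fintype.card V ≤ #U ∧
      (Fintype.card V : ℝ) - 3 * (Fintype.card (Fin q ⊕ Fin d) * s) ≤ 2 * κ * Fintype.card V ∧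
      ∀ i c, univ.image (fun a => ψ (.inl i, c, a)) = T i c := by
  set n : ℝ := ((Fintype.card V : ℕ) : ℝ) with hndef
  set C : Finset V := (univ : Finset (Fin q × Fin 3)).biUnion fun p => T p.1 p.2 with hC
  have hCc : #C = q * 3 * s := by
    rw [hC, card_biUnion fun p _ p' _ h => hT.disj p p' h]
    simp [hTc]
  have hCn : #(univ \ C) + #C = Fintype.card V := by
    rw [card_sdiff_add_card_eq_card (subset_univ _), card_univ]
  have hCn' : (#(univ \ C) : ℝ) + 3 * s * q = n := by
    rw [hndef, ← hCn, hCc]; push_cast; ring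
  have hκn : ⌈κ * n⌉₊ < κ * n + 1 := Nat.ceil_lt_add_one (by
    have : (0 : ℝ) ≤ s := Nat.cast_nonneg _
    linarith)
  have hs0 : (0 : ℝ) < s := by exact_mod_cast hs
  obtain ⟨U, hU, hUc⟩ := exists_subset_card_eq (s := univ \ C) (n := ⌈κ * n⌉₊) (by
    refine (Nat.cast_le (α := ℝ)).1 ?_
    linarith)
  set d : ℕ := #((univ \ C) \ U) / (3 * s) with hd
  obtain ⟨Q, hQ, hQd⟩ := exists_disjoint_subsets ((univ \ C) \ U) (d * 3) s (by
    rw [mul_assoc, hd]; exact Nat.div_mul_le_self _ _)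
  have hTC : ∀ i c, T i c ⊆ C := fun i c =>
    subset_biUnion_of_mem (fun p : Fin q × Fin 3 => T p.1 p.2) (mem_univ (i, c))
  have hQC : ∀ i, Disjoint C (Q i) := fun i => by
    refine disjoint_of_subset_right ((hQ i).2.trans sdiff_subset) disjoint_sdiff
  set B : Fin q ⊕ Fin d → Fin 3 → Finset V :=
    Sum.elim T fun i c => Q (finProdFinEquiv (i, c)) with hB
  obtain ⟨ψ, hψ, hψB⟩ := exists_indexing (B := B) (s := s) (by
    rintro ⟨b, c⟩ ⟨b', c'⟩ hne
    rcases b with i | i <;> rcases b' with j | j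
    · exact hT.disj (i, c) (j, c') fun h => hne (by simpa using h)
    · exact disjoint_of_subset_left (hTC i c) (hQC _)
    · exact (disjoint_of_subset_left (hTC j c') (hQC _)).symm
    · exact hQd _ _ fun h => hne (by simpa using finProdFinEquiv.injective h)) (by
    rintro (i | i) c
    · exact hTc i c
    · exact (hQ _).1)
  refine ⟨d, ψ, U, hψ, ?_, ?_, ?_, fun i c => hψB (.inl i) c⟩
  · rintro ⟨b, c, a⟩ hmem
    have h1 : ψ (b, c, a) ∈ B b c := by
      rw [← hψB]; exact mem_image_of_mem (fun a => ψ (b, c, a)) (mem_univ a)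
    rcases b with i | i
    · exact (mem_sdiff.1 (hU hmem)).2 (hTC i c h1)
    · exact (mem_sdiff.1 ((hQ _).2 h1)).2 hmem
  · rw [hUc]; exact Nat.le_ceil _
  · have h1 : #((univ \ C) \ U) + #U = #(univ \ C) := card_sdiff_add_card_eq_card hU
    have h2 : #((univ \ C) \ U) < 3 * s * (d + 1) := by
      rw [hd]; exact Nat.lt_mul_div_succ _ (by omega)
    have h1' : (#((univ \ C) \ U) : ℝ) + ⌈κ * n⌉₊ = #(univ \ C) := by
      rw [← hUc]; exact_mod_cast h1
    have h2' : (#((univ \ C) \ U) : ℝ) < 3 * s * (d + 1) := by exact_mod_cast h2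
    rw [Fintype.card_sum, Fintype.card_fin, Fintype.card_fin]
    push_cast
    linarith

/-- The density of tilings can always be increased by a fixed amount, until it is near `1`. -/
lemma TilesUpTo.exists_step {α κ : ℝ} (hα : 0 < α) (hκ : 0 < κ) (hκα : κ ≤ α / 40)
    (hκ4 : κ ≤ 1 / 4) : ∃ δ, 0 < δ ∧ ∀ a ≤ 1 - 3 * κ, TilesUpTo α ((κ / 2) ^ 2) a →
      TilesUpTo α ((κ / 2) ^ 2) (a + δ) := by
  obtain ⟨m, ε, hε, haug⟩ := exists_augmentation hα hκ hκα hκ4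
  have hm1 : (0 : ℝ) < 4 * m + 1 := by positivity
  refine ⟨min κ (ε / (4 * m + 1)), by positivity, fun a ha htile t' ht' => ?_⟩
  set δ := min κ (ε / (4 * m + 1)) with hδ
  obtain ⟨s₀, haug⟩ := haug t' ht'
  set s : ℕ := (s₀ + 1) * t' with hs
  have hs0 : 0 < s := Nat.mul_pos (by omega) ht'
  obtain ⟨n₁, haug⟩ := haug s (by rw [hs]; nlinarith) hs0
  obtain ⟨n₂, htile⟩ := htile s hs0
  obtain ⟨n₃, hn₃⟩ := exists_nat_ge ((3 * s + 1) / κ)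
  obtain ⟨n₄, hn₄⟩ := exists_nat_ge (((4 * m + 1) * t' + 1) / ε)
  rw [div_le_iff₀ hκ] at hn₃
  rw [div_le_iff₀ hε] at hn₄
  refine ⟨n₁ + n₂ + n₃ + n₄, ?_⟩
  intro V _ A X hA hR hn
  obtain ⟨q, ⟨T, hT, hTc⟩, hq⟩ := htile V A X hA hR (by omega)
  have hn3 : (n₃ : ℝ) ≤ Fintype.card V := Nat.cast_le.2 (by omega)
  have hn4 : (n₄ : ℝ) ≤ Fintype.card V := Nat.cast_le.2 (by omega)
  set n : ℝ := ((Fintype.card V : ℕ) : ℝ) with hndef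
  have hn0 : 0 ≤ n := Nat.cast_nonneg _
  have hs' : (s : ℝ) = (s₀ + 1) * t' := by rw [hs]; push_cast; ring
  by_cases hbig : (a + δ) * n ≤ 3 * s * q
  · refine ⟨_, hT.hasTiling (fun _ => s₀ + 1) fun b c => (hTc b c).ge, hbig.trans (le_of_eq ?_)⟩
    rw [sum_const, card_univ, Fintype.card_fin, hs']
    simp only [smul_eq_mul, Nat.cast_mul]
    push_cast
    ring
  have hκδ : a + δ ≤ 1 - 2 * κ := by
    have := min_le_left κ (ε / (4 * m + 1))
    linarith
  obtain ⟨d, ψ, U, hψ, hψU, hUc, hcov, himg⟩ := exists_padding hs0 (κ := κ) (by nlinarith) hT hTc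
    ((not_le.1 hbig).le.trans (mul_le_mul_of_nonneg_right hκδ hn0))
  have hstep : ∀ D : Finset V, #D ≤ ⌊ε * n⌋₊ → ∃ G : Finset V, Disjoint G D ∧
      HasTiling A (Popular ((κ / 2) ^ 2) A X) G t' (m + 1) ∧ #G ≤ (4 * m + 1) * t' ∧
      ∃ r : Fin q ⊕ Fin d → ℕ, ∑ b, r b ≤ m ∧
        ∀ b c, #(univ.image (fun a => ψ (b, c, a)) ∩ G) ≤ r b * t' := fun D hD =>
    haug V _ A X hA hR (by omega) ψ hψ U hψU hUc hcov D
      ((Nat.cast_le.2 hD).trans (Nat.floor_le (mul_nonneg hε.le hn0)))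
  set C : ℕ := (4 * m + 1) * t' with hC
  have hC0 : 0 < C := Nat.mul_pos (by omega) ht'
  set g : ℕ := ⌊ε * n⌋₊ / C with hg
  obtain ⟨D, hD, -, r, hr, hrD⟩ := exists_many_gadgets hstep g (Nat.mul_div_le _ _)
  obtain ⟨k, hk, hqk⟩ := HasTiling.extend_of_gadgets hT hTc hs hD Sum.inl Sum.inl_injective hr
    (fun i c => by rw [← himg]; exact hrD _ c)
  refine ⟨k, hk, ?_⟩
  have hg1 : 1 ≤ g := by
    rw [hg, Nat.one_le_div_iff hC0]
    refine Nat.le_floor ?_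
    rw [hC]; push_cast
    nlinarith
  have hgN : ⌊ε * n⌋₊ < C * (g + 1) := Nat.lt_mul_div_succ _ hC0
  have hgN' : (⌊ε * n⌋₊ : ℝ) + 1 ≤ C * (g + 1) := by exact_mod_cast hgN
  have hfl := Nat.lt_floor_add_one (ε * n)
  have hδn : δ * n ≤ t' * (g + 1) := by
    have h1 : δ * n ≤ ε / (4 * m + 1) * n := mul_le_mul_of_nonneg_right (min_le_right _ _) hn0
    refine h1.trans ?_
    rw [div_mul_eq_mul_div, div_le_iff₀ hm1]
    have : (C : ℝ) = (4 * m + 1) * t' := by rw [hC]; push_cast; ring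
    rw [this] at hgN'
    linarith
  have hqk' : (q : ℝ) * (s₀ + 1) + g ≤ k := by exact_mod_cast hqk
  have hg1' : (1 : ℝ) ≤ g := by exact_mod_cast hg1
  have ht0 : (0 : ℝ) < t' := by exact_mod_cast ht'
  have h1 := mul_le_mul_of_nonneg_left hqk' ht0.le
  have h2 := mul_le_mul_of_nonneg_left hg1' ht0.le
  rw [hs'] at hq
  nlinarith

/-- Large robust hypergraphs have tilings of density close to `1`. -/
lemma tilesUpTo_near_one {α κ : ℝ} (hα : 0 < α) (hκ : 0 < κ) (hκα : κ ≤ α / 40)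
    (hκ4 : κ ≤ 1 / 4) : TilesUpTo α ((κ / 2) ^ 2) (1 - 3 * κ) := by
  obtain ⟨δ, hδ, hstep⟩ := TilesUpTo.exists_step hα hκ hκα hκ4
  have mono : ∀ a b, a ≤ b → TilesUpTo α ((κ / 2) ^ 2) b → TilesUpTo α ((κ / 2) ^ 2) a := by
    intro a b hab h s hs
    obtain ⟨n₀, h⟩ := h s hs
    refine ⟨n₀, fun V _ A X hA hR hn => ?_⟩
    obtain ⟨q, hq, hqn⟩ := h V A X hA hR hn
    exact ⟨q, hq, (mul_le_mul_of_nonneg_right hab (Nat.cast_nonneg _)).trans hqn⟩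
  have key : ∀ k : ℕ, TilesUpTo α ((κ / 2) ^ 2) (min (1 - 3 * κ) (k * δ)) := by
    intro k
    induction k with
    | zero =>
      refine mono _ 0 (by simp) fun s hs => ⟨0, fun V _ A X _ _ _ => ⟨0, ?_, by simp⟩⟩
      exact ⟨fun i => i.elim0, ⟨fun i => i.elim0, fun p => p.1.elim0, fun i => i.elim0⟩,
        fun i => i.elim0⟩
    | succ k ih =>
      refine mono _ _ ?_ (hstep _ (min_le_left _ _) ih)
      rw [← min_add_add_right]
      refine min_le_min (by linarith) (le_of_eq ?_)
      push_cast; ring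
  obtain ⟨k, hk⟩ := exists_nat_ge ((1 - 3 * κ) / δ)
  rw [div_le_iff₀ hδ] at hk
  exact min_eq_left hk ▸ key k

section Assembly
variable {V : Type}

lemma HasTiling.card_le [Fintype V] {A : V → V → V → Prop} {P : V → V → Prop} {W : Finset V}
    {s q : ℕ} (h : HasTiling A P W s q) : 3 * s * q ≤ Fintype.card V := by
  obtain ⟨T, hT, hc⟩ := h
  have h1 : #((univ : Finset (Fin q × Fin 3)).biUnion fun p => T p.1 p.2) = q * 3 * s := by
    rw [card_biUnion fun p _ p' _ h => hT.disj p p' h]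
    simp [hc]
  have h2 := card_le_univ ((univ : Finset (Fin q × Fin 3)).biUnion fun p => T p.1 p.2)
  rw [h1] at h2
  linarith

lemma isHypergraph_of_card [DecidableEq V] {E : Finset (Finset V)} (hE : ∀ e ∈ E, #e = 3) :
    IsHypergraph fun x y z => ({x, y, z} : Finset V) ∈ E := by
  refine ⟨fun {x y z} h => ?_, fun {x y z} h => ?_, fun {x y z} h hxy => ?_⟩
  · rwa [show ({y, z, x} : Finset V) = {x, y, z} by ext; simp; tauto]
  · rwa [show ({y, x, z} : Finset V) = {x, y, z} by ext; simp; tauto]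
  · have := hE _ h
    rw [hxy, insert_eq_of_mem (mem_insert_self _ _)] at this
    have h2 := card_le_two (a := y) (b := z)
    omega

lemma two_mul_degree_le [Fintype V] [DecidableEq V] {E : Finset (Finset V)}
    (hE : ∀ e ∈ E, #e = 3) (u : V) {G : V → V → Prop}
    (hG : ∀ x y, G x y ↔ ({u, x, y} : Finset V) ∈ E) :
    2 * (#(E.filter (u ∈ ·)) : ℝ) ≤ weight (fun x y => if G x y then 1 else 0) univ univ := by
  rw [weight_ite_eq_card]
  set C : Finset (V × V) := {q ∈ univ ×ˢ univ | G q.1 q.2} with hC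
  have hmem : ∀ q, q ∈ C ↔ ({u, q.1, q.2} : Finset V) ∈ E := fun q => by
    simp [hC, hG]
  have h1 := card_nsmul_le_sum (E.filter (u ∈ ·))
    (fun e => #(C.filter fun q => ({u, q.1, q.2} : Finset V) = e)) 2 (by
      intro e he
      obtain ⟨he, hu⟩ := mem_filter.1 he
      have h2 : #(e.erase u) = 2 := by rw [card_erase_of_mem hu, hE e he]
      obtain ⟨x, y, hxy, hexy⟩ := card_eq_two.1 h2
      have h3 : ({u, x, y} : Finset V) = e := by rw [← hexy, insert_erase hu]
      have h4 : ({u, y, x} : Finset V) = e := by rw [pair_comm, h3]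
      exact one_lt_card.2 ⟨(x, y), mem_filter.2 ⟨(hmem _).2 (by rw [h3]; exact he), h3⟩, (y, x),
        mem_filter.2 ⟨(hmem _).2 (by rw [h4]; exact he), h4⟩, fun h => hxy (Prod.mk.inj h).1⟩)
  rw [← card_eq_sum_card_fiberwise (fun q hq =>
    mem_filter.2 ⟨(hmem q).1 hq, mem_insert_self _ _⟩), smul_eq_mul] at h1
  rw [mul_comm]
  exact_mod_cast h1

end Assembly

/-- Robust hypergraphs whose links are pairwise sharing edges and well connected have almost
spanning tight cycles. -/
lemma exists_cycle_of_robust {α c : ℝ} (I : ℕ) (hα : 0 < α) (hα1 : α ≤ 1) (hc : 0 < c) :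
    ∃ n₀ : ℕ, ∀ (V : Type) [Fintype V] (A : V → V → V → Prop) (X : V → Finset V),
    IsHypergraph A → Robust α A X → n₀ ≤ Fintype.card V →
    (∀ u, ∀ v ∈ X u, ∀ a ∈ X u, ∃ j ≤ I, c * (Fintype.card V : ℝ) ^ (2 * j) ≤
      #{p : Fin (2 * j) → V | Walk (A u) v (List.ofFn p) a}) →
    ∃ (ℓ : ℕ) (f : ZMod ℓ → V), Function.Injective f ∧
      (∀ i, A (f i) (f (i + 1)) (f (i + 2))) ∧ (1 - α) * Fintype.card V ≤ ℓ := by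
  have hκ : 0 < α / 40 := by linarith
  obtain ⟨ε, n₁, L, hε, hpath⟩ := exists_path_of_sharing (I := I) hc
    (ζ := (α / 40 / 2) ^ 2) (by positivity) hα
  obtain ⟨s₁, hs₁⟩ := exists_nat_ge ((5 + L) / (3 * ε))
  obtain ⟨s₂, hs₂⟩ := exists_nat_ge ((6 + 3 * L) / α)
  rw [div_le_iff₀ (by positivity)] at hs₁
  rw [div_le_iff₀ hα] at hs₂
  obtain ⟨n₂, htile⟩ := tilesUpTo_near_one hα hκ le_rfl (by linarith) (s₁ + s₂ + 2) (by omega)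
  refine ⟨n₁ + n₂ + 1, fun V _ A X hA hR hn hwalk => ?_⟩
  obtain ⟨q, hT, hq⟩ := htile V A X hA hR (by omega)
  have hn0 : (1 : ℝ) ≤ Fintype.card V := by exact_mod_cast (by omega : 1 ≤ Fintype.card V)
  have hqn : (3 * ((s₁ + s₂ + 2 : ℕ) : ℝ) * q) ≤ Fintype.card V := by exact_mod_cast hT.card_le
  have hpath := hpath V A X hA (by omega) hwalk fun u v =>
    (card_common_edges (hR.large u) (hR.large v) (hR.dense u) (hR.dense v)).trans
      (Nat.cast_le.2 (card_le_card fun q hq => by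
        have h := (mem_filter.1 hq).2
        exact mem_filter.2 ⟨mem_univ _, ⟨h.1.1, h.1.2.1, h.1.2.2⟩, h.2⟩))
  set n : ℝ := ((Fintype.card V : ℕ) : ℝ) with hndef
  have hq0 : 0 < q := by
    rw [Nat.pos_iff_ne_zero]
    rintro rfl
    rw [Nat.cast_zero, mul_zero] at hq
    nlinarith
  have hq0' : (0 : ℝ) < q := by exact_mod_cast hq0
  push_cast at hq hqn
  have hs1n : (0 : ℝ) ≤ s₁ := Nat.cast_nonneg _
  have hs2n : (0 : ℝ) ≤ s₂ := Nat.cast_nonneg _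
  have h1 : (5 + L : ℝ) * q ≤ ε * n := by
    have h2 := mul_le_mul_of_nonneg_right hs₁ hq0'.le
    have h3 : (s₁ : ℝ) * q * 3 ≤ n := by nlinarith
    have h4 := mul_le_mul_of_nonneg_left h3 hε.le
    nlinarith
  obtain ⟨ℓ, f, hf, hfA, hℓ⟩ := exists_cycle_of_hasTiling hA (N := ⌊ε * n⌋₊)
    (fun x y z w hxy hzw F hF => hpath x y z w hxy hzw F
      ((Nat.cast_le.2 hF).trans (Nat.floor_le (by positivity)))) hT (by omega) hq0
    (Nat.le_floor (by push_cast; exact h1))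
  refine ⟨ℓ, f, hf, hfA, ?_⟩
  have hℓ' : 3 * ((s₁ : ℝ) + s₂ + 2) * q ≤ ℓ + (6 + 3 * L) * q := by exact_mod_cast hℓ
  have h2 : (6 + 3 * L : ℝ) * q ≤ α / 3 * n := by
    have h2 := mul_le_mul_of_nonneg_right hs₂ hq0'.le
    have h3 : (s₂ : ℝ) * q * 3 ≤ n := by nlinarith
    have h4 := mul_le_mul_of_nonneg_left h3 hα.le
    nlinarith
  nlinarith

lemma exists_cycle_of_degree {η : ℝ} (hη : 0 < η) (hη1 : η ≤ 1) :
    ∃ n₀ : ℕ, ∀ (V : Type) [Fintype V] [DecidableEq V] (E : Finset (Finset V)),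
    (∀ e ∈ E, #e = 3) → n₀ ≤ Fintype.card V →
    (∀ v, (5 / 9 + η) * ((Fintype.card V).choose 2 : ℝ) ≤ #(E.filter (v ∈ ·))) →
    ∃ (ℓ : ℕ) (f : ZMod ℓ → V), Function.Injective f ∧
      (∀ i, ({f i, f (i + 1), f (i + 2)} : Finset V) ∈ E) ∧
      (1 - η) * Fintype.card V ≤ ℓ := by
  obtain ⟨I, c, hc, hrob⟩ := exists_robust_set (α := η / 2) (by linarith)
  obtain ⟨n₁, hcyc⟩ := exists_cycle_of_robust I (α := η / 2) (by linarith) (by linarith) hc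
  obtain ⟨n₂, hn₂⟩ := exists_nat_ge (4 / η)
  rw [div_le_iff₀ hη] at hn₂
  refine ⟨n₁ + n₂ + 6, fun V _ _ E hE hn hdeg => ?_⟩
  have hA := isHypergraph_of_card hE
  have hn2 : (n₂ : ℝ) ≤ Fintype.card V := Nat.cast_le.2 (by omega)
  have hch : ((Fintype.card V).choose 2 : ℝ) =
      (Fintype.card V : ℝ) * ((Fintype.card V : ℝ) - 1) / 2 := Nat.cast_choose_two ℝ _
  have hlink := fun u => hrob V (fun x y => ({u, x, y} : Finset V) ∈ E)
    (fun x y h => hA.rot (hA.swap h)) (by omega) (by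
      have h1 := hdeg u
      rw [hch] at h1
      refine le_trans ?_ (two_mul_degree_le hE u fun _ _ => Iff.rfl)
      have h2 : 4 ≤ (Fintype.card V : ℝ) * η :=
        hn₂.trans (mul_le_mul_of_nonneg_right hn2 hη.le)
      have h3 := mul_le_mul_of_nonneg_right h2 (Nat.cast_nonneg (Fintype.card V) : (0 : ℝ) ≤ _)
      have h4 := mul_le_mul_of_nonneg_right hη1 (Nat.cast_nonneg (Fintype.card V) : (0 : ℝ) ≤ _)
      nlinarith)
  choose X hX using hlink
  obtain ⟨ℓ, f, hf, hfE, hℓ⟩ := hcyc V _ X hA ⟨fun u => by exact_mod_cast (hX u).1, fun u => (hX u).2.1⟩ (by omega) (fun u => (hX u).2.2)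
  exact ⟨ℓ, f, hf, hfE, le_trans (mul_le_mul_of_nonneg_right (by linarith) (Nat.cast_nonneg _)) hℓ⟩

end TightCycle

/-- **Theorem (main).** For every real `η > 0` there exists `n₀` such that every
3-uniform hypergraph `H` on `n ≥ n₀` vertices with minimum vertex degree at least
`(5/9 + η) · (n choose 2)` contains a tight cycle of length at least `(1 - η) · n`.
A tight cycle of length `ℓ` is an injective map `f : ZMod ℓ → V` such that every
triple of cyclically consecutive vertices forms an edge. -/
theorem vertex_degree_almost_spanning_tight_cycle :
    ∀ η : ℝ, 0 < η → ∃ n₀ : ℕ, ∀ (V : Type) [Fintype V] [DecidableEq V],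
      ∀ E : Finset (Finset V), (∀ e ∈ E, e.card = 3) →
        n₀ ≤ Fintype.card V →
        (∀ v : V, ((5 : ℝ) / 9 + η) * ((Fintype.card V).choose 2) ≤
            ((E.filter (fun e => v ∈ e)).card : ℝ)) →
        ∃ (ℓ : ℕ) (f : ZMod ℓ → V), Function.Injective f ∧
          (∀ i : ZMod ℓ, ({f i, f (i + 1), f (i + 2)} : Finset V) ∈ E) ∧
          (1 - η) * (Fintype.card V : ℝ) ≤ (ℓ : ℝ) := by
  intro η hη
  obtain ⟨n₀, h⟩ := TightCycle.exists_cycle_of_degree (η := min η 1) (lt_min hη one_pos)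
    (min_le_right _ _)
  refine ⟨n₀, fun V _ _ E hE hn hdeg => ?_⟩
  obtain ⟨ℓ, f, hf, hfE, hℓ⟩ := h V E hE hn fun v =>
    (mul_le_mul_of_nonneg_right (by linarith [min_le_left η 1]) (Nat.cast_nonneg _)).trans (hdeg v)
  exact ⟨ℓ, f, hf, hfE,
    (mul_le_mul_of_nonneg_right (by linarith [min_le_left η 1]) (Nat.cast_nonneg _)).trans hℓ⟩
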